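/- Let A be an Artin algebra, P• a 2-term separating silting complex in K^b(proj A), and B = End_{D^b(A)}(P•). If every module X in the torsion-free class ℱ(P•) has injective dimension at most 1, then ed(A) = ed(B). -/

import Mathlib

universe u

open CategoryTheory

namespace Paper

variable (A : Type u) [Ring A]

/-- `X` belongs to `add 𝒮`: it is a direct summand of a finite direct sum of members of `𝒮`. -/
def memAdd (S : Set (ModuleCat.{u} A)) (X : ModuleCat.{u} A) : Prop :=
  ∃ (n : ℕ) (M : Fin n → ModuleCat.{u} A) (Y : ModuleCat.{u} A),
    (∀ i, M i ∈ S) ∧ Nonempty ((X × Y) ≃ₗ[A] ((i : Fin n) → M i))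

/-- `add T` for a single module `T`. -/
def addOf (T : ModuleCat.{u} A) : Set (ModuleCat.{u} A) :=
  {X | memAdd A {T} X}

/-- `0 → X → Y → Z → 0` is a short exact sequence. -/
def IsSES {X Y Z : ModuleCat.{u} A} (f : X →ₗ[A] Y) (g : Y →ₗ[A] Z) : Prop :=
  Function.Injective f ∧ Function.Surjective g ∧ LinearMap.range f = LinearMap.ker g

/-- The extension product `𝒮 • 𝒯` of two classes of modules. -/
def bullet (S T : Set (ModuleCat.{u} A)) : Set (ModuleCat.{u} A) :=
  {X | memAdd A {W | Module.Finite A W ∧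
    ∃ (T₁ T₂ : ModuleCat.{u} A) (f : T₁ →ₗ[A] W) (g : W →ₗ[A] T₂),
      T₁ ∈ S ∧ T₂ ∈ T ∧ IsSES A f g} X}

/-- `[T]ₙ`. -/
def bracket (T : ModuleCat.{u} A) : ℕ → Set (ModuleCat.{u} A)
  | 0 => {X | Subsingleton X}
  | 1 => addOf A T
  | (n+2) => bullet A (addOf A T) (bracket T (n+1))

/-- The extension dimension of `A`. -/
noncomputable def extDim : ℕ∞ :=
  sInf {d : ℕ∞ | ∃ n : ℕ, d = n ∧ ∃ T : ModuleCat.{u} A, Module.Finite A T ∧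
    ∀ X : ModuleCat.{u} A, Module.Finite A X → X ∈ bracket A T (n + 1)}

/-- There is an exact sequence `0 → M_n → ⋯ → M_0 → X → 0` with all `M_i ∈ add M`. -/
def ResLen (M : ModuleCat.{u} A) : ModuleCat.{u} A → ℕ → Prop
  | X, 0 => X ∈ addOf A M
  | X, (n+1) => ∃ (M₀ : ModuleCat.{u} A) (g : M₀ →ₗ[A] X),
      M₀ ∈ addOf A M ∧ Function.Surjective g ∧
        ResLen M (ModuleCat.of A (LinearMap.ker g)) n

/-- `M`-wrd(X) ≤ n : there is an exact sequence `0 → M_n → ⋯ → M_0 → X ⊕ Y → 0`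
with all `M_i ∈ add M`. -/
def wrdLE (M X : ModuleCat.{u} A) (n : ℕ) : Prop :=
  ∃ Y : ModuleCat.{u} A, Module.Finite A Y ∧ ResLen A M (ModuleCat.of A (X × Y)) n

/-- The weak `M`-resolution dimension of `X`. -/
noncomputable def wrdMod (M X : ModuleCat.{u} A) : ℕ∞ :=
  sInf {d : ℕ∞ | ∃ n : ℕ, d = n ∧ wrdLE A M X n}

/-- The weak `M`-resolution dimension of the algebra `A`. -/
noncomputable def wrdAlg (M : ModuleCat.{u} A) : ℕ∞ :=
  sSup {d : ℕ∞ | ∃ X : ModuleCat.{u} A, Module.Finite A X ∧ d = wrdMod A M X}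

/-- The weak resolution dimension of `A`. -/
noncomputable def wrd : ℕ∞ :=
  sInf {d : ℕ∞ | ∃ M : ModuleCat.{u} A, Module.Finite A M ∧ d = wrdAlg A M}

end Paper

open CategoryTheory Pretriangulated in
/-- The thick (triangulated, retract-closed) closure of a set of objects in the
homotopy category of complexes of `A`-modules. -/
def Paper.triThick (A : Type u) [Ring A]
    (G : Set (HomotopyCategory (ModuleCat.{u} A) (ComplexShape.up ℤ))) :
    Set (HomotopyCategory (ModuleCat.{u} A) (ComplexShape.up ℤ)) :=
  ⋂₀ {S : Set (HomotopyCategory (ModuleCat.{u} A) (ComplexShape.up ℤ)) |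
    G ⊆ S ∧ (∀ (n : ℤ) X, X ∈ S → X⟦n⟧ ∈ S) ∧
    (∀ T ∈ (distTriang (HomotopyCategory (ModuleCat.{u} A) (ComplexShape.up ℤ))),
      T.obj₁ ∈ S → T.obj₂ ∈ S → T.obj₃ ∈ S) ∧
    (∀ X Y, X ∈ S → (∃ (s : Y ⟶ X) (r : X ⟶ Y), s ≫ r = 𝟙 Y) → Y ∈ S)}

/-- A nonzero module is indecomposable if whenever it is isomorphic to a direct
product of two modules, one of the factors is zero. -/
def Paper.Indec (A : Type u) [Ring A] (X : ModuleCat.{u} A) : Prop :=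
  Nontrivial X ∧ ∀ (Y Z : ModuleCat.{u} A),
    Nonempty (X ≃ₗ[A] (Y × Z)) → Subsingleton Y ∨ Subsingleton Z

/-- Injective dimension at most one: there is an exact sequence
`0 → X → I⁰ → I¹ → 0` with `I⁰`, `I¹` injective. -/
def Paper.IdLEOne (A : Type u) [Ring A] (X : ModuleCat.{u} A) : Prop :=
  ∃ (I₀ I₁ : ModuleCat.{u} A) (f : X →ₗ[A] I₀) (g : I₀ →ₗ[A] I₁),
    Module.Injective A I₀ ∧ Module.Injective A I₁ ∧ Paper.IsSES A f g

section

open CategoryTheory Limits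
open scoped ZeroObject

namespace Paper

section Through

universe v w v' w'

variable {C : Type w} [Category.{v} C] [Preadditive C]
variable {D : Type w'} [Category.{v'} D] [Preadditive D]

/-- The morphisms `X ⟶ Y` that are finite sums of morphisms factoring through `M`. -/
def through (M X Y : C) : AddSubgroup (X ⟶ Y) :=
  AddSubgroup.closure {f | ∃ (a : X ⟶ M) (b : M ⟶ Y), f = a ≫ b}

/-- `X` is a direct summand of a finite direct sum of copies of `M`. -/
def IsAdd (M X : C) : Prop := 𝟙 X ∈ through M X X

lemma through_of_comp {M X Y : C} (a : X ⟶ M) (b : M ⟶ Y) : a ≫ b ∈ through M X Y :=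
  AddSubgroup.subset_closure ⟨a, b, rfl⟩

lemma through_comp_left {M X X' Y : C} {f : X ⟶ Y} (hf : f ∈ through M X Y) (g : X' ⟶ X) :
    g ≫ f ∈ through M X' Y := by
  induction hf using AddSubgroup.closure_induction with
  | mem f hf =>
    obtain ⟨a, b, rfl⟩ := hf
    rw [← Category.assoc]
    exact through_of_comp _ _
  | zero => simp
  | add f f' _ _ h h' => rw [Preadditive.comp_add]; exact add_mem h h'
  | neg f _ h => rw [Preadditive.comp_neg]; exact neg_mem h

lemma through_comp_right {M X Y Y' : C} {f : X ⟶ Y} (hf : f ∈ through M X Y) (g : Y ⟶ Y') :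
    f ≫ g ∈ through M X Y' := by
  induction hf using AddSubgroup.closure_induction with
  | mem f hf =>
    obtain ⟨a, b, rfl⟩ := hf
    rw [Category.assoc]
    exact through_of_comp _ _
  | zero => simp
  | add f f' _ _ h h' => rw [Preadditive.add_comp]; exact add_mem h h'
  | neg f _ h => rw [Preadditive.neg_comp]; exact neg_mem h

lemma IsAdd.comp_mem {M E X Y : C} (hE : IsAdd M E) (a : X ⟶ E) (b : E ⟶ Y) :
    a ≫ b ∈ through M X Y := by
  have := through_comp_left (through_comp_right hE b) a
  simpa using this

lemma IsAdd.through_le {M N X Y : C} (h : IsAdd N M) : through M X Y ≤ through N X Y := by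
  rw [through, AddSubgroup.closure_le]
  rintro _ ⟨a, b, rfl⟩
  exact h.comp_mem a b

lemma IsAdd.refl (M : C) : IsAdd M M := by
  simpa [IsAdd] using through_of_comp (𝟙 M) (𝟙 M)

lemma IsAdd.trans {M N X : C} (h : IsAdd N M) (h' : IsAdd M X) : IsAdd N X :=
  h.through_le h'

lemma IsAdd.of_retract {M X Y : C} (h : IsAdd M Y) (r : Retract X Y) : IsAdd M X := by
  have := h.comp_mem r.i r.r
  rwa [r.retract] at this

lemma IsAdd.of_iso {M X Y : C} (h : IsAdd M Y) (e : X ≅ Y) : IsAdd M X :=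
  h.of_retract ⟨e.hom, e.inv, by simp⟩

lemma IsAdd.of_isZero {M X : C} (h : IsZero X) : IsAdd M X := by
  rw [IsAdd, h.eq_of_src (𝟙 X) 0]; exact zero_mem _

/-- A relative biproduct decomposition. -/
lemma IsAdd.of_decomp {M X U V : C} (hU : IsAdd M U) (hV : IsAdd M V)
    (p : X ⟶ U) (i : U ⟶ X) (q : X ⟶ V) (j : V ⟶ X) (h : p ≫ i + q ≫ j = 𝟙 X) :
    IsAdd M X := by
  rw [IsAdd, ← h]
  exact add_mem (hU.comp_mem _ _) (hV.comp_mem _ _)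

lemma IsAdd.biprod [HasBinaryBiproducts C] {M U V : C} (hU : IsAdd M U) (hV : IsAdd M V) :
    IsAdd M (U ⊞ V) :=
  hU.of_decomp hV biprod.fst biprod.inl biprod.snd biprod.inr (biprod.total)

lemma IsAdd.inl [HasBinaryBiproducts C] {M N X : C} (h : IsAdd M X) : IsAdd (M ⊞ N) X :=
  IsAdd.trans ((IsAdd.refl (M ⊞ N)).of_retract ⟨biprod.inl, biprod.fst, by simp⟩) h

lemma IsAdd.inr [HasBinaryBiproducts C] {M N X : C} (h : IsAdd N X) : IsAdd (M ⊞ N) X :=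
  IsAdd.trans ((IsAdd.refl (M ⊞ N)).of_retract ⟨biprod.inr, biprod.snd, by simp⟩) h

lemma through_map (Φ : C ⥤ D) [Φ.Additive] {M X Y : C} {f : X ⟶ Y} (hf : f ∈ through M X Y) :
    Φ.map f ∈ through (Φ.obj M) (Φ.obj X) (Φ.obj Y) := by
  induction hf using AddSubgroup.closure_induction with
  | mem f hf =>
    obtain ⟨a, b, rfl⟩ := hf
    rw [Φ.map_comp]
    exact through_of_comp _ _
  | zero => simp
  | add f f' _ _ h h' => rw [Φ.map_add]; exact add_mem h h'
  | neg f _ h => rw [Φ.map_neg]; exact neg_mem h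

lemma IsAdd.map (Φ : C ⥤ D) [Φ.Additive] {M X : C} (h : IsAdd M X) :
    IsAdd (Φ.obj M) (Φ.obj X) := by
  have := through_map Φ h
  rwa [Φ.map_id] at this

lemma through_op {M X Y : C} {f : X ⟶ Y} (hf : f ∈ through M X Y) :
    f.op ∈ through (Opposite.op M) (Opposite.op Y) (Opposite.op X) := by
  induction hf using AddSubgroup.closure_induction with
  | mem f hf =>
    obtain ⟨a, b, rfl⟩ := hf
    rw [op_comp]
    exact through_of_comp _ _
  | zero => simp
  | add f f' _ _ h h' => rw [op_add]; exact add_mem h h'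
  | neg f _ h => rw [op_neg]; exact neg_mem h

lemma through_unop {M X Y : Cᵒᵖ} {f : X ⟶ Y} (hf : f ∈ through M X Y) :
    f.unop ∈ through M.unop Y.unop X.unop := by
  induction hf using AddSubgroup.closure_induction with
  | mem f hf =>
    obtain ⟨a, b, rfl⟩ := hf
    rw [unop_comp]
    exact through_of_comp _ _
  | zero => simp
  | add f f' _ _ h h' => rw [unop_add]; exact add_mem h h'
  | neg f _ h => rw [unop_neg]; exact neg_mem h

lemma IsAdd.op {M X : C} (h : IsAdd M X) : IsAdd (Opposite.op M) (Opposite.op X) :=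
  through_op h

lemma IsAdd.unop {M X : Cᵒᵖ} (h : IsAdd M X) : IsAdd M.unop X.unop :=
  through_unop h

end Through

section Filt

universe v w

variable {C : Type w} [Category.{v} C] [Abelian C]

/-- `Filt M n X`: `X` has a filtration of length `n` with subquotients in `add M`. -/
inductive Filt (M : C) : ℕ → C → Prop
  | zero {X : C} (h : IsZero X) : Filt M 0 X
  | succ {n : ℕ} (S : ShortComplex C) (hS : S.ShortExact) (h₁ : IsAdd M S.X₁)
      (h₃ : Filt M n S.X₃) : Filt M (n + 1) S.X₂

variable {M N : C} {n : ℕ}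

lemma Filt.mono (h : IsAdd N M) {X : C} (hX : Filt M n X) : Filt N n X := by
  induction hX with
  | zero h => exact .zero h
  | succ S hS h₁ _ ih => exact .succ S hS (h.trans h₁) ih

lemma Filt.of_iso {X Y : C} (hX : Filt M n X) (e : X ≅ Y) : Filt M n Y := by
  cases hX with
  | zero h => exact .zero (h.of_iso e.symm)
  | succ S hS h₁ h₃ =>
    let S' := ShortComplex.mk (S.f ≫ e.hom) (e.inv ≫ S.g) (by simp)
    let i : S ≅ S' := ShortComplex.isoMk (Iso.refl _) e (Iso.refl _) (by simp [S']) (by simp [S'])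
    exact .succ S' (ShortComplex.shortExact_of_iso i hS) h₁ h₃

lemma shortExact_id_zero (X : C) :
    (ShortComplex.mk (𝟙 X) (0 : X ⟶ (0 : C)) (by simp)).ShortExact :=
  (ShortComplex.Splitting.mk (S := ShortComplex.mk (𝟙 X) (0 : X ⟶ (0 : C)) (by simp))
    (𝟙 X) 0 (by simp) (by apply (isZero_zero C).eq_of_tgt) (by simp)).shortExact

lemma Filt.of_isAdd {X : C} (h : IsAdd M X) : Filt M 1 X :=
  .succ _ (shortExact_id_zero X) h (.zero (isZero_zero C))

lemma Filt.isAdd {X : C} (h : Filt M 1 X) : IsAdd M X := by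
  rcases h with _ | ⟨S, hS, h₁, h₃⟩
  rcases h₃ with ⟨h⟩
  have := hS.mono_f
  have : Epi S.f := hS.exact.epi_f (h.eq_of_tgt _ _)
  have : IsIso S.f := isIso_of_mono_of_epi _
  exact h₁.of_iso (asIso S.f).symm

/-- The pushout-type construction: given `X ⟶ W` mono with cokernel `Y` and
`X₁ ⟶ X` mono with cokernel `X₃`, the quotient `W / X₁` is an extension of `Y` by `X₃`. -/
lemma exists_quotient_shortExact (S S' : ShortComplex C) (hS : S.ShortExact)
    (hS' : S'.ShortExact) (e : S.X₂ ≅ S'.X₁) :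
    ∃ (Z : C) (p : S'.X₂ ⟶ Z) (i : S.X₃ ⟶ Z) (q : Z ⟶ S'.X₃)
      (w : (S.f ≫ e.hom ≫ S'.f) ≫ p = 0) (w' : i ≫ q = 0),
      (ShortComplex.mk _ _ w).ShortExact ∧ (ShortComplex.mk _ _ w').ShortExact := by
  have := hS.mono_f
  have := hS'.mono_f
  have := hS.epi_g
  have := hS'.epi_g
  let m := S.f ≫ e.hom ≫ S'.f
  have hm : Mono m := inferInstance
  have h1 : S.f ≫ (e.hom ≫ S'.f ≫ cokernel.π m) = 0 := by
    rw [← cokernel.condition m]; simp only [m, Category.assoc]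
  let i : S.X₃ ⟶ cokernel m := hS.exact.desc _ h1
  have hi : S.g ≫ i = e.hom ≫ S'.f ≫ cokernel.π m := hS.exact.g_desc _ _
  let q : cokernel m ⟶ S'.X₃ := cokernel.desc m S'.g (by simp [m])
  have hq : cokernel.π m ≫ q = S'.g := cokernel.π_desc _ _ _
  have hiq : i ≫ q = 0 := by
    rw [← cancel_epi S.g, reassoc_of% hi, hq]; simp
  have ex1 : (ShortComplex.mk m (cokernel.π m) (cokernel.condition m)).ShortExact :=
    { exact := ShortComplex.exact_cokernel m }
  refine ⟨cokernel m, cokernel.π m, i, q, cokernel.condition m, hiq, ex1, ?_⟩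
  have epiq : Epi q := epi_of_epi_fac hq
  have monoi : Mono i := by
    rw [Preadditive.mono_iff_cancel_zero]
    intro A z hz
    obtain ⟨A', π, hπ, x, hx⟩ := surjective_up_to_refinements_of_epi S.g z
    have h2 : (x ≫ e.hom ≫ S'.f) ≫ cokernel.π m = 0 := by
      have : x ≫ S.g ≫ i = 0 := by rw [← Category.assoc, ← hx]; simp [hz]
      rw [hi] at this; simpa using this
    obtain ⟨A'', π', hπ', y, hy⟩ := ex1.exact.exact_up_to_refinements _ h2
    dsimp at y hy
    have h3 : π' ≫ x = y ≫ S.f := by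
      rw [← cancel_mono (e.hom ≫ S'.f)]; simpa [m] using hy
    rw [← cancel_epi π, ← cancel_epi π', hx, ← Category.assoc, h3]
    simp
  refine { exact := ?_, mono_f := monoi, epi_g := epiq }
  rw [ShortComplex.exact_iff_exact_up_to_refinements]
  intro A z hz
  dsimp at z hz ⊢
  obtain ⟨A', π, hπ, x, hx⟩ := surjective_up_to_refinements_of_epi (cokernel.π m) z
  have h2 : x ≫ S'.g = 0 := by rw [← hq, ← Category.assoc, ← hx]; simp [hz]
  obtain ⟨A'', π', hπ', y, hy⟩ := hS'.exact.exact_up_to_refinements _ h2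
  refine ⟨A'', π' ≫ π, inferInstance, y ≫ e.inv ≫ S.g, ?_⟩
  simp only [Category.assoc, hi, Iso.inv_hom_id_assoc, hx]
  rw [← Category.assoc, hy, Category.assoc]

lemma Filt.snoc {X : C} (hX : Filt M n X) :
    ∀ (S : ShortComplex C) (_ : S.ShortExact) (_ : X ≅ S.X₁) (_ : IsAdd M S.X₃),
      Filt M (n + 1) S.X₂ := by
  induction hX with
  | zero h =>
    intro S hS e h₃
    have h := h.of_iso e.symm
    have := hS.epi_g
    have : Mono S.g := hS.exact.mono_g (h.eq_of_src _ _)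
    have : IsIso S.g := isIso_of_mono_of_epi _
    exact .of_isAdd (h₃.of_iso (asIso S.g))
  | succ S' hS' h₁ _ ih =>
    intro S hS e h₃
    obtain ⟨Z, p, i, q, w, w', ex, ex'⟩ := exists_quotient_shortExact S' S hS' hS e
    exact Filt.succ (ShortComplex.mk _ _ w) ex h₁ (ih _ ex' (Iso.refl _) h₃)

lemma Filt.op {X : C} (h : Filt M n X) : Filt (Opposite.op M) n (Opposite.op X) := by
  induction h with
  | zero h => exact .zero h.op
  | succ S hS h₁ _ ih => exact ih.snoc S.op hS.op (Iso.refl _) h₁.op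

lemma Filt.unop {M X : Cᵒᵖ} (h : Filt M n X) : Filt M.unop n X.unop := by
  induction h with
  | zero h => exact .zero h.unop
  | succ S hS h₁ _ ih => exact ih.snoc S.unop hS.unop (Iso.refl _) h₁.unop

lemma shortExact_biprod {S S' : ShortComplex C} (hS : S.ShortExact) (hS' : S'.ShortExact) :
    (ShortComplex.mk (biprod.map S.f S'.f) (biprod.map S.g S'.g)
      (by ext <;> simp)).ShortExact := by
  have := hS.mono_f
  have := hS'.mono_f
  have := hS.epi_g
  have := hS'.epi_g
  have m : Mono (biprod.map S.f S'.f) := inferInstance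
  have e : Epi (biprod.map S.g S'.g) := inferInstance
  refine { exact := ?_, mono_f := m, epi_g := e }
  apply ShortComplex.exact_of_f_is_kernel
  refine KernelFork.IsLimit.ofι' _ _ fun {A} k hk => ?_
  dsimp at k hk
  have h1 : (k ≫ biprod.fst) ≫ S.g = 0 := by
    simpa using congr($hk ≫ biprod.fst)
  have h2 : (k ≫ biprod.snd) ≫ S'.g = 0 := by
    simpa using congr($hk ≫ biprod.snd)
  refine ⟨biprod.lift (hS.exact.lift _ h1) (hS'.exact.lift _ h2), ?_⟩
  ext <;> simp

lemma Filt.biprod {X : C} (hX : Filt M n X) :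
    ∀ {Y : C} (_ : Filt M n Y), Filt M n (X ⊞ Y) := by
  induction hX with
  | zero h =>
    rintro Y ⟨h'⟩
    refine .zero ?_
    rw [IsZero.iff_id_eq_zero]
    ext
    · exact h.eq_of_src _ _
    · exact h.eq_of_src _ _
    · exact h'.eq_of_src _ _
    · exact h'.eq_of_src _ _
  | succ S hS h₁ _ ih =>
    rintro Y (_ | ⟨S', hS', h₁', h₃'⟩)
    exact .succ _ (shortExact_biprod hS hS') (h₁.biprod h₁') (ih h₃')

/-- All objects are direct summands of `(n+1)`-fold extensions of `add M`, for some `M`. -/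
def ExtLE (C : Type w) [Category.{v} C] [Abelian C] (n : ℕ) : Prop :=
  ∃ M : C, ∀ X : C, ∃ W : C, Nonempty (Retract X W) ∧ Filt M (n + 1) W

lemma ExtLE.op (h : ExtLE C n) : ExtLE Cᵒᵖ n := by
  obtain ⟨M, hM⟩ := h
  refine ⟨.op M, fun X => ?_⟩
  obtain ⟨W, ⟨r⟩, hW⟩ := hM X.unop
  exact ⟨.op W, ⟨⟨r.r.op, r.i.op, by simp [← op_comp]⟩⟩, hW.op⟩

end Filt

section Cosyzygy

universe v w

variable {C : Type w} [Category.{v} C] [Abelian C]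

/-- `J` is an injective object cogenerating `C` through its finite powers. -/
structure IsInjCogen (J : C) : Prop where
  injective : Injective J
  exists_mono : ∀ X : C, ∃ (I : C) (i : X ⟶ I), Mono i ∧ IsAdd J I

/-- `G` is a projective object generating `C` through its finite powers. -/
structure IsProjGen (G : C) : Prop where
  projective : Projective G
  exists_epi : ∀ X : C, ∃ (I : C) (p : I ⟶ X), Epi p ∧ IsAdd G I

lemma IsAdd.injective {J I : C} (hJ : Injective J) (h : IsAdd J I) : Injective I := by
  have key : ∀ {X Y : C} (m : X ⟶ Y) (_ : Mono m) (g : X ⟶ I) (f : I ⟶ I)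
      (_ : f ∈ through J I I), ∃ h : Y ⟶ I, m ≫ h = g ≫ f := by
    intro X Y m hm g f hf
    induction hf using AddSubgroup.closure_induction with
    | mem f hf =>
      obtain ⟨a, b, rfl⟩ := hf
      exact ⟨Injective.factorThru (g ≫ a) m ≫ b, by simp⟩
    | zero => exact ⟨0, by simp⟩
    | add f f' _ _ h h' =>
      obtain ⟨h, hh⟩ := h
      obtain ⟨h', hh'⟩ := h'
      exact ⟨h + h', by simp [hh, hh']⟩
    | neg f _ h =>
      obtain ⟨h, hh⟩ := h
      exact ⟨-h, by simp [hh]⟩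
  refine ⟨fun g m hm => ?_⟩
  obtain ⟨h, hh⟩ := key m hm g (𝟙 _) h
  exact ⟨h, by simpa using hh⟩

lemma IsProjGen.op {G : C} (h : IsProjGen G) : IsInjCogen (Opposite.op G) where
  injective := have := h.projective; inferInstance
  exists_mono X := by
    obtain ⟨I, p, hp, hI⟩ := h.exists_epi X.unop
    exact ⟨.op I, p.op, inferInstance, hI.op⟩

lemma IsInjCogen.op {G : C} (h : IsInjCogen G) : IsProjGen (Opposite.op G) where
  projective := have := h.injective; inferInstance
  exists_epi X := by
    obtain ⟨I, p, hp, hI⟩ := h.exists_mono X.unop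
    exact ⟨.op I, p.op, inferInstance, hI.op⟩

lemma IsInjCogen.exists_shortExact {J : C} (h : IsInjCogen J) (X : C) :
    ∃ (I Y : C) (f : X ⟶ I) (g : I ⟶ Y) (w : f ≫ g = 0),
      (ShortComplex.mk f g w).ShortExact ∧ IsAdd J I := by
  obtain ⟨I, i, hi, hI⟩ := h.exists_mono X
  exact ⟨I, cokernel i, i, cokernel.π i, cokernel.condition i,
    { exact := ShortComplex.exact_cokernel i }, hI⟩

/-- A morphism between first terms extends to short exact sequences with injective
middle term. -/
lemma exists_hom_of_injective {S S' : ShortComplex C} (hS : S.ShortExact)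
    (hI : Injective S'.X₂) (f : S.X₁ ⟶ S'.X₁) : ∃ τ : S ⟶ S', τ.τ₁ = f := by
  have := hS.mono_f
  have := hS.epi_g
  let f₂ := Injective.factorThru (f ≫ S'.f) S.f
  have h₂ : S.f ≫ f₂ = f ≫ S'.f := Injective.comp_factorThru _ _
  have h₃ : S.f ≫ f₂ ≫ S'.g = 0 := by rw [reassoc_of% h₂]; simp
  exact ⟨⟨f, f₂, hS.exact.desc _ h₃, h₂.symm, by simp⟩, rfl⟩

lemma through_of_τ₁_eq_zero {J : C} {S S' : ShortComplex C} (hS : S.ShortExact)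
    (hI : IsAdd J S'.X₂) (τ : S ⟶ S') (h : τ.τ₁ = 0) : τ.τ₃ ∈ through J S.X₃ S'.X₃ := by
  have := hS.epi_g
  have h₂ : S.f ≫ τ.τ₂ = 0 := by rw [← τ.comm₁₂, h, zero_comp]
  have : τ.τ₃ = hS.exact.desc _ h₂ ≫ S'.g := by
    rw [← cancel_epi S.g, ← τ.comm₂₃, hS.exact.g_desc_assoc]
  rw [this]
  exact hI.comp_mem _ _

lemma through_cosyzygy {J : C} (hJ : Injective J) {R : ShortComplex C} (hR : R.ShortExact)
    (hRI : IsAdd J R.X₂) {S S' : ShortComplex C} (hS : S.ShortExact)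
    (hI' : IsAdd J S'.X₂) (τ : S ⟶ S') (h : τ.τ₁ ∈ through R.X₁ S.X₁ S'.X₁) :
    τ.τ₃ ∈ through (R.X₃ ⊞ J) S.X₃ S'.X₃ := by
  have key : ∀ f ∈ through R.X₁ S.X₁ S'.X₁, ∃ τ : S ⟶ S', τ.τ₁ = f ∧
      τ.τ₃ ∈ through (R.X₃ ⊞ J) S.X₃ S'.X₃ := by
    intro f hf
    induction hf using AddSubgroup.closure_induction with
    | mem f hf =>
      obtain ⟨a, b, rfl⟩ := hf
      obtain ⟨α, rfl⟩ := exists_hom_of_injective hS (hRI.injective hJ) a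
      obtain ⟨β, rfl⟩ := exists_hom_of_injective hR (hI'.injective hJ) b
      exact ⟨α ≫ β, rfl, (IsAdd.inl (IsAdd.refl R.X₃)).through_le (through_of_comp _ _)⟩
    | zero => exact ⟨0, rfl, zero_mem _⟩
    | add f f' _ _ h h' =>
      obtain ⟨σ, rfl, h⟩ := h
      obtain ⟨σ', rfl, h'⟩ := h'
      exact ⟨σ + σ', rfl, add_mem h h'⟩
    | neg f _ h =>
      obtain ⟨σ, rfl, h⟩ := h
      exact ⟨-σ, rfl, neg_mem h⟩
  obtain ⟨σ, h₁, h₃⟩ := key _ h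
  have := through_of_τ₁_eq_zero (J := J) hS hI' (τ - σ) (by simp [h₁])
  have h' := add_mem ((IsAdd.inr (M := R.X₃) (IsAdd.refl J)).through_le this) h₃
  simpa using h'

lemma IsAdd.cosyzygy {J : C} (hJ : Injective J) {R : ShortComplex C} (hR : R.ShortExact)
    (hRI : IsAdd J R.X₂) {S : ShortComplex C} (hS : S.ShortExact) (hI : IsAdd J S.X₂)
    (h : IsAdd R.X₁ S.X₁) : IsAdd (R.X₃ ⊞ J) S.X₃ :=
  through_cosyzygy hJ hR hRI hS hI (𝟙 S) h

/-- The cokernels of a termwise monomorphism of short exact sequences. -/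
lemma exists_cokernel_shortExact {S S' : ShortComplex C} (hS : S.ShortExact)
    (hS' : S'.ShortExact) (φ : S ⟶ S') (h₁ : Mono φ.τ₁) (h₂ : Mono φ.τ₂) (h₃ : Mono φ.τ₃) :
    ∃ (T : ShortComplex C) (π : S' ⟶ T) (w : φ ≫ π = 0), T.ShortExact ∧
      (ShortComplex.mk φ.τ₁ π.τ₁ (by rw [← ShortComplex.comp_τ₁, w]; rfl)).ShortExact ∧
      (ShortComplex.mk φ.τ₂ π.τ₂ (by rw [← ShortComplex.comp_τ₂, w]; rfl)).ShortExact ∧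
      (ShortComplex.mk φ.τ₃ π.τ₃ (by rw [← ShortComplex.comp_τ₃, w]; rfl)).ShortExact := by
  let K : ShortComplex.SnakeInput C :=
    { L₀ := kernel φ, L₁ := S, L₂ := S', L₃ := cokernel φ
      v₀₁ := kernel.ι φ, v₁₂ := φ, v₂₃ := cokernel.π φ
      w₀₂ := kernel.condition φ, w₁₃ := cokernel.condition φ
      h₀ := kernelIsKernel φ, h₃ := cokernelIsCokernel φ
      L₁_exact := hS.exact, epi_L₁_g := hS.epi_g
      L₂_exact := hS'.exact, mono_L₂_f := hS'.mono_f }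
  have hepi := hS'.epi_g
  have z : IsZero K.L₀.X₃ := by
    have : Mono K.v₀₁.τ₃ := mono_of_isLimit_fork K.h₀τ₃
    rw [IsZero.iff_id_eq_zero, ← cancel_mono K.v₀₁.τ₃, ← cancel_mono φ.τ₃]
    rw [Category.id_comp, zero_comp, zero_comp]
    exact K.w₀₂_τ₃
  have hm : Mono K.L₃.f := K.L₂'_exact.mono_g (z.eq_of_src _ _)
  have he : Epi (K.v₂₃.τ₂ ≫ K.L₃.g) := by
    rw [K.v₂₃.comm₂₃]
    have : Epi K.L₂.g := hepi
    have : Epi K.v₂₃.τ₃ := epi_of_isColimit_cofork K.h₃τ₃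
    exact epi_comp _ _
  have he' : Epi K.L₃.g := epi_of_epi K.v₂₃.τ₂ _
  refine ⟨cokernel φ, cokernel.π φ, cokernel.condition φ,
    { exact := K.L₃_exact, mono_f := hm, epi_g := he' }, ?_, ?_, ?_⟩
  · exact { exact := ShortComplex.exact_of_g_is_cokernel _ K.h₃τ₁, mono_f := h₁,
            epi_g := epi_of_isColimit_cofork K.h₃τ₁ }
  · exact { exact := ShortComplex.exact_of_g_is_cokernel _ K.h₃τ₂, mono_f := h₂,
            epi_g := epi_of_isColimit_cofork K.h₃τ₂ }
  · exact { exact := ShortComplex.exact_of_g_is_cokernel _ K.h₃τ₃, mono_f := h₃,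
            epi_g := epi_of_isColimit_cofork K.h₃τ₃ }

lemma shortExact_inl_snd (X Y : C) :
    (ShortComplex.mk (biprod.inl : X ⟶ X ⊞ Y) biprod.snd (by simp)).ShortExact :=
  (ShortComplex.Splitting.ofHasBinaryBiproduct X Y).shortExact

lemma ShortExact.congr_X₁_X₃ {S : ShortComplex C} (hS : S.ShortExact) {X Y : C}
    (e : X ≅ S.X₁) (e' : S.X₃ ≅ Y) :
    (ShortComplex.mk (e.hom ≫ S.f) (S.g ≫ e'.hom) (by simp)).ShortExact :=
  ShortComplex.shortExact_of_iso (ShortComplex.isoMk (S₁ := S)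
    (S₂ := ShortComplex.mk (e.hom ≫ S.f) (S.g ≫ e'.hom) (by simp))
    e.symm (Iso.refl _) e' (by simp) (by simp)) hS

/-- Two cokernels of the same monomorphism are isomorphic. -/
lemma cokernel_iso_of_shortExact {X I Y Y' : C} {i : X ⟶ I} {p : I ⟶ Y} {p' : I ⟶ Y'}
    {w : i ≫ p = 0} {w' : i ≫ p' = 0} (h : (ShortComplex.mk i p w).ShortExact)
    (h' : (ShortComplex.mk i p' w').ShortExact) : Nonempty (Y ≅ Y') := by
  have := h.epi_g
  have := h'.epi_g
  exact ⟨IsColimit.coconePointUniqueUpToIso h.exact.gIsCokernel h'.exact.gIsCokernel⟩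

/-- The horseshoe lemma for cosyzygies. -/
lemma exists_horseshoe {J : C} (hJ : Injective J) {S : ShortComplex C} (hS : S.ShortExact)
    {I₁ Y₁ I₃ Y₃ : C} {i₁ : S.X₁ ⟶ I₁} {p₁ : I₁ ⟶ Y₁} {w₁ : i₁ ≫ p₁ = 0}
    {i₃ : S.X₃ ⟶ I₃} {p₃ : I₃ ⟶ Y₃} {w₃ : i₃ ≫ p₃ = 0}
    (h₁ : (ShortComplex.mk i₁ p₁ w₁).ShortExact) (h₃ : (ShortComplex.mk i₃ p₃ w₃).ShortExact)
    (hI₁ : IsAdd J I₁) (hI₃ : IsAdd J I₃) :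
    ∃ (I Y : C) (f : S.X₂ ⟶ I) (g : I ⟶ Y) (w : f ≫ g = 0) (a : Y₁ ⟶ Y) (b : Y ⟶ Y₃)
      (w' : a ≫ b = 0), (ShortComplex.mk f g w).ShortExact ∧ IsAdd J I ∧
        (ShortComplex.mk a b w').ShortExact := by
  have := hS.mono_f
  have m₁ := h₁.mono_f
  have m₃ := h₃.mono_f
  dsimp at m₁ m₃
  have inj₁ := hI₁.injective hJ
  let t : S.X₂ ⟶ I₁ := Injective.factorThru i₁ S.f
  have ht : S.f ≫ t = i₁ := Injective.comp_factorThru _ _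
  let f : S.X₂ ⟶ I₁ ⊞ I₃ := biprod.lift t (S.g ≫ i₃)
  have hfm : Mono f := by
    rw [Preadditive.mono_iff_cancel_zero]
    intro A z hz
    have e1 : z ≫ t = 0 := by simpa [f] using congr($hz ≫ biprod.fst)
    have e2 : z ≫ S.g ≫ i₃ = 0 := by simpa [f] using congr($hz ≫ biprod.snd)
    have e3 : z ≫ S.g = 0 := by rw [← cancel_mono i₃]; simpa using e2
    have e4 : hS.exact.lift z e3 ≫ S.f = z := hS.exact.lift_f z e3
    have e5 : hS.exact.lift z e3 = 0 := by
      rw [← cancel_mono i₁, ← ht, reassoc_of% e4, e1, zero_comp]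
    rw [← e4, e5, zero_comp]
  let φ : S ⟶ ShortComplex.mk (biprod.inl : I₁ ⟶ I₁ ⊞ I₃) biprod.snd (by simp) :=
    { τ₁ := i₁, τ₂ := f, τ₃ := i₃,
      comm₁₂ := by dsimp [f]; ext <;> simp [ht]
      comm₂₃ := by simp [f] }
  obtain ⟨T, π, w, hT, k₁, k₂, k₃⟩ :=
    exists_cokernel_shortExact hS (shortExact_inl_snd I₁ I₃) φ m₁ hfm m₃
  obtain ⟨e⟩ := cokernel_iso_of_shortExact h₁ k₁
  obtain ⟨e'⟩ := cokernel_iso_of_shortExact k₃ h₃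
  exact ⟨_, _, _, _, _, _, _, _, k₂, hI₁.biprod hI₃, ShortExact.congr_X₁_X₃ hT e e'⟩

/-- A filtration of `X` induces one of a cosyzygy of `X`. -/
lemma Filt.cosyzygy {J : C} (hJ : IsInjCogen J) {R : ShortComplex C} (hR : R.ShortExact)
    (hRI : IsAdd J R.X₂) {n : ℕ} {X : C} (hX : Filt R.X₁ n X) :
    ∃ (I Y : C) (f : X ⟶ I) (g : I ⟶ Y) (w : f ≫ g = 0),
      (ShortComplex.mk f g w).ShortExact ∧ IsAdd J I ∧ Filt (R.X₃ ⊞ J) n Y := by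
  induction hX with
  | @zero X h =>
    exact ⟨X, 0, 𝟙 X, 0, by simp, shortExact_id_zero X, .of_isZero h, .zero (isZero_zero C)⟩
  | succ S hS h₁ _ ih =>
    obtain ⟨I₃, Y₃, f₃, g₃, w₃, ex₃, hI₃, hY₃⟩ := ih
    obtain ⟨I₁, Y₁, f₁, g₁, w₁, ex₁, hI₁⟩ := hJ.exists_shortExact S.X₁
    obtain ⟨I, Y, f, g, w, a, b, w', ex, hI, ex'⟩ :=
      exists_horseshoe hJ.injective hS ex₁ ex₃ hI₁ hI₃
    exact ⟨I, Y, f, g, w, ex, hI, .succ (ShortComplex.mk a b w') ex'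
      (IsAdd.cosyzygy hJ.injective hR hRI ex₁ hI₁ h₁) hY₃⟩

/-- The dual of `Filt.cosyzygy`: a bound for syzygies, uniform in `X`. -/
lemma Filt.syzygy {G : C} (hG : IsProjGen G) (M : C) : ∃ N : C, ∀ {n : ℕ} {X : C},
    Filt M n X → ∃ (P Y : C) (f : Y ⟶ P) (g : P ⟶ X) (w : f ≫ g = 0),
      (ShortComplex.mk f g w).ShortExact ∧ IsAdd G P ∧ Filt N n Y := by
  obtain ⟨I, Y, f, g, w, ex, hI⟩ := hG.op.exists_shortExact (.op M)
  refine ⟨(Y ⊞ .op G).unop, fun {n X} hX => ?_⟩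
  obtain ⟨I', Y', f', g', w', ex', hI', hY'⟩ := Filt.cosyzygy hG.op ex hI hX.op
  refine ⟨I'.unop, Y'.unop, g'.unop, f'.unop, by rw [← unop_comp, w', unop_zero], ?_, hI'.unop,
    hY'.unop⟩
  exact ex'.unop

end Cosyzygy

section Coresolution

universe v w

variable {C : Type w} [Category.{v} C] [Abelian C]

/-- `X` has a coresolution of length `n` by objects of `add M`. -/
inductive CoR (M : C) : ℕ → C → Prop
  | zero {X : C} (h : IsAdd M X) : CoR M 0 X
  | succ {n : ℕ} (S : ShortComplex C) (hS : S.ShortExact) (h₂ : IsAdd M S.X₂)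
      (h₃ : CoR M n S.X₃) : CoR M (n + 1) S.X₁

lemma CoR.mono {M N : C} (h : IsAdd N M) {n : ℕ} {X : C} (hX : CoR M n X) : CoR N n X := by
  induction hX with
  | zero h' => exact .zero (h.trans h')
  | succ S hS h₁ _ ih => exact .succ S hS (h.trans h₁) ih

/-- If `W` is an extension of `Y` by `X` and `X ⟶ J` is a monomorphism into an injective object,
then `W` embeds in `Y ⊞ J` with cokernel `J / X`. -/
lemma shortExact_biprod_of_shortExact {S R : ShortComplex C} (hS : S.ShortExact)
    (hR : R.ShortExact) (hI : Injective R.X₂) (e : S.X₁ ≅ R.X₁) :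
    ∃ (f : S.X₂ ⟶ S.X₃ ⊞ R.X₂) (g : S.X₃ ⊞ R.X₂ ⟶ R.X₃) (w : f ≫ g = 0),
      (ShortComplex.mk f g w).ShortExact := by
  have := hS.mono_f
  have := hS.epi_g
  have := hR.mono_f
  have := hR.epi_g
  let t : S.X₂ ⟶ R.X₂ := Injective.factorThru (e.hom ≫ R.f) S.f
  have ht : S.f ≫ t = e.hom ≫ R.f := Injective.comp_factorThru _ _
  have h0 : S.f ≫ t ≫ R.g = 0 := by rw [reassoc_of% ht]; simp
  let d : S.X₃ ⟶ R.X₃ := hS.exact.desc _ h0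
  have hd : S.g ≫ d = t ≫ R.g := hS.exact.g_desc _ _
  let f : S.X₂ ⟶ S.X₃ ⊞ R.X₂ := biprod.lift S.g t
  let g : S.X₃ ⊞ R.X₂ ⟶ R.X₃ := biprod.desc (-d) R.g
  have hfm : Mono f := by
    rw [Preadditive.mono_iff_cancel_zero]
    intro A z hz
    have e1 : z ≫ S.g = 0 := by simpa [f] using congr($hz ≫ biprod.fst)
    have e2 : z ≫ t = 0 := by simpa [f] using congr($hz ≫ biprod.snd)
    have e4 : hS.exact.lift z e1 ≫ S.f = z := hS.exact.lift_f z e1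
    have e5 : hS.exact.lift z e1 = 0 := by
      rw [← cancel_mono (e.hom ≫ R.f), ← ht, reassoc_of% e4, e2, zero_comp]
    rw [← e4, e5, zero_comp]
  have hge : Epi g := epi_of_epi_fac (f := biprod.inr) (by simp [g] : _ = R.g)
  have w : f ≫ g = 0 := by simp [f, g, hd]
  refine ⟨f, g, w, { exact := ?_, mono_f := hfm, epi_g := hge }⟩
  rw [ShortComplex.exact_iff_exact_up_to_refinements]
  intro A z hz
  dsimp at z hz ⊢
  obtain ⟨A', π, hπ, x, hx⟩ := surjective_up_to_refinements_of_epi S.g (z ≫ biprod.fst)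
  have hz' : z ≫ biprod.snd ≫ R.g = (z ≫ biprod.fst) ≫ d := by
    have : z = biprod.lift (z ≫ biprod.fst) (z ≫ biprod.snd) := by ext <;> simp
    rw [this] at hz
    simp only [biprod.lift_desc, g, Preadditive.comp_neg, Category.assoc] at hz
    rw [Category.assoc]
    exact (eq_of_sub_eq_zero (by rw [← hz]; abel))
  have h1 : (π ≫ z ≫ biprod.snd - x ≫ t) ≫ R.g = 0 := by
    simp only [Preadditive.sub_comp, Category.assoc, hz', ← hd]
    rw [← reassoc_of% hx]; simp
  obtain ⟨A'', π', hπ', y, hy⟩ := hR.exact.exact_up_to_refinements _ h1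
  refine ⟨A'', π' ≫ π, inferInstance, π' ≫ x + y ≫ e.inv ≫ S.f, ?_⟩
  ext
  · simp [f, ← hx]
  · simp only [Category.assoc, biprod.lift_snd, f, Preadditive.add_comp, ht,
      Iso.inv_hom_id_assoc, ← hy, Preadditive.comp_sub]
    abel

lemma Filt.exists_shortExact {M X : C} {n : ℕ} (h : Filt M (n + 1) X) :
    ∃ S : ShortComplex C, S.ShortExact ∧ S.X₂ = X ∧ IsAdd M S.X₁ ∧ Filt M n S.X₃ := by
  cases h with
  | succ S hS h₁ h₃ => exact ⟨S, hS, rfl, h₁, h₃⟩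

/-- A filtered object has a coresolution. -/
lemma exists_coR {J : C} (hJ : IsInjCogen J) (n : ℕ) :
    ∀ M : C, ∃ N : C, ∀ W : C, Filt M (n + 1) W → CoR N n W := by
  induction n with
  | zero => exact fun M => ⟨M, fun W hW => .zero hW.isAdd⟩
  | succ n ih =>
    intro M
    obtain ⟨I, Y, f, g, w, ex, hI⟩ := hJ.exists_shortExact M
    obtain ⟨N, hN⟩ := ih (Y ⊞ J)
    refine ⟨(M ⊞ J) ⊞ N, fun W hW => ?_⟩
    obtain ⟨S, hS, e, h₁, h₃⟩ := hW.op.exists_shortExact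
    have hX : Filt M (n + 1) S.X₃.unop := h₃.unop
    obtain ⟨I', Y', f', g', w', ex', hI', hY'⟩ := Filt.cosyzygy hJ ex hI hX
    obtain ⟨a, b, w'', ex''⟩ := shortExact_biprod_of_shortExact (S := S.unop) hS.unop ex'
      (hI'.injective hJ.injective) (Iso.refl _)
    obtain rfl : S.X₂.unop = W := by rw [e]
    exact CoR.succ (ShortComplex.mk _ _ w'') ex'' ((h₁.unop.inl).biprod hI'.inr).inl
      ((hN _ hY').mono (IsAdd.refl N).inr)

end Coresolution

section Torsion

universe v w v' w'

variable {C : Type w} [Category.{v} C] [Abelian C]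
variable {D : Type w'} [Category.{v'} D] [Abelian D]

/-- A split torsion pair in an abelian category. -/
structure SplitTorsion (T F : C → Prop) : Prop where
  hom_eq_zero : ∀ {X Y : C}, T X → F Y → ∀ f : X ⟶ Y, f = 0
  of_iso_left : ∀ {X Y : C}, (X ≅ Y) → T X → T Y
  of_iso_right : ∀ {X Y : C}, (X ≅ Y) → F X → F Y
  exists_decomp : ∀ X : C, ∃ (U V : C) (p : X ⟶ U) (i : U ⟶ X) (q : X ⟶ V) (j : V ⟶ X),
    T U ∧ F V ∧ i ≫ p = 𝟙 U ∧ j ≫ q = 𝟙 V ∧ p ≫ i + q ≫ j = 𝟙 X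

variable {T F : C → Prop}

namespace SplitTorsion

lemma op (h : SplitTorsion T F) :
    SplitTorsion (C := Cᵒᵖ) (fun X => F X.unop) (fun X => T X.unop) where
  hom_eq_zero hX hY f := Quiver.Hom.unop_inj (by simpa using h.hom_eq_zero hY hX f.unop)
  of_iso_left e := h.of_iso_right e.unop.symm
  of_iso_right e := h.of_iso_left e.unop.symm
  exists_decomp X := by
    obtain ⟨U, V, p, i, q, j, hU, hV, h₁, h₂, h₃⟩ := h.exists_decomp X.unop
    refine ⟨.op V, .op U, j.op, q.op, i.op, p.op, hV, hU, ?_, ?_, ?_⟩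
    · rw [← op_comp, h₂]; rfl
    · rw [← op_comp, h₁]; rfl
    · rw [← op_comp, ← op_comp, ← op_add, add_comm, h₃]; rfl

lemma of_forall_hom_eq_zero (h : SplitTorsion T F) {X : C}
    (hX : ∀ Y, F Y → ∀ f : X ⟶ Y, f = 0) : T X := by
  obtain ⟨U, V, p, i, q, j, hU, hV, h₁, h₂, h₃⟩ := h.exists_decomp X
  have hq := hX V hV q
  refine h.of_iso_left ⟨i, p, h₁, ?_⟩ hU
  rw [← h₃, hq, zero_comp, add_zero]

lemma of_epi (h : SplitTorsion T F) {X Y : C} (f : X ⟶ Y) [Epi f] (hX : T X) : T Y :=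
  h.of_forall_hom_eq_zero fun Z hZ g => by
    rw [← cancel_epi f, h.hom_eq_zero hX hZ (f ≫ g), comp_zero]

/-- A monomorphism from a torsion object factors through the torsion part of the target. -/
lemma exists_torsion_mono (h : SplitTorsion T F) {X I : C} (hX : T X) (i : X ⟶ I) [Mono i] :
    ∃ (U Y : C) (f : X ⟶ U) (g : U ⟶ Y) (w : f ≫ g = 0) (r : Retract U I),
      (ShortComplex.mk f g w).ShortExact ∧ T U ∧ T Y ∧ f ≫ r.i = i := by
  obtain ⟨U, V, p, a, q, j, hU, hV, h₁, h₂, h₃⟩ := h.exists_decomp I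
  have hq : i ≫ q = 0 := h.hom_eq_zero hX hV _
  have hf : (i ≫ p) ≫ a = i := by
    have := congr(i ≫ $h₃)
    simpa [reassoc_of% hq] using this
  have : Mono (i ≫ p) := mono_of_mono_fac hf
  have hepi : Epi (cokernel.π (i ≫ p)) := inferInstance
  exact ⟨U, cokernel (i ≫ p), i ≫ p, cokernel.π _, cokernel.condition _, ⟨a, p, h₁⟩,
    { exact := ShortComplex.exact_cokernel _ }, hU, h.of_epi (cokernel.π (i ≫ p)) hU, hf⟩

lemma isAdd_torsion (h : SplitTorsion T F) (M : C) :
    ∃ N : C, T N ∧ ∀ U, T U → IsAdd M U → IsAdd N U := by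
  obtain ⟨N, V, p, i, q, j, hN, hV, h₁, h₂, h₃⟩ := h.exists_decomp M
  refine ⟨N, hN, fun U hU hM => ?_⟩
  have key : ∀ f ∈ through M U U, f ∈ through N U U := by
    intro f hf
    rw [through] at hf
    refine (AddSubgroup.closure_le _).2 ?_ hf
    rintro _ ⟨a, b, rfl⟩
    have hq : a ≫ q = 0 := h.hom_eq_zero hU hV _
    have : a ≫ b = (a ≫ p) ≫ (i ≫ b) := by
      have := congr(a ≫ $h₃ ≫ b)
      simpa [reassoc_of% hq] using this.symm
    rw [this]
    exact through_of_comp _ _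
  exact key _ hM

end SplitTorsion

/-- `Fac T M n φ`: the morphism `φ` between torsion objects is, up to `n` steps of dimension
shifting along short exact sequences in `T` with middle term in `add M`, a morphism that factors
through a torsion object of `add M`. -/
inductive Fac (T : C → Prop) (M : C) : ℕ → ∀ {X X' : C}, (X ⟶ X') → Prop
  | zero {X E X' : C} (hE : IsAdd M E) (a : X ⟶ E) (b : E ⟶ X') : Fac T M 0 (a ≫ b)
  | succ {n : ℕ} (S S' : ShortComplex C) (hS : S.ShortExact) (hS' : S'.ShortExact)
      (h₁ : T S.X₁) (h₂ : T S.X₂) (h₃ : T S.X₃) (h₁' : T S'.X₁) (h₂' : T S'.X₂) (h₃' : T S'.X₃)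
      (hM : IsAdd M S.X₂) (φ : S ⟶ S') (h : Fac T M n φ.τ₃) : Fac T M (n + 1) φ.τ₁

/-- A morphism between torsion objects that factors through an object with a coresolution. -/
lemma CoR.exists_fac {J : C} (hJ : IsInjCogen J) (h : SplitTorsion T F) (M : C) :
    ∃ N : C, ∀ (n : ℕ) (W : C), CoR M n W → ∀ (X X' : C), T X → T X' → ∀ (f : X ⟶ W)
      (g : W ⟶ X'), Fac T N n (f ≫ g) := by
  obtain ⟨N, hN, hN'⟩ := h.isAdd_torsion (M ⊞ J)
  refine ⟨N, fun n W hW => ?_⟩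
  induction hW with
  | @zero W hW =>
    intro X X' hX hX' f g
    obtain ⟨U, V, p, i, q, j, hU, hV, h₁, h₂, h₃⟩ := h.exists_decomp W
    have hq : f ≫ q = 0 := h.hom_eq_zero hX hV _
    have e : f ≫ g = (f ≫ p) ≫ (i ≫ g) := by
      have := congr(f ≫ $h₃ ≫ g)
      simpa [reassoc_of% hq] using this.symm
    rw [e]
    exact .zero (hN' U hU ((hW.of_retract ⟨i, p, h₁⟩).inl)) _ _
  | succ S hS h₂ h₃ ih =>
    intro X X' hX hX' f g
    have := hS.mono_f
    have := hS.epi_g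
    obtain ⟨I, i, hi, hI⟩ := hJ.exists_mono X
    obtain ⟨I', i', hi', hI'⟩ := hJ.exists_mono X'
    have hm : Mono (biprod.lift (f ≫ S.f) i) :=
      mono_of_mono_fac (biprod.lift_snd (f ≫ S.f) i)
    obtain ⟨U, Y, u, v, w, r, ex, hU, hY, e⟩ :=
      h.exists_torsion_mono hX (biprod.lift (f ≫ S.f) i)
    obtain ⟨U', Y', u', v', w', r', ex', hU', hY', e'⟩ := h.exists_torsion_mono hX' i'
    have inj' : Injective U' := (hI'.of_retract r').injective hJ.injective
    let t : S.X₂ ⟶ U' := Injective.factorThru (g ≫ u') S.f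
    have ht : S.f ≫ t = g ≫ u' := Injective.comp_factorThru _ _
    have e₁ : u ≫ r.i ≫ biprod.fst = f ≫ S.f := by rw [reassoc_of% e, biprod.lift_fst]
    have hc₁ : u ≫ r.i ≫ biprod.fst ≫ S.g = 0 := by rw [reassoc_of% e₁, S.zero, comp_zero]
    have hc₂ : S.f ≫ t ≫ v' = 0 := by rw [reassoc_of% ht, w', comp_zero]
    have hv : Epi v := ex.epi_g
    let c₁ : Y ⟶ S.X₃ := ex.exact.desc _ hc₁
    have h₁ : v ≫ c₁ = r.i ≫ biprod.fst ≫ S.g := ex.exact.g_desc _ _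
    let c₂ : S.X₃ ⟶ Y' := hS.exact.desc _ hc₂
    have h₂ : S.g ≫ c₂ = t ≫ v' := hS.exact.g_desc _ _
    let φ : ShortComplex.mk u v w ⟶ ShortComplex.mk u' v' w' :=
      { τ₁ := f ≫ g
        τ₂ := r.i ≫ biprod.fst ≫ t
        τ₃ := c₁ ≫ c₂
        comm₁₂ := by dsimp; rw [reassoc_of% e₁, ht, Category.assoc]
        comm₂₃ := by dsimp; rw [reassoc_of% h₁, h₂]; simp }
    refine Fac.succ _ _ ex ex' hX hU hY hX' hU' hY' (hN' U hU ?_) φ (ih Y Y' hY hY' c₁ c₂)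
    exact IsAdd.of_retract (IsAdd.biprod (‹IsAdd M S.X₂›.inl) hI.inr) r

/-- The kernel of `T ⊞ P ⟶ W`, for an epimorphism `P ⟶ W` with kernel `Y`, is an extension of
`T` by `Y`. -/
lemma exists_shortExact_kernel_desc {T Y P W : D} (c : T ⟶ W) {f : Y ⟶ P} {g : P ⟶ W}
    {w : f ≫ g = 0} (h : (ShortComplex.mk f g w).ShortExact) :
    ∃ (x : Y ⟶ kernel (biprod.desc c g)) (y : kernel (biprod.desc c g) ⟶ T) (w' : x ≫ y = 0),
      (ShortComplex.mk x y w').ShortExact := by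
  have hf : Mono f := h.mono_f
  have hg : Epi g := h.epi_g
  let ι := kernel.ι (biprod.desc c g)
  have hι : ι ≫ biprod.fst ≫ c + ι ≫ biprod.snd ≫ g = 0 := by
    have e : biprod.desc c g = biprod.fst ≫ c + biprod.snd ≫ g := by ext <;> simp
    rw [← Preadditive.comp_add, ← e]
    exact kernel.condition _
  let x : Y ⟶ kernel (biprod.desc c g) := kernel.lift _ (biprod.lift 0 f) (by simp [w])
  have hx : x ≫ ι = biprod.lift 0 f := kernel.lift_ι _ _ _
  have hxm : Mono x := mono_of_mono_fac
    (show x ≫ ι ≫ biprod.snd = f by rw [reassoc_of% hx, biprod.lift_snd])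
  have w' : x ≫ ι ≫ biprod.fst = 0 := by rw [reassoc_of% hx, biprod.lift_fst]
  have hy : Epi (ι ≫ biprod.fst) := by
    rw [epi_iff_surjective_up_to_refinements]
    intro A z
    obtain ⟨A', π, hπ, p, hp⟩ := surjective_up_to_refinements_of_epi g (z ≫ c)
    refine ⟨A', π, hπ, kernel.lift _ (biprod.lift (π ≫ z) (-p)) ?_, ?_⟩
    · simp [hp]
    · simp [ι]
  refine ⟨x, ι ≫ biprod.fst, w', { exact := ?_, mono_f := hxm, epi_g := hy }⟩
  apply ShortComplex.exact_of_f_is_kernel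
  refine KernelFork.IsLimit.ofι' _ _ fun {A} k hk => ?_
  dsimp at k hk ⊢
  have h0 : (k ≫ ι ≫ biprod.snd) ≫ g = 0 := by
    have := congr(k ≫ $hι)
    rw [Preadditive.comp_add, comp_zero] at this
    rw [← this]
    simp [reassoc_of% hk]
  refine ⟨h.exact.lift _ h0, ?_⟩
  have e : h.exact.lift _ h0 ≫ f = k ≫ ι ≫ biprod.snd := h.exact.lift_f _ _
  rw [← cancel_mono ι, Category.assoc, hx]
  ext
  · simpa using hk.symm
  · simpa using e

lemma IsAdd.projective {G P : D} (hG : Projective G) (h : IsAdd G P) : Projective P := by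
  rw [Injective.projective_iff_injective_op]
  exact h.op.injective inferInstance

/-- The image of a `Fac`-morphism under a functor that is exact on the torsion class factors
through a filtered object. -/
lemma Fac.exists_filt {G : D} (hG : IsProjGen G) (Ψ : C ⥤ D) [Ψ.Additive]
    (hΨ : ∀ S : ShortComplex C, S.ShortExact → T S.X₁ → T S.X₂ → T S.X₃ →
      (S.map Ψ).ShortExact) (M : C) (n : ℕ) :
    ∃ N : D, ∀ {X X' : C} (φ : X ⟶ X'), Fac T M n φ →
      ∃ (V : D) (a : Ψ.obj X ⟶ V) (b : V ⟶ Ψ.obj X'), Ψ.map φ = a ≫ b ∧ Filt N (n + 1) V := by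
  induction n with
  | zero =>
    refine ⟨Ψ.obj M, fun φ h => ?_⟩
    cases h with
    | @zero _ E _ hE a b => exact ⟨Ψ.obj E, Ψ.map a, Ψ.map b, Ψ.map_comp _ _, .of_isAdd (hE.map Ψ)⟩
  | succ n ih =>
    obtain ⟨N, hN⟩ := ih
    obtain ⟨N', hN'⟩ := Filt.syzygy hG N
    refine ⟨N' ⊞ (Ψ.obj M ⊞ G), fun φ h => ?_⟩
    cases h with
    | succ S S' hS hS' h₁ h₂ h₃ h₁' h₂' h₃' hM φ h =>
    obtain ⟨W, α, β, e, hW⟩ := hN _ h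
    obtain ⟨P, Y, f, g, w, ex, hP, hY⟩ := hN' hW
    have projP : Projective P := hP.projective hG.projective
    have exS' : (ShortComplex.mk (Ψ.map S'.f) (Ψ.map S'.g)
      (by rw [← Ψ.map_comp, S'.zero, Ψ.map_zero])).ShortExact := hΨ S' hS' h₁' h₂' h₃'
    have hm' : Mono (Ψ.map S'.f) := exS'.mono_f
    have he' : Epi (Ψ.map S'.g) := exS'.epi_g
    have hg : Epi g := ex.epi_g
    let d : Ψ.obj S.X₂ ⊞ P ⟶ W := biprod.desc (Ψ.map S.g ≫ α) g
    let l : P ⟶ Ψ.obj S'.X₂ := Projective.factorThru (g ≫ β) (Ψ.map S'.g)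
    have hl : l ≫ Ψ.map S'.g = g ≫ β := Projective.factorThru_comp _ _
    have hz : Ψ.map S.f ≫ Ψ.map S.g = 0 := by rw [← Ψ.map_comp, S.zero, Ψ.map_zero]
    let a : Ψ.obj S.X₁ ⟶ kernel d := kernel.lift d (biprod.lift (Ψ.map S.f) 0)
      (by simp [d, reassoc_of% hz])
    let m : Ψ.obj S.X₂ ⊞ P ⟶ Ψ.obj S'.X₂ := biprod.desc (Ψ.map φ.τ₂) l
    have hm : m ≫ Ψ.map S'.g = d ≫ β := by
      ext
      · simp only [m, d, biprod.inl_desc_assoc, Category.assoc]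
        rw [← e, ← Ψ.map_comp, ← Ψ.map_comp, φ.comm₂₃]
      · simp [m, d, hl]
    let b : kernel d ⟶ Ψ.obj S'.X₁ := exS'.exact.lift (kernel.ι d ≫ m)
      (by rw [Category.assoc, hm]; simp [d])
    have hb : b ≫ Ψ.map S'.f = kernel.ι d ≫ m := exS'.exact.lift_f _ _
    refine ⟨kernel d, a, b, ?_, ?_⟩
    · rw [← cancel_mono (Ψ.map S'.f), Category.assoc, hb, kernel.lift_ι_assoc,
        ← Ψ.map_comp, φ.comm₁₂]
      simp [m]
    · obtain ⟨x, y, w', ex''⟩ := exists_shortExact_kernel_desc (Ψ.map S.g ≫ α) ex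
      exact (hY.mono (IsAdd.refl N').inl).snoc _ ex'' (Iso.refl _) ((hM.map Ψ).inl.inr)

/-- A functor that is exact on the torsion class transports filtrations, up to retracts. -/
lemma ExtLE.exists_of_torsion {J : C} (hJ : IsInjCogen J) (h : SplitTorsion T F) {G : D}
    (hG : IsProjGen G) (Ψ : C ⥤ D) [Ψ.Additive]
    (hΨ : ∀ S : ShortComplex C, S.ShortExact → T S.X₁ → T S.X₂ → T S.X₃ →
      (S.map Ψ).ShortExact) {n : ℕ} (hn : ExtLE C n) :
    ∃ N : D, ∀ X, T X → ∃ W : D, Nonempty (Retract (Ψ.obj X) W) ∧ Filt N (n + 1) W := by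
  obtain ⟨M, hM⟩ := hn
  obtain ⟨M₁, hM₁⟩ := exists_coR hJ n M
  obtain ⟨M₂, hM₂⟩ := CoR.exists_fac hJ h M₁
  obtain ⟨N, hN⟩ := Fac.exists_filt hG Ψ hΨ M₂ n
  refine ⟨N, fun X hX => ?_⟩
  obtain ⟨W, ⟨r⟩, hW⟩ := hM X
  obtain ⟨V, a, b, e, hV⟩ := hN _ (hM₂ n W (hM₁ W hW) X X hX hX r.i r.r)
  rw [r.retract, Ψ.map_id] at e
  exact ⟨V, ⟨⟨a, b, e.symm⟩⟩, hV⟩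

/-- The comparison of extension dimensions along a pair of functors, one exact on the torsion class
and the other one exact on the torsion-free class of a split torsion pair. -/
theorem ExtLE.of_splitTorsion {J G₀ : C} (hJ : IsInjCogen J) (hG₀ : IsProjGen G₀)
    (h : SplitTorsion T F) {G J' : D} (hG : IsProjGen G) (hJ' : IsInjCogen J')
    (Ψ Ψ' : C ⥤ D) [Ψ.Additive] [Ψ'.Additive]
    (hΨ : ∀ S : ShortComplex C, S.ShortExact → T S.X₁ → T S.X₂ → T S.X₃ →
      (S.map Ψ).ShortExact)
    (hΨ' : ∀ S : ShortComplex C, S.ShortExact → F S.X₁ → F S.X₂ → F S.X₃ →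
      (S.map Ψ').ShortExact)
    (hD : ∀ Y : D, ∃ U V : C, T U ∧ F V ∧ Nonempty (Retract Y (Ψ.obj U ⊞ Ψ'.obj V)))
    {n : ℕ} (hn : ExtLE C n) : ExtLE D n := by
  obtain ⟨N, hN⟩ := hn.exists_of_torsion hJ h hG Ψ hΨ
  obtain ⟨N', hN'⟩ := hn.op.exists_of_torsion hG₀.op h.op hJ'.op Ψ'.op
    (fun S hS h₁ h₂ h₃ => (hΨ' S.unop hS.unop h₃ h₂ h₁).op)
  refine ⟨N ⊞ N'.unop, fun Y => ?_⟩
  obtain ⟨U, V, hU, hV, ⟨r⟩⟩ := hD Y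
  obtain ⟨W, ⟨s⟩, hW⟩ := hN U hU
  obtain ⟨W', ⟨s'⟩, hW'⟩ := hN' (.op V) hV
  refine ⟨W ⊞ W'.unop, ⟨r.trans ⟨biprod.map s.i s'.r.unop, biprod.map s.r s'.i.unop, ?_⟩⟩,
    (hW.mono (IsAdd.refl N).inl).biprod (hW'.unop.mono (IsAdd.refl N'.unop).inr)⟩
  have e' : s'.r.unop ≫ s'.i.unop = 𝟙 _ := by rw [← unop_comp, s'.retract]; rfl
  ext
  · simp
  · simp
  · simp
  · simpa using e'

end Torsion

section Ring

variable {R : Type u} [Ring R]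

lemma exists_equiv_prod_of_retract {X Y : Type u} [AddCommGroup X] [Module R X] [AddCommGroup Y]
    [Module R Y] (a : X →ₗ[R] Y) (b : Y →ₗ[R] X) (h : b ∘ₗ a = LinearMap.id) :
    Nonempty ((X × LinearMap.ker b) ≃ₗ[R] Y) := by
  have hb : ∀ x, b (a x) = x := fun x => congr($h x)
  refine ⟨LinearEquiv.ofBijective (a.coprod (LinearMap.ker b).subtype) ⟨?_, fun y => ?_⟩⟩
  · rw [← LinearMap.ker_eq_bot, LinearMap.ker_eq_bot']
    rintro ⟨x, y, hy⟩ hxy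
    have h1 : a x + y = 0 := hxy
    have h2 : x = 0 := by
      have := congr(b $h1)
      simpa [hb, LinearMap.mem_ker.1 hy] using this
    subst h2
    simpa using h1
  · exact ⟨(b y, ⟨y - a (b y), by simp [hb]⟩), by simp⟩

lemma memAdd_of_retract {S : Set (ModuleCat.{u} R)} {n : ℕ} {M : Fin n → ModuleCat.{u} R}
    (hM : ∀ i, M i ∈ S) {X : ModuleCat.{u} R} (a : X →ₗ[R] ((i : Fin n) → M i))
    (b : ((i : Fin n) → M i) →ₗ[R] X) (h : b ∘ₗ a = LinearMap.id) : memAdd R S X := by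
  obtain ⟨e⟩ := exists_equiv_prod_of_retract a b h
  exact ⟨n, M, ModuleCat.of R (LinearMap.ker b), hM, ⟨e⟩⟩

lemma memAdd.retract {S : Set (ModuleCat.{u} R)} {X Y : ModuleCat.{u} R} (hY : memAdd R S Y)
    (a : X →ₗ[R] Y) (b : Y →ₗ[R] X) (h : b ∘ₗ a = LinearMap.id) : memAdd R S X := by
  obtain ⟨n, M, Z, hM, ⟨e⟩⟩ := hY
  refine memAdd_of_retract hM (e.toLinearMap ∘ₗ LinearMap.inl R Y Z ∘ₗ a)
    (b ∘ₗ LinearMap.fst R Y Z ∘ₗ e.symm.toLinearMap) ?_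
  ext x
  simpa using congr($h x)

lemma memAdd_of_mem {S : Set (ModuleCat.{u} R)} {X : ModuleCat.{u} R} (h : X ∈ S) :
    memAdd R S X :=
  memAdd_of_retract (n := 1) (M := fun _ => X) (fun _ => h) (LinearMap.pi fun _ => LinearMap.id)
    (LinearMap.proj 0) rfl

lemma bracket_of_retract {T X Y : ModuleCat.{u} R} {n : ℕ} (h : Y ∈ bracket R T (n + 1))
    (a : X →ₗ[R] Y) (b : Y →ₗ[R] X) (e : b ∘ₗ a = LinearMap.id) : X ∈ bracket R T (n + 1) := by
  cases n with
  | zero => exact memAdd.retract h a b e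
  | succ n => exact memAdd.retract h a b e

end Ring

section FG

variable {R : Type u} [Ring R]

/-- The underlying linear map of a morphism of finitely generated modules. -/
abbrev lin {X Y : FGModuleCat.{u} R} (f : X ⟶ Y) : X.obj →ₗ[R] Y.obj := f.hom.hom

/-- The morphism of finitely generated modules defined by a linear map. -/
abbrev fgHom {X Y : FGModuleCat.{u} R} (f : X.obj →ₗ[R] Y.obj) : X ⟶ Y :=
  ObjectProperty.homMk (ModuleCat.ofHom f)

lemma lin_add {X Y : FGModuleCat.{u} R} (f g : X ⟶ Y) : lin (f + g) = lin f + lin g := rfl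
lemma lin_neg {X Y : FGModuleCat.{u} R} (f : X ⟶ Y) : lin (-f) = -lin f := rfl

instance : (forget₂ (FGModuleCat.{u} R) (ModuleCat.{u} R)).Additive where

lemma lin_sum {X Y : FGModuleCat.{u} R} {ι : Type*} (s : Finset ι) (f : ι → (X ⟶ Y)) :
    lin (∑ i ∈ s, f i) = ∑ i ∈ s, lin (f i) :=
  map_sum (⟨⟨lin, rfl⟩, fun _ _ => rfl⟩ : (X ⟶ Y) →+ (X.obj →ₗ[R] Y.obj)) f s

lemma fg_hom_ext {X Y : FGModuleCat.{u} R} {f g : X ⟶ Y} (h : lin f = lin g) : f = g :=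
  ObjectProperty.hom_ext _ (ModuleCat.hom_ext h)

lemma exists_sum_of_memAdd {S : Set (ModuleCat.{u} R)} (hS : ∀ M ∈ S, Module.Finite R M)
    {X : FGModuleCat.{u} R} (h : memAdd R S X.obj) :
    ∃ (n : ℕ) (M : Fin n → FGModuleCat.{u} R) (a : ∀ i, X ⟶ M i) (b : ∀ i, M i ⟶ X),
      (∀ i, (M i).obj ∈ S) ∧ 𝟙 X = ∑ i, a i ≫ b i := by
  obtain ⟨n, M, Y, hM, ⟨e⟩⟩ := h
  refine ⟨n, fun i => ⟨M i, hS _ (hM i)⟩,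
    fun i => fgHom (LinearMap.proj i ∘ₗ e.toLinearMap ∘ₗ LinearMap.inl R X.obj Y),
    fun i => fgHom (LinearMap.fst R X.obj Y ∘ₗ e.symm.toLinearMap ∘ₗ
      LinearMap.single R (fun i => (M i : Type u)) i), hM, fg_hom_ext ?_⟩
  rw [lin_sum]
  ext x
  have h : x = (e.symm (e (x, 0))).1 := by simp
  rw [← Finset.univ_sum_single (e (x, 0)), map_sum, Prod.fst_sum] at h
  simpa [LinearMap.sum_apply] using h

lemma IsAdd.memAdd {M X : FGModuleCat.{u} R} (h : IsAdd M X) :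
    X.obj ∈ addOf R M.obj := by
  have key : ∀ f ∈ through M X X, ∃ (n : ℕ) (a : X.obj →ₗ[R] (Fin n → M.obj))
      (b : (Fin n → M.obj) →ₗ[R] X.obj), lin f = b ∘ₗ a := by
    intro f hf
    induction hf using AddSubgroup.closure_induction with
    | mem f hf =>
      obtain ⟨a, b, rfl⟩ := hf
      exact ⟨1, LinearMap.pi fun _ => lin a, lin b ∘ₗ LinearMap.proj 0, rfl⟩
    | zero => exact ⟨0, 0, 0, rfl⟩
    | add f f' _ _ h h' =>
      obtain ⟨n, a, b, h⟩ := h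
      obtain ⟨n', a', b', h'⟩ := h'
      let e := LinearEquiv.sumArrowLequivProdArrow (Fin n) (Fin n') R M.obj
      let e' := LinearEquiv.funCongrLeft R M.obj (finSumFinEquiv (m := n) (n := n'))
      refine ⟨n + n', (e'.symm.toLinearMap ∘ₗ e.symm.toLinearMap) ∘ₗ a.prod a',
        b.coprod b' ∘ₗ (e.toLinearMap ∘ₗ e'.toLinearMap), ?_⟩
      rw [lin_add, h, h']
      ext x
      simp
    | neg f _ h =>
      obtain ⟨n, a, b, h⟩ := h
      exact ⟨n, a, -b, by rw [lin_neg, h]; rfl⟩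
  obtain ⟨n, a, b, e⟩ := key _ h
  exact memAdd_of_retract (S := {M.obj}) (M := fun _ => M.obj) (fun _ => rfl) a b e.symm

variable [IsNoetherianRing R]

lemma fg_shortExact_iff (S : ShortComplex (FGModuleCat.{u} R)) :
    S.ShortExact ↔ IsSES R (X := S.X₁.obj) (Y := S.X₂.obj) (Z := S.X₃.obj) (lin S.f) (lin S.g) := by
  let Φ := forget₂ (FGModuleCat.{u} R) (ModuleCat.{u} R)
  constructor
  · intro h
    have h' := h.map_of_exact Φ
    exact ⟨h'.moduleCat_injective_f, h'.moduleCat_surjective_g, h'.exact.moduleCat_range_eq_ker⟩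
  · rintro ⟨h₁, h₂, h₃⟩
    have m : Mono (Φ.map S.f) := (ModuleCat.mono_iff_injective _).2 h₁
    have e : Epi (Φ.map S.g) := (ModuleCat.epi_iff_surjective _).2 h₂
    have : Mono S.f := Φ.mono_of_mono_map m
    have : Epi S.g := Φ.epi_of_epi_map e
    refine { exact := ?_ }
    rw [← S.exact_map_iff_of_faithful Φ]
    exact (S.map Φ).moduleCat_exact_iff_range_eq_ker.2 h₃

lemma Filt.mem_bracket {M : FGModuleCat.{u} R} {n : ℕ} :
    ∀ {X : FGModuleCat.{u} R}, Filt M (n + 1) X → X.obj ∈ bracket R M.obj (n + 1) := by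
  induction n with
  | zero => exact fun h => h.isAdd.memAdd
  | succ n ih =>
    intro X h
    obtain ⟨S, hS, rfl, h₁, h₃⟩ := h.exists_shortExact
    exact memAdd_of_mem ⟨S.X₂.property, _, _, _, _, h₁.memAdd, ih h₃, (fg_shortExact_iff S).1 hS⟩

lemma Filt.of_isZero {C : Type*} [Category* C] [Abelian C] {M X : C} (h : IsZero X) :
    ∀ n, Filt M n X
  | 0 => .zero h
  | n + 1 => .succ _ (shortExact_id_zero X) (.of_isZero h) (.of_isZero (isZero_zero C) n)

lemma exists_factor_filt {T X Y : FGModuleCat.{u} R} {n m : ℕ} (W : Fin m → FGModuleCat.{u} R)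
    (hW : ∀ i, ∃ Z, Nonempty (Retract (W i) Z) ∧ Filt T n Z)
    (a : ∀ i, X ⟶ W i) (b : ∀ i, W i ⟶ Y) :
    ∃ (Z : FGModuleCat.{u} R) (c : X ⟶ Z) (d : Z ⟶ Y),
      Filt T n Z ∧ ∑ i, a i ≫ b i = c ≫ d := by
  induction m with
  | zero => exact ⟨0, 0, 0, Filt.of_isZero (isZero_zero _) _, by simp⟩
  | succ m ih =>
    obtain ⟨Z, c, d, hZ, h⟩ := ih (fun i => W i.succ) (fun i => hW _) (fun i => a i.succ)
      (fun i => b i.succ)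
    obtain ⟨Z', ⟨r⟩, hZ'⟩ := hW 0
    refine ⟨Z' ⊞ Z, biprod.lift (a 0 ≫ r.i) c, biprod.desc (r.r ≫ b 0) d, hZ'.biprod hZ, ?_⟩
    rw [Fin.sum_univ_succ, h]
    simp

/-- Pulling back an extension along a retract. -/
lemma exists_retract_of_retract_right {C : Type*} [Category* C] [Abelian C] {S : ShortComplex C}
    (hS : S.ShortExact) {Z : C} (r : Retract S.X₃ Z) :
    ∃ (W : C) (x : S.X₁ ⟶ W) (y : W ⟶ Z) (w : x ≫ y = 0),
      (ShortComplex.mk x y w).ShortExact ∧ Nonempty (Retract S.X₂ W) := by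
  obtain ⟨x, y, w, h⟩ := exists_shortExact_kernel_desc (f := S.f) (g := S.g) (w := S.zero) r.r hS
  refine ⟨_, x, y, w, h, ⟨⟨kernel.lift _ (biprod.lift (S.g ≫ r.i) (-𝟙 _)) (by simp),
    -(kernel.ι _ ≫ biprod.snd), by simp⟩⟩⟩

lemma exists_retract_of_mem_bracket {T : FGModuleCat.{u} R} {n : ℕ} :
    ∀ {X : FGModuleCat.{u} R}, X.obj ∈ bracket R T.obj (n + 1) →
      ∃ W : FGModuleCat.{u} R, Nonempty (Retract X W) ∧ Filt T (n + 1) W := by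
  induction n with
  | zero =>
    intro X h
    obtain ⟨m, M, a, b, hM, e⟩ := exists_sum_of_memAdd (by rintro M rfl; exact T.property) h
    obtain ⟨Z, c, d, hZ, e'⟩ := exists_factor_filt (T := T) (n := 1) M
      (fun i => ⟨M i, ⟨.refl _⟩, .of_isAdd (by
        have : (M i).obj = T.obj := hM i
        exact IsAdd.of_iso (IsAdd.refl T) (eqToIso (ObjectProperty.FullSubcategory.ext this)))⟩) a b
    exact ⟨Z, ⟨⟨c, d, (e.trans e').symm⟩⟩, hZ⟩
  | succ n ih =>
    intro X h
    obtain ⟨m, M, a, b, hM, e⟩ := exists_sum_of_memAdd (fun M h => h.1) h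
    obtain ⟨Z, c, d, hZ, e'⟩ := exists_factor_filt (T := T) (n := n + 2) M
      (fun i => by
        obtain ⟨fin, T₁, T₂, f, g, h₁, h₂, hfg⟩ := hM i
        have f₁ : Module.Finite R T₁ := Module.Finite.of_injective f hfg.1
        have f₂ : Module.Finite R T₂ := Module.Finite.of_surjective g hfg.2.1
        let T₁' : FGModuleCat.{u} R := ⟨T₁, f₁⟩
        let T₂' : FGModuleCat.{u} R := ⟨T₂, f₂⟩
        let S : ShortComplex (FGModuleCat.{u} R) :=
          .mk (X₁ := T₁') (X₂ := M i) (X₃ := T₂') (fgHom f) (fgHom g) (fg_hom_ext (by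
            ext x
            exact hfg.2.2.le ⟨x, rfl⟩))
        have hS : S.ShortExact := (fg_shortExact_iff S).2 hfg
        obtain ⟨W₂, ⟨r⟩, hW₂⟩ := ih (X := T₂') h₂
        obtain ⟨W, x, y, w, hW, hr⟩ := exists_retract_of_retract_right hS r
        refine ⟨W, hr, .succ _ hW ?_ hW₂⟩
        obtain ⟨m', M', a', b', hM', e'⟩ := exists_sum_of_memAdd (X := T₁')
          (by rintro M rfl; exact T.property) h₁
        obtain rfl : M' = fun _ => T :=
          funext fun i => ObjectProperty.FullSubcategory.ext (hM' i)
        change 𝟙 T₁' ∈ through T _ _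
        rw [e']
        exact sum_mem fun j _ => through_of_comp _ _) a b
    exact ⟨Z, ⟨⟨c, d, (e.trans e').symm⟩⟩, hZ⟩

lemma exists_bracket_iff_extLE (n : ℕ) :
    (∃ T : ModuleCat.{u} R, Module.Finite R T ∧
      ∀ X : ModuleCat.{u} R, Module.Finite R X → X ∈ bracket R T (n + 1)) ↔
    ExtLE (FGModuleCat.{u} R) n := by
  constructor
  · rintro ⟨T, hT, h⟩
    exact ⟨⟨T, hT⟩, fun X => exists_retract_of_mem_bracket (h X.obj X.property)⟩
  · rintro ⟨T, h⟩
    refine ⟨T.obj, T.property, fun X hX => ?_⟩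
    obtain ⟨W, ⟨r⟩, hW⟩ := h ⟨X, hX⟩
    exact bracket_of_retract hW.mem_bracket (lin r.i) (lin r.r) congr(lin $(r.retract))

end FG

lemma extDim_eq_of_extLE_iff {R S : Type u} [Ring R] [Ring S] [IsNoetherianRing R]
    [IsNoetherianRing S]
    (h : ∀ n, ExtLE (FGModuleCat.{u} R) n ↔ ExtLE (FGModuleCat.{u} S) n) :
    extDim R = extDim S := by
  simp only [extDim, exists_bracket_iff_extLE, h]

end Paper

end

section

open CategoryTheory Limits

namespace Paper

section Matlis

variable {k : Type u} [CommRing k]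

lemma length_hom_le_of_exact {N₁ N₂ N₃ E : Type u} [AddCommGroup N₁] [AddCommGroup N₂]
    [AddCommGroup N₃] [AddCommGroup E] [Module k N₁] [Module k N₂] [Module k N₃] [Module k E]
    (f : N₁ →ₗ[k] N₂) (g : N₂ →ₗ[k] N₃) (hg : Function.Surjective g)
    (h : Function.Exact f g) :
    Module.length k (N₂ →ₗ[k] E) ≤ Module.length k (N₁ →ₗ[k] E) + Module.length k (N₃ →ₗ[k] E) := by
  let F := LinearMap.lcomp k E f
  let G := LinearMap.lcomp k E g
  have hFG : Function.Exact G F.rangeRestrict := by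
    intro φ
    constructor
    · intro hφ
      have h0 : φ ∘ₗ f = 0 := congr_arg Subtype.val hφ
      refine ⟨(LinearMap.range f).liftQ φ (by
        rintro _ ⟨x, rfl⟩; exact congr($h0 x)) ∘ₗ
        (h.linearEquivOfSurjective hg).symm.toLinearMap, ?_⟩
      ext x
      have : (h.linearEquivOfSurjective hg).symm (g x) = Submodule.Quotient.mk x := by
        rw [LinearEquiv.symm_apply_eq]; rfl
      simp [G, this]
    · rintro ⟨ψ, rfl⟩
      refine Subtype.ext (LinearMap.ext fun x => ?_)
      simp [F, G, h.apply_apply_eq_zero]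
  rw [Module.length_eq_add_of_exact G F.rangeRestrict
    (fun a b hab => LinearMap.ext fun y => by
      obtain ⟨x, rfl⟩ := hg y; exact congr($hab x)) F.surjective_rangeRestrict hFG, add_comm]
  gcongr
  exact Module.length_le_of_injective _ (Submodule.injective_subtype _)

/-- A module is a *small cogenerator* if the dual of a module of finite length has at most the
same length and finitely generated modules have enough functionals. -/
structure IsMatlis (k : Type u) [CommRing k] (E : Type u) [AddCommGroup E] [Module k E] : Prop where
  injective : Module.Injective k E
  length_le : ∀ (N : Type u) [AddCommGroup N] [Module k N] [Module.Finite k N],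
    Module.length k (N →ₗ[k] E) ≤ Module.length k N
  exists_ne_zero : ∀ (N : Type u) [AddCommGroup N] [Module k N] (x : N), x ≠ 0 →
    ∃ f : N →ₗ[k] E, f x ≠ 0

lemma length_hom_le [IsArtinianRing k] {E : Type u} [AddCommGroup E] [Module k E]
    (j : (∀ m : MaximalSpectrum k, k ⧸ m.asIdeal) →ₗ[k] E)
    (hess : ∀ x : E, x ≠ 0 → ∃ r : k, r • x ≠ 0 ∧ r • x ∈ LinearMap.range j)
    (hj : Function.Injective j)
    (N : Type u) [AddCommGroup N] [Module k N] [hN : Module.Finite k N] :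
    Module.length k (N →ₗ[k] E) ≤ Module.length k N := by
  classical
  refine IsNoetherianRing.induction_on_isQuotientEquivQuotientPrime k hN
    (motive := fun N _ _ _ => Module.length k (N →ₗ[k] E) ≤ Module.length k N) ?_ ?_ ?_
  · intro N _ _ _ _
    have : Subsingleton (N →ₗ[k] E) := ⟨fun f g => LinearMap.ext fun x => by
      rw [Subsingleton.elim x 0, map_zero, map_zero]⟩
    rw [Module.length_eq_zero]
    exact zero_le
  · intro N _ _ _ p e
    have hp := IsArtinianRing.isMaximal_of_isPrime p.1
    let m : MaximalSpectrum k := ⟨p.1, hp⟩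
    let s : (k ⧸ p.1) →ₗ[k] E := j ∘ₗ LinearMap.single k (fun m : MaximalSpectrum k =>
      k ⧸ m.asIdeal) m
    let ev : (N →ₗ[k] E) →ₗ[k] E := LinearMap.applyₗ (e.symm 1)
    have hs (φ : N →ₗ[k] E) (r : k) : r • φ (e.symm 1) = φ (e.symm (Ideal.Quotient.mk p.1 r)) := by
      rw [← map_smul, ← map_smul, Algebra.smul_def, mul_one]; rfl
    have hev : Function.Injective ev := by
      intro φ ψ h
      ext x
      obtain ⟨r, hr⟩ := Ideal.Quotient.mk_surjective (e x)
      obtain rfl : e.symm (Ideal.Quotient.mk p.1 r) = x := by rw [hr]; simp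
      rw [← hs, ← hs]
      exact congr_arg (r • ·) h
    have hrange (φ) : ev φ ∈ LinearMap.range s := by
      by_cases h0 : ev φ = 0
      · rw [h0]; exact zero_mem _
      have hkill (c : k) (hc : c ∈ p.1) : c • ev φ = 0 := by
        change c • φ (e.symm 1) = 0
        rw [hs, Ideal.Quotient.eq_zero_iff_mem.2 hc, map_zero, map_zero]
      obtain ⟨r, hr0, y, hy⟩ := hess _ h0
      have hrp : r ∉ p.1 := fun h => hr0 (hkill r h)
      obtain ⟨t, ht⟩ : ∃ t, 1 - r * t ∈ p.1 := by
        obtain ⟨t, ht⟩ := hp.exists_inv hrp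
        obtain ⟨i, hi, h⟩ := ht
        exact ⟨t, by rw [← h]; simpa [mul_comm] using hi⟩
      have hx : ev φ = j (t • y) := by
        have := hkill _ ht
        rw [sub_smul, one_smul, sub_eq_zero] at this
        rwa [map_smul, hy, smul_smul, mul_comm t r]
      refine ⟨(t • y) m, ?_⟩
      rw [hx]
      change j _ = j _
      congr 1
      ext m'
      by_cases hm : m' = m
      · subst hm; simp
      · rw [LinearMap.single_apply, Pi.single_eq_of_ne hm]
        obtain ⟨c, hc, hc'⟩ : ∃ c ∈ p.1, c ∉ m'.asIdeal := by
          by_contra! h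
          exact hm (MaximalSpectrum.ext (hp.eq_of_le m'.isMaximal.ne_top h).symm)
        have h1 : c • (t • y) = 0 := hj (by rw [map_smul, ← hx, hkill c hc, map_zero])
        have h2 : c • ((t • y) m') = 0 := congr($h1 m')
        rw [Algebra.smul_def, mul_eq_zero] at h2
        exact (h2.resolve_left (by
          rwa [Ideal.Quotient.algebraMap_eq, Ideal.Quotient.eq_zero_iff_mem])).symm
    calc Module.length k (N →ₗ[k] E) ≤ Module.length k (LinearMap.range s) :=
          Module.length_le_of_injective (ev.codRestrict _ hrange)
            fun _ _ h => hev (congr_arg Subtype.val h)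
      _ ≤ Module.length k (k ⧸ p.1) :=
          Module.length_le_of_surjective _ s.surjective_rangeRestrict
      _ = Module.length k N := e.symm.length_eq
  · intro N₁ _ _ _ N₂ _ _ _ N₃ _ _ _ f g hf hg h h₁ h₃
    rw [Module.length_eq_add_of_exact f g hf hg h]
    exact (length_hom_le_of_exact f g hg h).trans (add_le_add h₁ h₃)

variable (k) in
lemma exists_isMatlis [IsArtinianRing k] :
    ∃ (E : Type u) (_ : AddCommGroup E) (_ : Module k E), IsMatlis k E := by
  let S := ∀ m : MaximalSpectrum k, k ⧸ m.asIdeal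
  let I := Injective.under (ModuleCat.of k S)
  let ι : S →ₗ[k] I := (Injective.ι (ModuleCat.of k S)).hom
  have hι : Function.Injective ι := (ModuleCat.mono_iff_injective _).1 inferInstance
  have hI : Module.Injective k I :=
    Module.injective_module_of_injective_object k I (inj := inferInstanceAs (Injective I))
  obtain ⟨K, hK⟩ : ∃ K : Submodule k I, Maximal (fun K => Disjoint K (LinearMap.range ι)) K := by
    obtain ⟨K, -, hK⟩ := zorn_le_nonempty₀ {K : Submodule k I | Disjoint K (LinearMap.range ι)}
      (fun c hc hchain y hy => ⟨sSup c, by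
        rw [Set.mem_ofPred_eq, Submodule.disjoint_def]
        intro x hx hx'
        obtain ⟨K, hKc, hxK⟩ := (Submodule.mem_sSup_of_directed ⟨y, hy⟩ hchain.directedOn).1 hx
        exact (Submodule.disjoint_def.1 (hc hKc)) x hxK hx', fun _ => le_sSup⟩) ⊥
      (by simp)
    exact ⟨K, hK⟩
  let j : S →ₗ[k] (I ⧸ K) := K.mkQ ∘ₗ ι
  have hj : Function.Injective j := by
    rw [← LinearMap.ker_eq_bot, LinearMap.ker_eq_bot']
    intro x hx
    have : ι x ∈ K := (Submodule.Quotient.mk_eq_zero K).1 hx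
    exact hι ((Submodule.disjoint_def.1 hK.1 _ this ⟨x, rfl⟩).trans (map_zero ι).symm)
  have hess : ∀ x : I ⧸ K, x ≠ 0 → ∃ r : k, r • x ≠ 0 ∧ r • x ∈ LinearMap.range j := by
    intro x hx
    obtain ⟨x, rfl⟩ := K.mkQ_surjective x
    by_contra! h
    have hd : Disjoint (K ⊔ Submodule.span k {x}) (LinearMap.range ι) := by
      rw [Submodule.disjoint_def]
      intro y hy hy'
      obtain ⟨a, ha, b, hb, rfl⟩ := Submodule.mem_sup.1 hy
      obtain ⟨r, rfl⟩ := Submodule.mem_span_singleton.1 hb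
      obtain ⟨s, hs⟩ := hy'
      have e : r • K.mkQ x = j s := by
        change r • K.mkQ x = K.mkQ (ι s)
        have h0 : K.mkQ a = 0 := (Submodule.Quotient.mk_eq_zero K).2 ha
        rw [hs, map_add, map_smul, h0, zero_add]
      have h0 : r • K.mkQ x = 0 := by
        by_contra h0
        exact h r h0 ⟨s, e.symm⟩
      have : s = 0 := hj (by rw [← e, h0, map_zero])
      rw [← hs, this, map_zero]
    have := hK.2 hd le_sup_left
    exact hx ((Submodule.Quotient.mk_eq_zero K).2
      (this (Submodule.mem_sup_right (Submodule.mem_span_singleton_self x))))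
  have hlen := length_hom_le j hess hj
  have hfin : Module.length k (I ⧸ K) ≠ ⊤ := by
    refine ne_top_of_le_ne_top (Module.length_ne_top (R := k) (M := k)) ?_
    have := hlen k
    rwa [(LinearMap.ringLmapEquivSelf k k (I ⧸ K)).length_eq] at this
  obtain ⟨φ, hφ⟩ := hI.out j hj ι
  have hφinj : Function.Injective φ := by
    rw [← LinearMap.ker_eq_bot, LinearMap.ker_eq_bot']
    intro x hx
    by_contra h0
    obtain ⟨r, hr, s, hs⟩ := hess x h0
    have : ι s = 0 := by rw [← hφ, hs, map_smul, hx, smul_zero]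
    have : s = 0 := hι (this.trans (map_zero ι).symm)
    exact hr (by rw [← hs, this, map_zero])
  let ψ : (I ⧸ K) →ₗ[k] (I ⧸ K) := K.mkQ ∘ₗ φ
  have hψinj : Function.Injective ψ := by
    rw [← LinearMap.ker_eq_bot, LinearMap.ker_eq_bot']
    intro x hx
    by_contra h0
    obtain ⟨r, hr, s, hs⟩ := hess x h0
    have : j s = 0 := by
      change K.mkQ (ι s) = 0
      rw [← hφ, hs, map_smul, map_smul]
      exact (congr_arg (r • ·) hx).trans (smul_zero r)
    exact hr (by rw [← hs, this])
  have hart : IsArtinian k (I ⧸ K) :=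
    ((isFiniteLength_iff_isNoetherian_isArtinian).1 (Module.length_ne_top_iff.1 hfin)).2
  let e : (I ⧸ K) ≃ₗ[k] (I ⧸ K) := LinearEquiv.ofBijective ψ
    (IsArtinian.bijective_of_injective_endomorphism ψ hψinj)
  have hinj : Module.Injective k (I ⧸ K) := by
    refine ⟨fun X Y _ _ _ _ f hf g => ?_⟩
    obtain ⟨h, hh⟩ := hI.out f hf (φ ∘ₗ g)
    refine ⟨e.symm.toLinearMap ∘ₗ K.mkQ ∘ₗ h, fun x => ?_⟩
    change e.symm (K.mkQ (h (f x))) = g x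
    rw [hh, LinearEquiv.symm_apply_eq]
    rfl
  refine ⟨I ⧸ K, inferInstance, inferInstance, hinj, fun N _ _ _ => hlen N, fun N _ _ x hx => ?_⟩
  have hann : Ideal.torsionOf k N x ≠ ⊤ := fun h => hx (by
    have : (1 : k) ∈ Ideal.torsionOf k N x := h ▸ Submodule.mem_top
    simpa using this)
  obtain ⟨m, hm, hle⟩ := Ideal.exists_le_maximal _ hann
  classical
  let m' : MaximalSpectrum k := ⟨m, hm⟩
  let t : (k ⧸ Ideal.torsionOf k N x) →ₗ[k] (I ⧸ K) := j ∘ₗ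
    LinearMap.single k (fun m : MaximalSpectrum k => k ⧸ m.asIdeal) m' ∘ₗ
      (Submodule.factor hle)
  let q := (Ideal.quotTorsionOfEquivSpanSingleton k N x)
  obtain ⟨f, hf⟩ := hinj.out (Submodule.span k {x}).subtype (Submodule.injective_subtype _)
    (t ∘ₗ q.symm.toLinearMap)
  refine ⟨f, fun h => ?_⟩
  have h1 := hf ⟨x, Submodule.mem_span_singleton_self x⟩
  have h2 : q.symm ⟨x, Submodule.mem_span_singleton_self x⟩ = Submodule.Quotient.mk 1 := by
    rw [LinearEquiv.symm_apply_eq, Ideal.quotTorsionOfEquivSpanSingleton_apply_mk]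
    ext; simp
  have h3 : t (Submodule.Quotient.mk 1) = 0 := by
    rw [← h2]; exact h1.symm.trans h
  have h4 := hj (h3.trans (map_zero j).symm)
  have h5 := congr_fun h4 m'
  have h6 : Ideal.Quotient.mk m 1 = 0 := (Pi.single_eq_same m' _).symm.trans h5
  exact hm.ne_top ((Ideal.eq_top_iff_one _).2 (Ideal.Quotient.eq_zero_iff_mem.1 h6))

end Matlis

section Dual

variable {k : Type u} [CommRing k] {E : Type u} [AddCommGroup E] [Module k E]

lemma IsMatlis.finite [IsArtinianRing k] (h : IsMatlis k E) (N : Type u) [AddCommGroup N]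
    [Module k N] [Module.Finite k N] : Module.Finite k (N →ₗ[k] E) := by
  have : Module.length k (N →ₗ[k] E) ≠ ⊤ :=
    ne_top_of_le_ne_top (Module.length_ne_top (R := k) (M := N)) (h.length_le N)
  have := ((isFiniteLength_iff_isNoetherian_isArtinian).1 (Module.length_ne_top_iff.1 this)).1
  infer_instance

lemma IsMatlis.bijective_eval [IsArtinianRing k] (h : IsMatlis k E) (N : Type u) [AddCommGroup N]
    [Module k N] [Module.Finite k N] :
    Function.Bijective (LinearMap.applyₗ : N →ₗ[k] (N →ₗ[k] E) →ₗ[k] E) := by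
  have hinj : Function.Injective (LinearMap.applyₗ : N →ₗ[k] (N →ₗ[k] E) →ₗ[k] E) := by
    rw [← LinearMap.ker_eq_bot, LinearMap.ker_eq_bot']
    intro x hx
    by_contra h0
    obtain ⟨f, hf⟩ := h.exists_ne_zero N x h0
    exact hf congr($hx f)
  have := h.finite N
  have := h.finite (N →ₗ[k] E)
  refine ⟨hinj, ?_⟩
  by_contra hsurj
  have h1 := Submodule.length_lt (N := LinearMap.range
    (LinearMap.applyₗ : N →ₗ[k] (N →ₗ[k] E) →ₗ[k] E)) (fun h => hsurj (LinearMap.range_eq_top.1 h))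
  rw [← (LinearEquiv.ofInjective _ hinj).length_eq] at h1
  exact absurd ((h.length_le _).trans (h.length_le _)) (not_le.2 h1)

variable {R S T : Type u} [Ring R] [Ring S] [Algebra k R] [Algebra k S]

/-- The dual of an `R`-module `X` with values in `E`, seen as a module over `S`. -/
def DualMod (_σ : S →ₐ[k] Rᵐᵒᵖ) (E : Type u) [AddCommGroup E] [Module k E] (X : Type u)
    [AddCommGroup X] [Module k X] : Type u :=
  X →ₗ[k] E

variable (σ : S →ₐ[k] Rᵐᵒᵖ) (X : Type u) [AddCommGroup X] [Module k X]

instance : AddCommGroup (DualMod σ E X) :=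
  inferInstanceAs (AddCommGroup (X →ₗ[k] E))

instance : Module k (DualMod σ E X) :=
  inferInstanceAs (Module k (X →ₗ[k] E))

variable {σ X} in
/-- The linear form underlying an element of the dual. -/
def DualMod.toHom (f : DualMod σ E X) : X →ₗ[k] E := f

variable {σ X} in
lemma DualMod.ext {f g : DualMod σ E X} (h : ∀ x, f.toHom x = g.toHom x) : f = g :=
  LinearMap.ext h

lemma dualMod_base_smul_apply (c : k) (f : DualMod σ E X) (x : X) :
    (c • f).toHom x = c • f.toHom x := rfl

variable [Module R X] [IsScalarTower k R X]

instance : SMul S (DualMod σ E X) where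
  smul s f := LinearMap.comp (M₂ := X) f (Algebra.lsmul k k X (σ s).unop)

lemma dualMod_smul_apply (s : S) (f : DualMod σ E X) (x : X) :
    (s • f).toHom x = f.toHom ((σ s).unop • x) := rfl

instance : Module S (DualMod σ E X) where
  one_smul f := DualMod.ext fun x => by
    rw [dualMod_smul_apply, map_one, MulOpposite.unop_one, one_smul]
  mul_smul s t f := DualMod.ext fun x => by
    rw [dualMod_smul_apply, map_mul, MulOpposite.unop_mul, mul_smul]; rfl
  smul_zero s := rfl
  smul_add s f g := rfl
  add_smul s t f := DualMod.ext fun x => by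
    rw [dualMod_smul_apply, map_add, MulOpposite.unop_add, add_smul, map_add]; rfl
  zero_smul f := DualMod.ext fun x => by
    rw [dualMod_smul_apply, map_zero, MulOpposite.unop_zero, zero_smul, map_zero]; rfl

instance : IsScalarTower k S (DualMod σ E X) where
  smul_assoc c s f := DualMod.ext fun x => by
    rw [dualMod_smul_apply, map_smul σ, MulOpposite.unop_smul, smul_assoc, map_smul f.toHom,
      dualMod_base_smul_apply, dualMod_smul_apply]

lemma DualMod.finite [IsArtinianRing k] (h : IsMatlis k E) [Module.Finite k R]
    [Module.Finite R X] : Module.Finite S (DualMod σ E X) := by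
  have := Module.Finite.trans (R := k) R (X)
  have : Module.Finite k (DualMod σ E X) := h.finite (X)
  exact Module.Finite.of_restrictScalars_finite k S _

variable {X} {Y : Type u} [AddCommGroup Y] [Module k Y] [Module R Y]
  [IsScalarTower k R Y]

variable (E) in
/-- Functoriality of the dual. -/
def dualMap (f : X →ₗ[R] Y) : DualMod σ E Y →ₗ[S] DualMod σ E X where
  toFun φ := φ.toHom ∘ₗ f.restrictScalars k
  map_add' _ _ := rfl
  map_smul' s φ := DualMod.ext fun x =>
    congr_arg φ.toHom (f.map_smul (σ s).unop x).symm

lemma dualMap_apply (f : X →ₗ[R] Y) (φ : DualMod σ E Y) (x : X) :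
    (dualMap E σ f φ).toHom x = φ.toHom (f x) := rfl

lemma dualMap_isSES (hE : Module.Injective k E) {Z : Type u} [AddCommGroup Z] [Module k Z]
    [Module R Z] [IsScalarTower k R Z]
    (f : X →ₗ[R] Y) (g : Y →ₗ[R] Z)
    (h : IsSES R (X := .of R X) (Y := .of R Y) (Z := .of R Z) f g) :
    IsSES S (X := .of S (DualMod σ E Z)) (Y := .of S (DualMod σ E Y)) (Z := .of S (DualMod σ E X))
      (dualMap E σ g) (dualMap E σ f) := by
  obtain ⟨h₁, h₂, h₃⟩ := h
  refine ⟨fun φ ψ h => DualMod.ext (σ := σ) fun z => ?_, fun φ => ?_, le_antisymm ?_ ?_⟩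
  · obtain ⟨y, rfl⟩ := h₂ z
    exact congr(DualMod.toHom (σ := σ) $h y)
  · obtain ⟨ψ, hψ⟩ := hE.out (f.restrictScalars k) h₁ (DualMod.toHom (σ := σ) φ)
    exact ⟨ψ, DualMod.ext (σ := σ) hψ⟩
  · rintro _ ⟨φ, rfl⟩
    refine LinearMap.mem_ker.2 (DualMod.ext (σ := σ) fun x => ?_)
    have : g (f x) = 0 := h₃.le ⟨x, rfl⟩
    rw [dualMap_apply, dualMap_apply, this, map_zero]
    rfl
  · intro φ hφ
    have hφ' (x : X) : DualMod.toHom (σ := σ) φ (f x) = 0 := congr(DualMod.toHom (σ := σ) $hφ x)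
    have hex : Function.Exact (f.restrictScalars k) (g.restrictScalars k) := fun y =>
      (SetLike.ext_iff.1 h₃ y).symm
    have hle : LinearMap.range (f.restrictScalars k) ≤
        LinearMap.ker (DualMod.toHom (σ := σ) φ) := by
      rintro _ ⟨x, rfl⟩; exact hφ' x
    refine ⟨(LinearMap.range (f.restrictScalars k)).liftQ (DualMod.toHom (σ := σ) φ) hle ∘ₗ
        (hex.linearEquivOfSurjective h₂).symm.toLinearMap, DualMod.ext (σ := σ) fun y => ?_⟩
    have : (hex.linearEquivOfSurjective h₂).symm (g y) = Submodule.Quotient.mk y := by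
      rw [LinearEquiv.symm_apply_eq]; rfl
    change (LinearMap.range (f.restrictScalars k)).liftQ (DualMod.toHom (σ := σ) φ) hle
      ((hex.linearEquivOfSurjective h₂).symm (g y)) = _
    rw [this]
    rfl

end Dual

section DualFunctor

variable {k : Type u} [CommRing k] {E : Type u} [AddCommGroup E] [Module k E]
variable {R S : Type u} [Ring R] [Ring S] [Algebra k R] [Algebra k S]

/-- The module structure over the base ring of an algebra. -/
@[reducible] def fgModule (k : Type u) [CommRing k] {R : Type u} [Ring R] [Algebra k R]
    (X : FGModuleCat.{u} R) : Module k X.obj :=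
  Module.compHom _ (algebraMap k R)

attribute [local instance] fgModule

lemma fg_isScalarTower (X : FGModuleCat.{u} R) : IsScalarTower k R X.obj where
  smul_assoc c r x := by rw [Algebra.smul_def, mul_smul]; rfl

attribute [local instance] fg_isScalarTower

variable [IsArtinianRing k] [Module.Finite k R]

/-- The duality functor on finitely generated modules over an Artin algebra. -/
def dualFunctor (hE : IsMatlis k E) (σ : S →ₐ[k] Rᵐᵒᵖ) : (FGModuleCat.{u} R)ᵒᵖ ⥤ FGModuleCat.{u} S where
  obj X := ⟨ModuleCat.of S (DualMod σ E X.unop.obj),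
    have : Module.Finite R X.unop.obj := X.unop.property
    DualMod.finite σ X.unop.obj hE⟩
  map f := fgHom (dualMap E σ (lin f.unop))

instance (hE : IsMatlis k E) (σ : S →ₐ[k] Rᵐᵒᵖ) : (dualFunctor hE σ).Additive where
  map_add {_ _ f g} := fg_hom_ext (LinearMap.ext fun φ => DualMod.ext (σ := σ) fun x =>
    map_add φ.toHom (lin f.unop x) (lin g.unop x))

lemma exists_retract_dual [Module.Finite k S] (hE : IsMatlis k E) (σ : S →ₐ[k] Rᵐᵒᵖ) (σ' : R →ₐ[k] Sᵐᵒᵖ)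
    (h : ∀ s, (σ' (σ s).unop).unop = s) (Y : FGModuleCat.{u} S) :
    ∃ X, Nonempty (Retract Y ((dualFunctor hE σ).obj X)) := by
  let X := (dualFunctor hE σ').obj (.op Y)
  let ev : Y.obj →ₗ[S] DualMod σ E X.obj :=
    { toFun y :=
        { toFun φ := DualMod.toHom (σ := σ') φ y
          map_add' _ _ := rfl
          map_smul' c φ := by
            have h0 : c • φ = (show DualMod σ' E Y.obj from c • show DualMod σ' E Y.obj from φ) :=
              algebraMap_smul (M := DualMod σ' E Y.obj) R c φ
            rw [h0]
            rfl }
      map_add' y z := DualMod.ext (σ := σ) fun φ => map_add (DualMod.toHom (σ := σ') φ) y z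
      map_smul' s y := DualMod.ext (σ := σ) fun φ => by
        change DualMod.toHom (σ := σ') φ (s • y) =
          DualMod.toHom (σ := σ') (show DualMod σ' E Y.obj from
            (σ s).unop • show DualMod σ' E Y.obj from φ) y
        rw [dualMod_smul_apply, h] }
  have hfin : Module.Finite k Y.obj :=
    have : Module.Finite S Y.obj := Y.property
    Module.Finite.trans S _
  have hev : Function.Bijective ev := by
    obtain ⟨h₁, h₂⟩ := hE.bijective_eval Y.obj
    constructor
    · intro y z hyz
      exact h₁ (LinearMap.ext fun φ => congr(DualMod.toHom (σ := σ) $hyz φ))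
    · intro ψ
      let ψ' : (Y.obj →ₗ[k] E) →ₗ[k] E :=
        { toFun φ := DualMod.toHom (σ := σ) ψ φ
          map_add' := map_add (DualMod.toHom (σ := σ) ψ)
          map_smul' c φ := by
            have h0 : (show DualMod σ' E Y.obj from c • φ) =
              (show X.obj from c • show X.obj from φ) :=
                (algebraMap_smul (M := DualMod σ' E Y.obj) R c φ).symm
            exact (congr_arg (DualMod.toHom (σ := σ) ψ) h0).trans
              (map_smul (DualMod.toHom (σ := σ) ψ) c _) }
      obtain ⟨y, hy⟩ := h₂ ψ'
      exact ⟨y, DualMod.ext (σ := σ) fun φ => congr($hy φ)⟩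
  let e := LinearEquiv.ofBijective ev hev
  exact ⟨.op X, ⟨⟨fgHom ev, fgHom (X := (dualFunctor hE σ).obj (.op X)) e.symm.toLinearMap,
    fg_hom_ext (LinearMap.ext fun y => e.symm_apply_apply y)⟩⟩⟩

lemma dualFunctor_shortExact [IsNoetherianRing R] [IsNoetherianRing S]
    (hE : IsMatlis k E) (σ : S →ₐ[k] Rᵐᵒᵖ)
    (T : ShortComplex (FGModuleCat.{u} R)ᵒᵖ) (hT : T.ShortExact) :
    (T.map (dualFunctor hE σ)).ShortExact :=
  (fg_shortExact_iff _).2 (dualMap_isSES σ hE.injective _ _ ((fg_shortExact_iff _).1 hT.unop))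

end DualFunctor

lemma ExtLE.of_exact {C D : Type*} [Category* C] [Category* D] [Abelian C] [Abelian D]
    (Ψ : C ⥤ D) [Ψ.Additive] (hΨ : ∀ S : ShortComplex C, S.ShortExact → (S.map Ψ).ShortExact)
    (h : ∀ Y, ∃ X, Nonempty (Retract Y (Ψ.obj X))) {n : ℕ} (hn : ExtLE C n) : ExtLE D n := by
  obtain ⟨M, hM⟩ := hn
  have key : ∀ (n : ℕ) (X : C), Filt M n X → Filt (Ψ.obj M) n (Ψ.obj X) := by
    intro n X hX
    induction hX with
    | zero h => exact .zero (Ψ.map_isZero h)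
    | succ S hS h₁ _ ih => exact .succ _ (hΨ S hS) (h₁.map Ψ) ih
  refine ⟨Ψ.obj M, fun Y => ?_⟩
  obtain ⟨X, ⟨r⟩⟩ := h Y
  obtain ⟨W, ⟨s⟩, hW⟩ := hM X
  exact ⟨Ψ.obj W, ⟨r.trans (s.map Ψ)⟩, key _ _ hW⟩

lemma isNoetherianRing_of_finite (k : Type u) [CommRing k] [IsArtinianRing k] (R : Type u) [Ring R]
    [Algebra k R] [Module.Finite k R] : IsNoetherianRing R :=
  isNoetherian_of_tower k inferInstance

lemma extLE_op_of_extLE (k : Type u) [CommRing k] [IsArtinianRing k] {R S : Type u} [Ring R]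
    [Ring S] [Algebra k R] [Algebra k S] [Module.Finite k R] [Module.Finite k S]
    [IsNoetherianRing R] [IsNoetherianRing S]
    (σ : S →ₐ[k] Rᵐᵒᵖ) (σ' : R →ₐ[k] Sᵐᵒᵖ) (h : ∀ s, (σ' (σ s).unop).unop = s) {n : ℕ}
    (hn : ExtLE (FGModuleCat.{u} R) n) : ExtLE (FGModuleCat.{u} S) n := by
  obtain ⟨E, _, _, hE⟩ := exists_isMatlis k
  exact hn.op.of_exact (dualFunctor hE σ) (dualFunctor_shortExact hE σ)
    (fun Y => (exists_retract_dual hE σ σ' h Y))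

/-- The opposite of an Artin algebra has the same extension dimension. -/
lemma extLE_mulOpposite_iff (k : Type u) [CommRing k] [IsArtinianRing k] (R : Type u) [Ring R]
    [Algebra k R] [Module.Finite k R] [IsNoetherianRing R] [IsNoetherianRing Rᵐᵒᵖ] (n : ℕ) :
    ExtLE (FGModuleCat.{u} Rᵐᵒᵖ) n ↔ ExtLE (FGModuleCat.{u} R) n :=
  ⟨extLE_op_of_extLE k (AlgEquiv.opOp k R).toAlgHom (AlgHom.id k _) fun _ => rfl,
    extLE_op_of_extLE k (AlgHom.id k _) (AlgEquiv.opOp k R).toAlgHom fun _ => rfl⟩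

section Generators

lemma isAdd_pi {R : Type u} [Ring R] {M X : FGModuleCat.{u} R} {n : ℕ}
    (e : X.obj ≃ₗ[R] (Fin n → M.obj)) : IsAdd M X := by
  have h : 𝟙 X = ∑ i, (fgHom (LinearMap.proj i ∘ₗ e.toLinearMap) : X ⟶ M) ≫
      (fgHom (e.symm.toLinearMap ∘ₗ LinearMap.single R (fun _ => M.obj) i) : M ⟶ X) := by
    refine fg_hom_ext ?_
    rw [lin_sum]
    ext x
    have h : x = e.symm (e x) := by simp
    rw [← Finset.univ_sum_single (e x), map_sum] at h
    simpa [LinearMap.sum_apply] using h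
  rw [IsAdd, h]
  exact sum_mem fun i _ => through_of_comp _ _

lemma fg_surjective_of_epi {R : Type u} [Ring R] [IsNoetherianRing R] {X Y : FGModuleCat.{u} R}
    (f : X ⟶ Y) [Epi f] : Function.Surjective (lin f) :=
  (ModuleCat.epi_iff_surjective _).1
    (inferInstanceAs (Epi ((forget₂ (FGModuleCat.{u} R) (ModuleCat.{u} R)).map f)))

lemma fg_injective_of_mono {R : Type u} [Ring R] [IsNoetherianRing R] {X Y : FGModuleCat.{u} R}
    (f : X ⟶ Y) [Mono f] : Function.Injective (lin f) :=
  (ModuleCat.mono_iff_injective _).1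
    (inferInstanceAs (Mono ((forget₂ (FGModuleCat.{u} R) (ModuleCat.{u} R)).map f)))

lemma fg_epi_of_surjective {R : Type u} [Ring R] {X Y : FGModuleCat.{u} R}
    (f : X ⟶ Y) (h : Function.Surjective (lin f)) : Epi f :=
  (forget₂ (FGModuleCat.{u} R) (ModuleCat.{u} R)).epi_of_epi_map
    ((ModuleCat.epi_iff_surjective _).2 h)

lemma fg_mono_of_injective {R : Type u} [Ring R] {X Y : FGModuleCat.{u} R}
    (f : X ⟶ Y) (h : Function.Injective (lin f)) : Mono f :=
  (forget₂ (FGModuleCat.{u} R) (ModuleCat.{u} R)).mono_of_mono_map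
    ((ModuleCat.mono_iff_injective _).2 h)

/-- The regular module is a projective generator. -/
lemma isProjGen_regular {R : Type u} [Ring R] [IsNoetherianRing R] :
    IsProjGen (FGModuleCat.of R R) where
  projective := ⟨fun {X Y} f e he => by
    obtain ⟨x, hx⟩ := fg_surjective_of_epi e (lin f (1 : R))
    refine ⟨fgHom (LinearMap.toSpanSingleton R X.obj x), fg_hom_ext (LinearMap.ext_ring ?_)⟩
    change lin e ((1 : R) • x) = _
    rw [one_smul, hx]⟩
  exists_epi X := by
    have : Module.Finite R X.obj := X.property
    obtain ⟨n, p, hp⟩ := Module.Finite.exists_fin' R X.obj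
    exact ⟨FGModuleCat.of R (Fin n → R), fgHom p, fg_epi_of_surjective _ hp,
      isAdd_pi (LinearEquiv.refl R _)⟩

lemma exists_isInjCogen (k : Type u) [CommRing k] [IsArtinianRing k] (R : Type u) [Ring R]
    [Algebra k R] [Module.Finite k R] [IsNoetherianRing R] :
    ∃ J : FGModuleCat.{u} R, IsInjCogen J := by
  obtain ⟨E, _, _, hE⟩ := exists_isMatlis k
  let σ := (AlgEquiv.opOp k R).toAlgHom
  let J : FGModuleCat.{u} R := ⟨ModuleCat.of R (DualMod σ E Rᵐᵒᵖ), DualMod.finite σ Rᵐᵒᵖ hE⟩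
  let coind (X : Type u) [AddCommGroup X] [Module k X] [Module R X] [IsScalarTower k R X]
      (h : X →ₗ[k] E) : X →ₗ[R] DualMod σ E Rᵐᵒᵖ :=
    { toFun x := 
        { toFun r := h (r.unop • x)
          map_add' r r' := by simp [add_smul]
          map_smul' c r := by simp }
      map_add' x y := DualMod.ext (σ := σ) fun r => by 
        change h (r.unop • (x + y)) = h (r.unop • x) + h (r.unop • y)
        rw [smul_add, map_add]
      map_smul' s x := DualMod.ext (σ := σ) fun r => by 
        change h (r.unop • s • x) = h ((r.unop * s) • x)
        rw [mul_smul] }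
  have hcoind (X : Type u) [AddCommGroup X] [Module k X] [Module R X] [IsScalarTower k R X]
      (h : X →ₗ[k] E) (x : X) : DualMod.toHom (σ := σ) (coind X h x) 1 = h x :=
    congr_arg h (one_smul R x)
  refine ⟨J, ⟨⟨fun {X Y} g m hm => ?_⟩, fun X => ?_⟩⟩
  · let _ := fgModule k X
    let _ := fgModule k Y
    have := fg_isScalarTower (k := k) X
    have := fg_isScalarTower (k := k) Y
    let g' : X.obj →ₗ[k] E :=
      { toFun x := DualMod.toHom (σ := σ) (lin g x) 1
        map_add' x y := by rw [map_add]; rfl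
        map_smul' c x := by
          have : lin g (c • x) = algebraMap k R c • lin g x := (lin g).map_smul _ x
          rw [this]
          have : algebraMap k R c • (show DualMod σ E Rᵐᵒᵖ from lin g x) =
            c • (show DualMod σ E Rᵐᵒᵖ from lin g x) := algebraMap_smul R c _
          exact congr(DualMod.toHom (σ := σ) $this 1) }
    obtain ⟨h, hh⟩ := hE.injective.out ((lin m).restrictScalars k) (fg_injective_of_mono m) g'
    refine ⟨fgHom (coind Y.obj h), fg_hom_ext (LinearMap.ext fun x => DualMod.ext (σ := σ) ?_)⟩
    intro r
    change h (r.unop • lin m x) = DualMod.toHom (σ := σ) (lin g x) r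
    rw [← map_smul]
    refine (hh (r.unop • x)).trans ?_
    change DualMod.toHom (σ := σ) (lin g (r.unop • x)) 1 = _
    rw [map_smul]
    change DualMod.toHom (σ := σ) (lin g x) (MulOpposite.op r.unop • 1) = _
    simp
  · let _ := fgModule k X
    have := fg_isScalarTower (k := k) X
    have : Module.Finite R X.obj := X.property
    have : Module.Finite k X.obj := Module.Finite.trans R _
    have := hE.finite X.obj
    obtain ⟨n, p, hp⟩ := Module.Finite.exists_fin' k (X.obj →ₗ[k] E)
    let i : X.obj →ₗ[R] (Fin n → J.obj) :=
      LinearMap.pi fun j => coind X.obj (p (Pi.single j 1))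
    have : Module.Finite R J.obj := J.property
    refine ⟨FGModuleCat.of R (Fin n → J.obj), fgHom i, fg_mono_of_injective _ ?_,
      isAdd_pi (LinearEquiv.refl R _)⟩
    change Function.Injective i
    rw [← LinearMap.ker_eq_bot, LinearMap.ker_eq_bot']
    intro x hx
    by_contra h0
    obtain ⟨f, hf⟩ := hE.exists_ne_zero X.obj x h0
    obtain ⟨c, rfl⟩ := hp f
    refine hf ?_
    have hj (j) : p (Pi.single j 1) x = 0 := by
      rw [← hcoind]
      exact congr(DualMod.toHom (σ := σ) ($hx j) 1)
    have : c = ∑ j, c j • Pi.single j 1 := by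
      simp [← Pi.single_smul, Finset.univ_sum_single]
    rw [this, map_sum, LinearMap.sum_apply]
    refine Finset.sum_eq_zero fun j _ => ?_
    rw [map_smul, LinearMap.smul_apply, hj, smul_zero]

end Generators

end Paper

end

section

open CategoryTheory Limits Pretriangulated

namespace Paper

section HomVanishing

set_option linter.unusedSectionVars false

universe v w

variable {D : Type w} [Category.{v} D] [Preadditive D] [HasZeroObject D] [HasShift D ℤ]
  [∀ n : ℤ, (shiftFunctor D n).Additive] [Pretriangulated D]

namespace DistTriang

variable {X Y Z : D} {f : X ⟶ Y} {g : Y ⟶ Z} {δ : Z ⟶ X⟦(1 : ℤ)⟧}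
  (h : Triangle.mk f g δ ∈ distTriang D)
include h

lemma comp_zero₁ : f ≫ g = 0 := comp_distTriang_mor_zero₁₂ _ h

lemma lift₂ {W : D} (x : W ⟶ Y) (hx : x ≫ g = 0) : ∃ y : W ⟶ X, y ≫ f = x := by
  obtain ⟨y, hy⟩ := Triangle.coyoneda_exact₂ _ h x hx
  exact ⟨y, hy.symm⟩

lemma lift₃ {W : D} (x : W ⟶ Z) (hx : x ≫ δ = 0) : ∃ y : W ⟶ Y, y ≫ g = x := by
  obtain ⟨y, hy⟩ := Triangle.coyoneda_exact₃ _ h x hx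
  exact ⟨y, hy.symm⟩

lemma desc₂ {W : D} (x : Y ⟶ W) (hx : f ≫ x = 0) : ∃ y : Z ⟶ W, g ≫ y = x := by
  obtain ⟨y, hy⟩ := Triangle.yoneda_exact₂ _ h x hx
  exact ⟨y, hy.symm⟩

/-- The inverse rotation. -/
lemma exists_inv_rot : ∃ (a : Z⟦(-1 : ℤ)⟧ ⟶ X) (b : Y ⟶ Z⟦(-1 : ℤ)⟧⟦(1 : ℤ)⟧),
    Triangle.mk a f b ∈ distTriang D :=
  ⟨_, _, inv_rot_of_distTriang _ h⟩

end DistTriang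

/-- Every morphism `P ⟶ Y⟦i⟧` vanishes. -/
def HomZero (P Y : D) (i : ℤ) : Prop := ∀ f : P ⟶ Y⟦i⟧, f = 0

namespace HomZero

variable {P : D}

lemma of_retract {Y Z : D} {i : ℤ} (h : HomZero P Z i) (r : Retract Y Z) : HomZero P Y i := by
  intro f
  have := congr($(h (f ≫ r.i⟦i⟧')) ≫ r.r⟦i⟧')
  simpa [← Functor.map_comp] using this

lemma of_iso {Y Z : D} {i : ℤ} (h : HomZero P Z i) (e : Y ≅ Z) : HomZero P Y i :=
  h.of_retract ⟨e.hom, e.inv, by simp⟩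

lemma zero_iff {Y : D} : HomZero P Y 0 ↔ ∀ f : P ⟶ Y, f = 0 := by
  refine ⟨fun h f => ?_, fun h f => ?_⟩
  · have := h (f ≫ (shiftFunctorZero D ℤ).inv.app Y)
    simpa using congr($this ≫ (shiftFunctorZero D ℤ).hom.app Y)
  · have := h (f ≫ (shiftFunctorZero D ℤ).hom.app Y)
    simpa using congr($this ≫ (shiftFunctorZero D ℤ).inv.app Y)

lemma shift_iff {Y : D} (a i n : ℤ) (hn : a + i = n) :
    HomZero P (Y⟦a⟧) i ↔ HomZero P Y n := by
  refine ⟨fun h f => ?_, fun h f => ?_⟩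
  · have := h (f ≫ (shiftFunctorAdd' D a i n hn).hom.app Y)
    simpa using congr($this ≫ (shiftFunctorAdd' D a i n hn).inv.app Y)
  · have := h (f ≫ (shiftFunctorAdd' D a i n hn).inv.app Y)
    simpa using congr($this ≫ (shiftFunctorAdd' D a i n hn).hom.app Y)

variable {T : Triangle D} (hT : T ∈ distTriang D)
include hT

lemma obj₂ {i : ℤ} (h₁ : HomZero P T.obj₁ i) (h₃ : HomZero P T.obj₃ i) :
    HomZero P T.obj₂ i := by
  intro f
  obtain ⟨g, hg⟩ := Triangle.coyoneda_exact₂ _ (Triangle.shift_distinguished T hT i) f (h₃ _)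
  rw [hg, h₁ g]
  exact zero_comp

lemma obj₃ {i n : ℤ} (hn : i + 1 = n) (h₂ : HomZero P T.obj₂ i) (h₁ : HomZero P T.obj₁ n) :
    HomZero P T.obj₃ i :=
  obj₂ (rot_of_distTriang _ hT) h₂ ((shift_iff 1 i n (by omega)).2 h₁)

lemma obj₁ {i n : ℤ} (hn : n + 1 = i) (h₂ : HomZero P T.obj₂ i) (h₃ : HomZero P T.obj₃ n) :
    HomZero P T.obj₁ i :=
  obj₂ (inv_rot_of_distTriang _ hT) ((shift_iff (-1) i n (by omega)).2 h₃) h₂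

/-- The third object has no maps from `P` if `Hom(P, -)` is surjective on the first map. -/
lemma obj₃_zero (h : ∀ f : P ⟶ T.obj₂, ∃ g : P ⟶ T.obj₁, g ≫ T.mor₁ = f)
    (h₁ : HomZero P T.obj₁ 1) : HomZero P T.obj₃ 0 := by
  rw [zero_iff]
  intro f
  obtain ⟨g, rfl⟩ := Triangle.coyoneda_exact₃ T hT f (h₁ _)
  obtain ⟨g', rfl⟩ := h g
  rw [Category.assoc, comp_distTriang_mor_zero₁₂ T hT, comp_zero]

lemma obj₁_one (h : ∀ f : P ⟶ T.obj₃, ∃ g : P ⟶ T.obj₂, g ≫ T.mor₂ = f)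
    (h₂ : HomZero P T.obj₂ 1) : HomZero P T.obj₁ 1 := by
  rw [← shift_iff 1 0 1 (by simp)]
  exact obj₃_zero (rot_of_distTriang _ hT) h h₂

/-- `Hom(P, -)` is injective on the first map if the third object has no negative self-maps. -/
lemma injective_mor₁ (h₃ : HomZero P T.obj₃ (-1)) (f : P ⟶ T.obj₁) (hf : f ≫ T.mor₁ = 0) :
    f = 0 := by
  obtain ⟨g, hg⟩ := Triangle.coyoneda_exact₂ _ (inv_rot_of_distTriang _ hT) f hf
  rw [hg, h₃ g]
  exact zero_comp

end HomZero

section FiniteCover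

variable [HasFiniteBiproducts D] {P : D}

/-- The finite power `Pⁿ`. -/
noncomputable abbrev power (P : D) (n : ℕ) : D := ⨁ fun _ : Fin n => P

lemma homZero_power {Y : D} {i : ℤ} (h : HomZero P Y i) (n : ℕ) : HomZero P (power Y n) i := by
  intro f
  have : f = f ≫ (shiftFunctor D i).map (𝟙 _) := by simp
  rw [this, ← biproduct.total, Functor.map_sum, Preadditive.comp_sum]
  refine Finset.sum_eq_zero fun j _ => ?_
  rw [Functor.map_comp, ← Category.assoc, h (f ≫ _), zero_comp]

/-- The identification of `Hom(P, Y)` with its module structure over `(End P)ᵐᵒᵖ`. -/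
def homEquiv (P Y : D) : (P ⟶ Y) ≃+ (preadditiveCoyonedaObj P).obj Y := AddEquiv.refl _

lemma smul_homEquiv {Y : D} (c : P ⟶ P) (x : P ⟶ Y) :
    (MulOpposite.op (c : End P) : (End P)ᵐᵒᵖ) • homEquiv P Y x = homEquiv P Y (c ≫ x) := rfl

lemma map_homEquiv {Y Z : D} (f : Y ⟶ Z) (x : P ⟶ Y) :
    (preadditiveCoyonedaObj P).map f (homEquiv P Y x) = homEquiv P Z (x ≫ f) := rfl

lemma exists_power_cover {X : D} [Module.Finite (End P)ᵐᵒᵖ ((preadditiveCoyonedaObj P).obj X)] :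
    ∃ (n : ℕ) (π : power P n ⟶ X), ∀ f : P ⟶ X, ∃ g : P ⟶ power P n, g ≫ π = f := by
  obtain ⟨n, x, hx⟩ := Module.Finite.exists_fin (R := (End P)ᵐᵒᵖ)
    (M := (preadditiveCoyonedaObj P).obj X)
  refine ⟨n, biproduct.desc fun i => (homEquiv P X).symm (x i), fun f => ?_⟩
  have hf : homEquiv P X f ∈
      Submodule.span (End P)ᵐᵒᵖ (Set.range x) := hx ▸ Submodule.mem_top
  rw [Submodule.mem_span_range_iff_exists_fun] at hf
  obtain ⟨c, hc⟩ := hf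
  refine ⟨biproduct.lift fun i => ((c i).unop : P ⟶ P), ?_⟩
  rw [biproduct.lift_desc]
  exact hc

lemma eq_sum_power {Y : D} {n : ℕ} (f : Y ⟶ power P n) :
    f = ∑ j : Fin n, (f ≫ biproduct.π (fun _ : Fin n => P) j) ≫
      biproduct.ι (fun _ : Fin n => P) j := by
  have : f = f ≫ 𝟙 _ := by simp
  rw [← biproduct.total, Preadditive.comp_sum] at this
  simpa only [← Category.assoc] using this

instance finite_hom_power (n : ℕ) :
    Module.Finite (End P)ᵐᵒᵖ ((preadditiveCoyonedaObj P).obj (power P n)) := by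
  refine Module.Finite.of_fg_top (Submodule.fg_def.2 ⟨Set.range fun j : Fin n =>
    homEquiv P (power P n) (biproduct.ι (fun _ : Fin n => P) j), Set.finite_range _, ?_⟩)
  rw [eq_top_iff]
  intro f _
  obtain ⟨f, rfl⟩ := (homEquiv P (power P n)).surjective f
  rw [eq_sum_power f, map_sum]
  refine Submodule.sum_mem _ fun j _ => ?_
  rw [← smul_homEquiv]
  exact Submodule.smul_mem _ _ (Submodule.subset_span ⟨j, rfl⟩)

/-- The cone of a finite cover has no non-negative self-extensions. -/
lemma exists_cover_triangle {X : D}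
    [Module.Finite (End P)ᵐᵒᵖ ((preadditiveCoyonedaObj P).obj X)]
    (hP : ∀ i > 0, HomZero P P i) (hX : ∀ i > 0, HomZero P X i) :
    ∃ (n : ℕ) (M : D) (π : power P n ⟶ X) (q : X ⟶ M) (δ : M ⟶ (power P n)⟦(1 : ℤ)⟧),
      Triangle.mk π q δ ∈ distTriang D ∧
      (∀ f : P ⟶ X, ∃ g : P ⟶ power P n, g ≫ π = f) ∧ ∀ i ≥ 0, HomZero P M i := by
  obtain ⟨n, π, hπ⟩ := exists_power_cover (P := P) (X := X)
  obtain ⟨M, q, δ, h⟩ := distinguished_cocone_triangle π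
  refine ⟨n, M, π, q, δ, h, hπ, fun i hi => ?_⟩
  rcases eq_or_lt_of_le hi with rfl | hi
  · exact HomZero.obj₃_zero h hπ (homZero_power (hP 1 (by simp)) n)
  · exact HomZero.obj₃ h rfl (hX i hi) (homZero_power (hP _ (by omega)) n)

lemma hom_ext_of_orth {X X' : D}
    [Module.Finite (End P)ᵐᵒᵖ ((preadditiveCoyonedaObj P).obj X)]
    (hP : ∀ i > 0, HomZero P P i) (hX : ∀ i > 0, HomZero P X i)
    (hX' : ∀ Y : D, (∀ i ≥ 0, HomZero P Y i) → ∀ f : Y ⟶ X', f = 0)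
    (f : X ⟶ X') (hf : ∀ h : P ⟶ X, h ≫ f = 0) : f = 0 := by
  obtain ⟨n, M, π, q, δ, h, hπ, hM⟩ := exists_cover_triangle hP hX
  obtain ⟨g, hg⟩ := DistTriang.desc₂ h f (biproduct.hom_ext' _ _ fun j => by
    rw [comp_zero]
    exact (Category.assoc _ _ _).symm.trans (hf (biproduct.ι (fun _ : Fin n => P) j ≫ π)))
  rw [← hg, hX' M hM g, comp_zero]

lemma exists_hom_of_orth [IsNoetherianRing (End P)ᵐᵒᵖ] {X X' : D}
    [Module.Finite (End P)ᵐᵒᵖ ((preadditiveCoyonedaObj P).obj X)]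
    (hP : ∀ i > 0, HomZero P P i) (hX : ∀ i > 0, HomZero P X i) (hX₀ : HomZero P X (-1))
    (hX' : ∀ Y : D, (∀ i ≥ 0, HomZero P Y i) → ∀ f : Y ⟶ X', f = 0)
    (φ : (preadditiveCoyonedaObj P).obj X →ₗ[(End P)ᵐᵒᵖ] (preadditiveCoyonedaObj P).obj X') :
    ∃ f : X ⟶ X', ∀ h : P ⟶ X, homEquiv P X' (h ≫ f) = φ (homEquiv P X h) := by
  obtain ⟨n, M, π, q, δ, h, hπ, hM⟩ := exists_cover_triangle hP hX
  obtain ⟨L, l, ε, hT, hL⟩ : ∃ (L : D) (l : L ⟶ power P n) (ε : X ⟶ L⟦(1 : ℤ)⟧),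
      Triangle.mk l π ε ∈ distTriang D ∧ ∀ i > 0, HomZero P L i :=
    ⟨_, _, _, inv_rot_of_distTriang _ h, fun i hi =>
      (HomZero.shift_iff (-1) i (i - 1) (by omega)).2 (hM _ (by omega))⟩
  have hlπ : l ≫ π = 0 := comp_distTriang_mor_zero₁₂ _ hT
  let a : power P n ⟶ X' := biproduct.desc fun j =>
    (homEquiv P X').symm (φ (homEquiv P X (biproduct.ι (fun _ : Fin n => P) j ≫ π)))
  have ha (f : P ⟶ power P n) : homEquiv P X' (f ≫ a) = φ (homEquiv P X (f ≫ π)) := by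
    have hf := eq_sum_power f
    have h₁ := congr(homEquiv P X ($hf ≫ π))
    have h₂ := congr(homEquiv P X' ($hf ≫ a))
    rw [h₁, h₂]
    simp only [Preadditive.sum_comp, map_sum]
    refine Finset.sum_congr rfl fun j _ => ?_
    rw [Category.assoc (_ ≫ _), Category.assoc (_ ≫ _), ← smul_homEquiv, ← smul_homEquiv,
      map_smul, biproduct.ι_desc, AddEquiv.apply_symm_apply]
  have hinj (f : P ⟶ L) (hf : f ≫ l = 0) : f = 0 :=
    HomZero.injective_mor₁ hT hX₀ f hf
  have : Module.Finite (End P)ᵐᵒᵖ ((preadditiveCoyonedaObj P).obj L) := by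
    have : IsNoetherian (End P)ᵐᵒᵖ ((preadditiveCoyonedaObj P).obj (power P n)) := inferInstance
    exact Module.Finite.of_injective ((preadditiveCoyonedaObj P).map l).hom
      ((injective_iff_map_eq_zero _).2 hinj)
  obtain ⟨m, M', ρ, q', δ', h', hρ, hM'⟩ := exists_cover_triangle hP hL
  have hz : ρ ≫ l ≫ a = 0 := biproduct.hom_ext' _ _ fun j => by
    have h₀ : ((biproduct.ι (fun _ : Fin m => P) j ≫ ρ) ≫ l) ≫ π = 0 := by
      rw [Category.assoc, hlπ, comp_zero]
    have := ha ((biproduct.ι (fun _ : Fin m => P) j ≫ ρ) ≫ l)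
    rw [h₀, map_zero, map_zero, AddEquiv.map_eq_zero_iff] at this
    simpa only [Category.assoc, comp_zero] using this
  obtain ⟨g, hg⟩ := DistTriang.desc₂ h' (l ≫ a) hz
  rw [hX' M' hM' g, comp_zero] at hg
  obtain ⟨f, hf⟩ := DistTriang.desc₂ hT a hg.symm
  refine ⟨f, fun x => ?_⟩
  obtain ⟨y, rfl⟩ := hπ x
  rw [← ha y, ← hf, Category.assoc]

end FiniteCover

/-- A sequence that becomes short exact under `Hom(P, -)` is part of a distinguished triangle. -/
lemma exists_distTriang_of_exact {P : D} (hgen : ∀ W : D, (∀ i, HomZero P W i) → IsZero W)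
    {X₁ X₂ X₃ : D} (h₁ : ∀ i ≠ 0, HomZero P X₁ i) (h₂ : ∀ i ≠ 0, HomZero P X₂ i)
    (h₃ : ∀ i ≠ 0, HomZero P X₃ i) (f : X₁ ⟶ X₂) (g : X₂ ⟶ X₃) (w : f ≫ g = 0)
    (hf : ∀ x : P ⟶ X₁, x ≫ f = 0 → x = 0)
    (hfg : ∀ x : P ⟶ X₂, x ≫ g = 0 → ∃ y, y ≫ f = x)
    (hg : ∀ x : P ⟶ X₃, ∃ y, y ≫ g = x) :
    ∃ δ : X₃ ⟶ X₁⟦(1 : ℤ)⟧, Triangle.mk f g δ ∈ distTriang D := by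
  obtain ⟨K, a, δ, hK⟩ := distinguished_cocone_triangle₁ g
  obtain ⟨u, hu⟩ := DistTriang.lift₂ hK f w
  obtain ⟨W, q, ε, hW⟩ := distinguished_cocone_triangle u
  have hKz (i : ℤ) (hi : i ≠ 0) : HomZero P K i := by
    by_cases hi' : i = 1
    · subst hi'
      exact HomZero.obj₁_one hK hg (h₂ 1 (by simp))
    · exact HomZero.obj₁ (n := i - 1) hK (by omega) (h₂ i hi) (h₃ _ (by omega))
  have hWz (i : ℤ) : HomZero P W i := by
    by_cases hi : i = 0
    · subst hi
      refine HomZero.obj₃_zero hW (fun x => ?_) (h₁ 1 (by simp))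
      change P ⟶ K at x
      change ∃ g : P ⟶ X₁, g ≫ u = x
      obtain ⟨y, hy⟩ := hfg (x ≫ a) (by
        rw [Category.assoc, DistTriang.comp_zero₁ hK, comp_zero])
      refine ⟨y, ?_⟩
      rw [← sub_eq_zero]
      refine HomZero.injective_mor₁ hK (h₃ (-1) (by simp)) _ ?_
      change (y ≫ u - x) ≫ a = 0
      rw [Preadditive.sub_comp, Category.assoc, hu, hy, sub_self]
    · by_cases hi' : i = -1
      · subst hi'
        intro x
        obtain ⟨b, c, hb⟩ := DistTriang.exists_inv_rot hW
        refine HomZero.injective_mor₁ hb (hKz (-1) (by simp)) x (hf _ ?_)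
        change (x ≫ b) ≫ f = 0
        rw [← hu, Category.assoc, ← Category.assoc b, DistTriang.comp_zero₁ hb, zero_comp,
          comp_zero]
      · exact HomZero.obj₃ hW rfl (hKz i hi) (h₁ _ (by omega))
  have hu' : IsIso u := (Triangle.isZero₃_iff_isIso₁ _ hW).1 (hgen W hWz)
  refine ⟨δ ≫ (inv u)⟦(1 : ℤ)⟧', isomorphic_distinguished _ hK _ ?_⟩
  refine Triangle.isoMk _ _ (@asIso _ _ _ _ u hu') (Iso.refl _) (Iso.refl _) ?_ ?_ ?_
  · exact (Category.comp_id f).trans hu.symm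
  · exact (Category.comp_id g).trans (Category.id_comp g).symm
  · refine Eq.trans ?_ (Category.id_comp δ).symm
    change (δ ≫ (inv u)⟦(1 : ℤ)⟧') ≫ u⟦(1 : ℤ)⟧' = δ
    rw [Category.assoc, ← Functor.map_comp, IsIso.inv_hom_id, CategoryTheory.Functor.map_id, Category.comp_id]

end HomVanishing

section Silting

universe w' v w

variable {C : Type w} [Category.{v} C] [Abelian C] [HasDerivedCategory.{w'} C]

open DerivedCategory DerivedCategory.TStructure

/-- The stalk complex of an object in degree `0`. -/
noncomputable abbrev stalk : C ⥤ DerivedCategory C := singleFunctor C 0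

/-- The properties of a two-term silting complex, considered as an object of the derived category. -/
structure IsTwoTermSilting (P : DerivedCategory C) : Prop where
  isLE : P.IsLE 0
  hom_eq_zero : ∀ Y : DerivedCategory C, Y.IsLE (-2) → ∀ f : P ⟶ Y, f = 0
  homZero_one : HomZero P P 1
  isZero : ∀ W : DerivedCategory C, (∀ i, HomZero P W i) → IsZero W

lemma isLE_stalk_shift (X : C) (n : ℤ) : (((stalk).obj X)⟦n⟧).IsLE (-n) :=
  t.isLE_shift _ 0 n (-n) (by omega)

lemma isGE_stalk_shift (X : C) (n : ℤ) : (((stalk).obj X)⟦n⟧).IsGE (-n) :=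
  t.isGE_shift _ 0 n (-n) (by omega)

/-- The top cohomology of a bounded above object, as a triangle. -/
lemma exists_top_triangle (Y : DerivedCategory C) (n : ℤ) (hY : Y.IsLE (-n)) :
    ∃ (Z : DerivedCategory C) (N : C) (i : Z ⟶ Y) (q : Y ⟶ ((stalk).obj N)⟦n⟧)
      (δ : ((stalk).obj N)⟦n⟧ ⟶ Z⟦(1 : ℤ)⟧),
      Triangle.mk i q δ ∈ distTriang _ ∧ Z.IsLE (-n - 1) := by
  obtain ⟨Z, N, hZ, hN, i, q, δ, h⟩ := t.exists_triangle Y (-n - 1) (-n) (by omega)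
  have hN : N.IsGE (-n) := ⟨hN⟩
  have hZ : Z.IsLE (-n - 1) := ⟨hZ⟩
  have hN' : N.IsLE (-n) := by
    rw [isLE_iff]
    intro j hj
    have h' := (homologyFunctor C j).map_distinguished_exact _ (rot_of_distTriang _ h)
    refine h'.isZero_of_both_zeros ?_ ?_
    · exact (isZero_of_isLE Y (-n) j hj).eq_of_src _ _
    · refine (isZero_of_isLE (Z⟦(1 : ℤ)⟧) (-n - 2) j (by omega) (hX := ?_)).eq_of_tgt _ _
      exact t.isLE_shift _ (-n - 1) 1 (-n - 2) (by omega)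
  obtain ⟨N', ⟨e⟩⟩ := exists_iso_singleFunctor_obj_of_isGE_of_isLE N (-n)
  let e' : N ≅ ((stalk).obj N')⟦n⟧ :=
    e ≪≫ (((singleFunctors C).shiftIso n (-n) 0 (by omega)).app N').symm
  refine ⟨Z, N', i, q ≫ e'.hom, e'.inv ≫ δ, isomorphic_distinguished _ h _ ?_, hZ⟩
  refine Triangle.isoMk _ _ (Iso.refl _) (Iso.refl _) e'.symm ?_ ?_ ?_
  · exact (Category.comp_id i).trans (Category.id_comp i).symm
  · change (q ≫ e'.hom) ≫ e'.inv = 𝟙 _ ≫ q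
    simp
  · change (e'.inv ≫ δ) ≫ (shiftFunctor _ (1 : ℤ)).map (𝟙 _) = e'.inv ≫ δ
    simp

namespace IsTwoTermSilting

variable {P : DerivedCategory C} (hP : IsTwoTermSilting P)
include hP

lemma homZero_of_isLE {Y : DerivedCategory C} {n : ℤ} (hY : Y.IsLE n) {i : ℤ} (hi : n + 2 ≤ i) :
    HomZero P Y i :=
  hP.hom_eq_zero _ (by
    have := t.isLE_shift Y n i (n - i) (by omega)
    exact t.isLE_of_le (Y⟦i⟧) (n - i) (-2) (by omega))

lemma homZero_of_isGE {Y : DerivedCategory C} {n : ℤ} (hY : Y.IsGE n) {i : ℤ} (hi : i < n) :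
    HomZero P Y i := fun f => by
  have := t.isGE_shift Y n i (n - i) (by omega)
  have := hP.isLE
  exact t.zero f 0 (n - i) (by omega)

lemma homZero_self {i : ℤ} (hi : 0 < i) : HomZero P P i := by
  rcases (by omega : i = 1 ∨ 2 ≤ i) with rfl | hi
  · exact hP.homZero_one
  · exact hP.homZero_of_isLE hP.isLE (by omega)

lemma isLE_zero {Y : DerivedCategory C} (hY : ∀ i > 0, HomZero P Y i) : Y.IsLE 0 := by
  obtain ⟨Z, N, hZ, hN, i, q, δ, h⟩ := t.exists_triangle Y 0 1 (by omega)
  have hN : N.IsGE 1 := ⟨hN⟩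
  have hZ : Z.IsLE 0 := ⟨hZ⟩
  have hN0 : IsZero N := hP.isZero N fun j => by
    by_cases hj : 0 < j
    · exact HomZero.obj₃ h rfl (hY j hj) (hP.homZero_of_isLE hZ (by omega))
    · exact hP.homZero_of_isGE hN (by omega)
  have : IsIso i := (Triangle.isZero₃_iff_isIso₁ _ h).1 hN0
  exact t.isLE_of_iso (asIso i) 0

lemma isLE_neg_one {Y : DerivedCategory C} (hY : ∀ i ≥ 0, HomZero P Y i) : Y.IsLE (-1) := by
  have := hP.isLE_zero (Y := Y⟦(-1 : ℤ)⟧) fun i hi =>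
    (HomZero.shift_iff (-1) i (i - 1) (by omega)).2 (hY _ (by omega))
  exact t.isLE_of_shift Y (-1) (-1) 0 (by omega)

lemma homZero_stalk {X : C} {i : ℤ} (h₀ : i ≠ 0) (h₁ : i ≠ 1) :
    HomZero P ((stalk).obj X) i := by
  by_cases hi : i < 0
  · exact hP.homZero_of_isGE (n := 0) inferInstance hi
  · exact hP.homZero_of_isLE (n := 0) inferInstance (by omega)

/-- There are no maps from a torsion object to a torsion-free one. -/
lemma hom_eq_zero_of_torsion {N V : C} (hN : HomZero P ((stalk).obj N) 1)
    (hV : HomZero P ((stalk).obj V) 0) (f : N ⟶ V) : f = 0 := by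
  have h₁ : (ShortComplex.mk (kernel.ι f) (factorThruImage f) (by
      rw [← cancel_mono (image.ι f)]; simp)).ShortExact :=
    { exact := by
        refine ShortComplex.exact_of_f_is_kernel _ (KernelFork.IsLimit.ofι _ _
          (fun g hg => kernel.lift f g ?_) ?_ ?_)
        · rw [← image.fac f, ← Category.assoc, hg, zero_comp]
        · intro _ g hg
          simp
        · intro _ g hg m hm
          rw [← cancel_mono (kernel.ι f)]
          simpa using hm
      epi_g := by dsimp; infer_instance
      mono_f := by dsimp; infer_instance }
  have h₂ : (ShortComplex.mk (image.ι f) (cokernel.π (image.ι f)) (by simp)).ShortExact :=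
    { exact := ShortComplex.exact_cokernel _
      epi_g := by dsimp; infer_instance
      mono_f := by dsimp; infer_instance }
  have hI : IsZero ((stalk).obj (image f)) := hP.isZero _ fun i => by
    by_cases hi : i = 1
    · subst hi
      exact HomZero.obj₃ h₁.singleTriangle_distinguished rfl hN
        (hP.homZero_stalk (by omega) (by omega))
    · by_cases hi' : i = 0
      · subst hi'
        exact HomZero.obj₁ h₂.singleTriangle_distinguished (n := -1) (by omega) hV
          (hP.homZero_stalk (by omega) (by omega))
      · exact hP.homZero_stalk hi' hi
  have hI' : IsZero (image f) :=
    ((homologyFunctor C 0).map_isZero hI).of_iso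
      ((singleFunctorCompHomologyFunctorIso C 0).app _).symm
  rw [← image.fac f, hI'.eq_of_tgt (factorThruImage f) 0, zero_comp]

lemma hom_stalk_eq_zero {Y : DerivedCategory C} (hY : ∀ i ≥ 0, HomZero P Y i) (U : C)
    (f : Y ⟶ (stalk).obj U) : f = 0 := by
  have := hP.isLE_neg_one hY
  exact t.zero f (-1) 0 (by omega)

lemma hom_stalk_shift_eq_zero {Y : DerivedCategory C} (hY : ∀ i ≥ 0, HomZero P Y i) {V : C}
    (hV : HomZero P ((stalk).obj V) 0) (f : Y ⟶ ((stalk).obj V)⟦(1 : ℤ)⟧) : f = 0 := by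
  have := hP.isLE_neg_one hY
  obtain ⟨Z, N, i, q, δ, h, hZ⟩ := exists_top_triangle Y 1 this
  have hZ' : Z.IsLE (-2) := hZ
  have hV' := isGE_stalk_shift V 1
  obtain ⟨g, rfl⟩ := DistTriang.desc₂ h f (t.zero _ (-2) (-1) (by omega))
  obtain ⟨g, rfl⟩ := (shiftFunctor (DerivedCategory C) (1 : ℤ)).map_surjective g
  obtain ⟨g, rfl⟩ := (stalk (C := C)).map_surjective g
  have hN : HomZero P ((stalk).obj N) 1 := by
    have := HomZero.obj₃ h (i := 0) rfl (hY 0 le_rfl) (hP.homZero_of_isLE hZ' (by omega))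
    exact (HomZero.shift_iff 1 0 1 (by omega)).1 this
  rw [hP.hom_eq_zero_of_torsion hN hV g, Functor.map_zero, Functor.map_zero, comp_zero]

end IsTwoTermSilting

end Silting

section Truncation

universe w' v w

variable {C : Type w} [Category.{v} C] [Abelian C] [HasDerivedCategory.{w'} C]

open DerivedCategory DerivedCategory.TStructure

section HomologyExact

variable {X Y Z : DerivedCategory C} {f : X ⟶ Y} {g : Y ⟶ Z} {δ : Z ⟶ X⟦(1 : ℤ)⟧}

lemma homology_exact (h : Triangle.mk f g δ ∈ distTriang _) (n : ℤ) :
    ∃ w, (ShortComplex.mk ((homologyFunctor C n).map f) ((homologyFunctor C n).map g) w).Exact :=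
  ⟨_, (homologyFunctor C n).map_distinguished_exact _ h⟩

lemma isZero_homology_shift (X : DerivedCategory C) (a n m : ℤ) (h : a + n = m)
    (hX : IsZero ((homologyFunctor C m).obj X)) :
    IsZero ((homologyFunctor C n).obj (X⟦a⟧)) :=
  hX.of_iso (((homologyFunctor C 0).shiftIso a n m (by omega)).app X)

lemma homology_epi (h : Triangle.mk f g δ ∈ distTriang _) (n : ℤ)
    (hX : IsZero ((homologyFunctor C (n + 1)).obj X)) : Epi ((homologyFunctor C n).map g) := by
  obtain ⟨w, hw⟩ := homology_exact (rot_of_distTriang _ h) n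
  exact hw.epi_f ((isZero_homology_shift X 1 n (n + 1) (by omega) hX).eq_of_tgt _ _)

lemma homology_mono (h : Triangle.mk f g δ ∈ distTriang _) (n : ℤ)
    (hZ : IsZero ((homologyFunctor C (n - 1)).obj Z)) : Mono ((homologyFunctor C n).map f) := by
  obtain ⟨w, hw⟩ := homology_exact (inv_rot_of_distTriang _ h) n
  exact hw.mono_g ((isZero_homology_shift Z (-1) n (n - 1) (by omega) hZ).eq_of_src _ _)

end HomologyExact

/-- The cohomology of a shifted stalk complex. -/
noncomputable def homologyStalkShift (n : ℤ) :
    stalk (C := C) ⋙ shiftFunctor (DerivedCategory C) n ⋙ homologyFunctor C (-n) ≅ 𝟭 C :=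
  (Functor.associator _ _ _).symm ≪≫
    Functor.isoWhiskerRight ((singleFunctors C).shiftIso n (-n) 0 (by omega)) _ ≪≫
    singleFunctorCompHomologyFunctorIso C (-n)

namespace HomZero

variable {D : Type w} [Category.{v} D] [Preadditive D] [HasZeroObject D] [HasShift D ℤ]
  [∀ n : ℤ, (shiftFunctor D n).Additive] [Pretriangulated D]

lemma shift_source {P Y : D} {n a i : ℤ} (h : HomZero P Y n) (hi : a + n = i)
    (f : P⟦a⟧ ⟶ Y⟦i⟧) : f = 0 := by
  apply (shiftFunctor D (-a)).map_injective
  rw [Functor.map_zero]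
  have h' := (shift_iff i (-a) n (by omega)).2 h
  have := h' (((shiftFunctorCompIsoId D a (-a) (by omega)).inv.app P) ≫ f⟦-a⟧')
  simpa using congr((shiftFunctorCompIsoId D a (-a) (by omega)).hom.app P ≫ $this)

end HomZero

namespace IsTwoTermSilting

variable {P : DerivedCategory C} (hP : IsTwoTermSilting P)
include hP

lemma exists_truncation {X : DerivedCategory C} (hX : ∀ i > 0, HomZero P X i) :
    ∃ (X' Z : DerivedCategory C) (U W : C) (i : X' ⟶ X) (q : X ⟶ (stalk.obj U)⟦(0 : ℤ)⟧)
      (δ : (stalk.obj U)⟦(0 : ℤ)⟧ ⟶ X'⟦(1 : ℤ)⟧) (i' : Z ⟶ X')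
      (q' : X' ⟶ (stalk.obj W)⟦(1 : ℤ)⟧) (δ' : (stalk.obj W)⟦(1 : ℤ)⟧ ⟶ Z⟦(1 : ℤ)⟧),
      Triangle.mk i q δ ∈ distTriang _ ∧ Triangle.mk i' q' δ' ∈ distTriang _ ∧
      X'.IsLE (-1) ∧ Z.IsLE (-2) ∧ HomZero P (stalk.obj U) 1 ∧
      (∃ p : (homologyFunctor C 0).obj X ⟶ U, Epi p) ∧
      ∃ (K : C) (m : K ⟶ (homologyFunctor C (-1)).obj X) (p : K ⟶ W), Mono m ∧ Epi p := by
  have hX₀ := hP.isLE_zero hX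
  obtain ⟨X', U, i, q, δ, h, hX'⟩ := exists_top_triangle X 0 (by simpa using hX₀)
  have hX' : X'.IsLE (-1) := by simpa using hX'
  obtain ⟨Z, W, i', q', δ', h', hZ⟩ := exists_top_triangle X' 1 hX'
  have hZ : Z.IsLE (-2) := hZ
  refine ⟨X', Z, U, W, i, q, δ, i', q', δ', h, h', hX', hZ, ?_, ?_, ?_⟩
  · exact (HomZero.shift_iff 0 1 1 (by simp)).1
      (HomZero.obj₃ h rfl (hX 1 (by simp)) (hP.homZero_of_isLE hX' (by simp)))
  · have := homology_epi h 0 (isZero_of_isLE X' (-1) _ (by simp))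
    exact ⟨(homologyFunctor C 0).map q ≫ ((homologyStalkShift 0).app U).hom, epi_comp _ _⟩
  · have h₁ := homology_epi h' (-1) (isZero_of_isLE Z (-2) _ (by simp))
    have := isGE_stalk_shift U 0
    have h₂ := homology_mono h (-1) (isZero_of_isGE ((stalk.obj U)⟦(0 : ℤ)⟧) (-0) _ (by simp))
    exact ⟨_, _, (homologyFunctor C (-1)).map q' ≫ ((homologyStalkShift 1).app W).hom, h₂,
      epi_comp _ _⟩

lemma exists_bijective {X X' Z : DerivedCategory C} {U W : C} {i : X' ⟶ X}
    {q : X ⟶ (stalk.obj U)⟦(0 : ℤ)⟧} {δ : (stalk.obj U)⟦(0 : ℤ)⟧ ⟶ X'⟦(1 : ℤ)⟧} {i' : Z ⟶ X'}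
    {q' : X' ⟶ (stalk.obj W)⟦(1 : ℤ)⟧} {δ' : (stalk.obj W)⟦(1 : ℤ)⟧ ⟶ Z⟦(1 : ℤ)⟧}
    (h : Triangle.mk i q δ ∈ distTriang _) (h' : Triangle.mk i' q' δ' ∈ distTriang _)
    (hX' : X'.IsLE (-1)) (hZ : Z.IsLE (-2)) {T F : C} (p : W ⟶ T) (j : T ⟶ W)
    (r : W ⟶ F) (l : F ⟶ W) (hT : HomZero P (stalk.obj T) 1)
    (hl : l ≫ r = 𝟙 F) (hs : p ≫ j + r ≫ l = 𝟙 W)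
    (hUF : HomZero (stalk.obj U) (stalk.obj F) 2) :
    ∃ g : X ⟶ (stalk.obj U)⟦(0 : ℤ)⟧ ⊞ (stalk.obj F)⟦(1 : ℤ)⟧,
      Function.Bijective fun x : P ⟶ X => x ≫ g := by
  let Φ := stalk (C := C) ⋙ shiftFunctor (DerivedCategory C) (1 : ℤ)
  obtain ⟨a, b, hab⟩ := DistTriang.exists_inv_rot h
  obtain ⟨e, he⟩ : ∃ e : X ⟶ (stalk.obj F)⟦(1 : ℤ)⟧, i ≫ e = q' ≫ Φ.map r :=
      DistTriang.desc₂ hab (q' ≫ Φ.map r) (by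
    rw [← cancel_epi ((shiftFunctorAdd' (DerivedCategory C) 0 (-1) (-1) (by simp)).hom.app
      (stalk.obj U)), comp_zero]
    exact HomZero.shift_source hUF (by simp) _)
  have hΦ (u : P ⟶ Φ.obj W) (h₁ : u ≫ Φ.map p = 0) (h₂ : u ≫ Φ.map r = 0) : u = 0 := by
    have h₃ : u ≫ Φ.map (p ≫ j + r ≫ l) = u := by rw [hs]; simp
    rw [Functor.map_add, Functor.map_comp, Functor.map_comp, Preadditive.comp_add,
      ← Category.assoc, h₁, ← Category.assoc, h₂, zero_comp, zero_comp, add_zero] at h₃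
    exact h₃.symm
  have hΦl (u : P ⟶ Φ.obj F) : (u ≫ Φ.map l) ≫ Φ.map r = u := by
    rw [Category.assoc, ← Functor.map_comp, hl, CategoryTheory.Functor.map_id, Category.comp_id]
  refine ⟨biprod.lift q e, ?_, fun y => ?_⟩
  · refine (injective_iff_map_eq_zero (Preadditive.rightComp P (biprod.lift q e))).2 fun x hx => ?_
    have hx : x ≫ biprod.lift q e = 0 := hx
    have hxq : x ≫ q = 0 := by simpa using congr($hx ≫ biprod.fst)
    have hxe : x ≫ e = 0 := by simpa using congr($hx ≫ biprod.snd)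
    obtain ⟨y, rfl⟩ := DistTriang.lift₂ h x hxq
    rw [Category.assoc, he] at hxe
    have hpy : (y ≫ q') ≫ Φ.map p = 0 :=
      (HomZero.zero_iff.1 ((HomZero.shift_iff 1 0 1 (by simp)).2 hT)) _
    have hy : y ≫ q' = 0 := hΦ (y ≫ q') hpy ((Category.assoc _ _ _).trans hxe)
    obtain ⟨z, rfl⟩ := DistTriang.lift₂ h' y hy
    rw [hP.hom_eq_zero Z hZ z, zero_comp, zero_comp]
  · obtain ⟨x, hx⟩ := DistTriang.lift₃ h (y ≫ biprod.fst)
      (hP.homZero_of_isLE hX' (i := 1) (by simp) _)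
    obtain ⟨z, hz⟩ := DistTriang.lift₃ h' ((y ≫ biprod.snd - x ≫ e) ≫ Φ.map l)
      (hP.homZero_of_isLE hZ (i := 1) (by simp) _)
    refine ⟨x + z ≫ i, ?_⟩
    change (x + z ≫ i) ≫ biprod.lift q e = y
    apply biprod.hom_ext
    · rw [Category.assoc, biprod.lift_fst, Preadditive.add_comp, hx, Category.assoc,
        DistTriang.comp_zero₁ h, comp_zero, add_zero]
    · rw [Category.assoc, biprod.lift_snd, Preadditive.add_comp, Category.assoc, he,
        ← Category.assoc z, hz]
      refine Eq.trans (congrArg _ (hΦl (y ≫ biprod.snd - x ≫ e))) ?_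
      abel

end IsTwoTermSilting

end Truncation

section Presentation

universe v w

lemma nonempty_linearEquiv_of_ker_eq {R M N L : Type*} [Ring R] [AddCommGroup M] [AddCommGroup N]
    [AddCommGroup L] [Module R M] [Module R N] [Module R L] (f : M →ₗ[R] N) (g : M →ₗ[R] L)
    (hf : Function.Surjective f) (hg : Function.Surjective g)
    (h : LinearMap.ker f = LinearMap.ker g) : Nonempty (N ≃ₗ[R] L) :=
  ⟨(f.quotKerEquivOfSurjective hf).symm ≪≫ₗ Submodule.quotEquivOfEq _ _ h ≪≫ₗ
    g.quotKerEquivOfSurjective hg⟩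

set_option linter.unusedSectionVars false

variable {D : Type w} [Category.{v} D] [Preadditive D] [HasZeroObject D] [HasShift D ℤ]
  [∀ n : ℤ, (shiftFunctor D n).Additive] [Pretriangulated D] [HasFiniteBiproducts D] {P : D}

lemma exists_power_hom (N : Type v) [AddCommGroup N] [Module (End P)ᵐᵒᵖ N] {n : ℕ}
    (x : Fin n → N) :
    ∃ ψ : (preadditiveCoyonedaObj P).obj (power P n) →ₗ[(End P)ᵐᵒᵖ] N,
      ∀ f, ψ (homEquiv P _ f) =
        ∑ j, (MulOpposite.op (f ≫ biproduct.π (fun _ : Fin n => P) j : End P) : (End P)ᵐᵒᵖ) • x j := by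
  refine ⟨{ toFun := fun f => ∑ j, (MulOpposite.op
              ((homEquiv P _).symm f ≫ biproduct.π (fun _ : Fin n => P) j : End P) : (End P)ᵐᵒᵖ) • x j
            map_add' := fun f g => ?_
            map_smul' := fun c f => ?_ }, fun f => rfl⟩
  · rw [← Finset.sum_add_distrib]
    refine Finset.sum_congr rfl fun j _ => ?_
    rw [map_add, Preadditive.add_comp, MulOpposite.op_add, add_smul]
  · rw [Finset.smul_sum]
    refine Finset.sum_congr rfl fun j _ => ?_
    obtain ⟨f, rfl⟩ := (homEquiv P _).surjective f
    have : c • homEquiv P _ f = homEquiv P _ ((c.unop : P ⟶ P) ≫ f) := rfl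
    rw [this, RingHom.id_apply, smul_smul, AddEquiv.symm_apply_apply, AddEquiv.symm_apply_apply,
      Category.assoc]
    rfl

lemma map_power_desc {Y : D} {n : ℕ} (y : Fin n → (P ⟶ Y)) (f : P ⟶ power P n) :
    homEquiv P Y (f ≫ biproduct.desc y) =
      ∑ j, (MulOpposite.op (f ≫ biproduct.π (fun _ : Fin n => P) j : End P) : (End P)ᵐᵒᵖ) •
        homEquiv P Y (y j) := by
  have h := congr(homEquiv P Y ($(eq_sum_power f) ≫ biproduct.desc y))
  rw [h, Preadditive.sum_comp, map_sum]
  refine Finset.sum_congr rfl fun j _ => ?_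
  rw [smul_homEquiv, Category.assoc (f ≫ _), biproduct.ι_desc]

lemma exists_power_presentation [IsNoetherianRing (End P)ᵐᵒᵖ] (N : Type v) [AddCommGroup N]
    [Module (End P)ᵐᵒᵖ N] [Module.Finite (End P)ᵐᵒᵖ N] :
    ∃ (m n : ℕ) (φ : power P m ⟶ power P n)
      (ψ : (preadditiveCoyonedaObj P).obj (power P n) →ₗ[(End P)ᵐᵒᵖ] N),
      Function.Surjective ψ ∧ ∀ x : P ⟶ power P n, ψ (homEquiv P _ x) = 0 ↔ ∃ y, y ≫ φ = x := by
  obtain ⟨n, x, hx⟩ := Module.Finite.exists_fin (R := (End P)ᵐᵒᵖ) (M := N)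
  obtain ⟨ψ, hψ⟩ := exists_power_hom (P := P) N x
  have hfin : IsNoetherian (End P)ᵐᵒᵖ ((preadditiveCoyonedaObj P).obj (power P n)) := inferInstance
  obtain ⟨m, y, hy⟩ := Submodule.fg_iff_exists_fin_generating_family.1
    (hfin.noetherian (LinearMap.ker ψ))
  refine ⟨m, n, biproduct.desc fun i => (homEquiv P _).symm (y i), ψ, fun z => ?_, fun z => ?_⟩
  · have hz : z ∈ Submodule.span (End P)ᵐᵒᵖ (Set.range x) := hx ▸ Submodule.mem_top
    obtain ⟨c, rfl⟩ := (Submodule.mem_span_range_iff_exists_fun _).1 hz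
    refine ⟨homEquiv P _ (biproduct.lift fun i => ((c i).unop : P ⟶ P)), ?_⟩
    rw [hψ]
    refine Finset.sum_congr rfl fun j _ => ?_
    rw [biproduct.lift_π]
    rfl
  · rw [← LinearMap.mem_ker, ← hy, Submodule.mem_span_range_iff_exists_fun]
    constructor
    · rintro ⟨c, hc⟩
      refine ⟨biproduct.lift fun i => ((c i).unop : P ⟶ P), (homEquiv P _).injective ?_⟩
      rw [map_power_desc, ← hc]
      refine Finset.sum_congr rfl fun j _ => ?_
      rw [biproduct.lift_π, AddEquiv.apply_symm_apply]
      rfl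
    · rintro ⟨u, rfl⟩
      refine ⟨fun j => MulOpposite.op (u ≫ biproduct.π (fun _ : Fin m => P) j : End P), ?_⟩
      rw [map_power_desc]
      refine Finset.sum_congr rfl fun j _ => ?_
      rw [AddEquiv.apply_symm_apply]

lemma exists_cone_presentation [IsNoetherianRing (End P)ᵐᵒᵖ] (hP : ∀ i > 0, HomZero P P i)
    (N : Type v) [AddCommGroup N] [Module (End P)ᵐᵒᵖ N] [Module.Finite (End P)ᵐᵒᵖ N] :
    ∃ (m n : ℕ) (X : D) (φ : power P m ⟶ power P n) (ρ : power P n ⟶ X)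
      (δ : X ⟶ (power P m)⟦(1 : ℤ)⟧), Triangle.mk φ ρ δ ∈ distTriang D ∧
      (∀ i > 0, HomZero P X i) ∧
      Nonempty ((preadditiveCoyonedaObj P).obj X ≃ₗ[(End P)ᵐᵒᵖ] N) := by
  obtain ⟨m, n, φ, ψ, hψ, hψ'⟩ := exists_power_presentation (P := P) N
  obtain ⟨X, ρ, δ, h⟩ := distinguished_cocone_triangle φ
  refine ⟨m, n, X, φ, ρ, δ, h, fun i hi => ?_, ?_⟩
  · exact HomZero.obj₃ h rfl (homZero_power (hP i hi) n) (homZero_power (hP _ (by omega)) m)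
  · refine nonempty_linearEquiv_of_ker_eq ((preadditiveCoyonedaObj P).map ρ).hom ψ
      (fun x => ?_) hψ ?_
    · obtain ⟨x, rfl⟩ := (homEquiv P X).surjective x
      obtain ⟨y, rfl⟩ := DistTriang.lift₃ h x (homZero_power (hP 1 (by simp)) m _)
      exact ⟨homEquiv P _ y, rfl⟩
    · ext x
      obtain ⟨x, rfl⟩ := (homEquiv P _).surjective x
      rw [LinearMap.mem_ker, LinearMap.mem_ker, hψ']
      constructor
      · exact fun hx => DistTriang.lift₂ h x hx
      · rintro ⟨y, rfl⟩
        change homEquiv P X ((y ≫ φ) ≫ ρ) = 0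
        rw [Category.assoc, DistTriang.comp_zero₁ h, comp_zero, map_zero]

end Presentation

end Paper

end

section

open CategoryTheory Limits Pretriangulated
open scoped ZeroObject

namespace Paper

section Heart

open DerivedCategory DerivedCategory.TStructure

section FiniteHomology

variable {A : Type u} [Ring A] {D : Type*} [Category* D] [Preadditive D]

lemma finite_map_power [HasFiniteBiproducts D] (Φ : D ⥤ ModuleCat.{u} A) [Φ.Additive] (P : D)
    [Module.Finite A (Φ.obj P)] (n : ℕ) : Module.Finite A (Φ.obj (power P n)) := by
  refine Module.Finite.of_surjective
    (LinearMap.lsum A (fun _ : Fin n => Φ.obj P) ℕ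
      fun j => (Φ.map (biproduct.ι (fun _ : Fin n => P) j)).hom)
    fun x => ⟨fun j => (Φ.map (biproduct.π (fun _ : Fin n => P) j)).hom x, ?_⟩
  have h : Φ.map (𝟙 (power P n)) = 𝟙 _ := Φ.map_id _
  rw [← biproduct.total, Functor.map_sum] at h
  have := congr(ModuleCat.Hom.hom $h x)
  rw [ModuleCat.hom_sum] at this
  simpa using this

lemma finite_of_exact [IsNoetherianRing A] {S : ShortComplex (ModuleCat.{u} A)} (h : S.Exact)
    (h₁ : Module.Finite A S.X₁) (h₃ : Module.Finite A S.X₃) : Module.Finite A S.X₂ := by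
  have : IsNoetherian A S.X₂ :=
    isNoetherian_of_range_eq_ker S.f.hom S.g.hom h.moduleCat_range_eq_ker
  infer_instance

end FiniteHomology

variable {A : Type u} [Ring A] [IsNoetherianRing A] [HasDerivedCategory.{u} (ModuleCat.{u} A)]

/-- The stalk complex in degree `0` of a finitely generated module. -/
noncomputable abbrev fgStalk : FGModuleCat.{u} A ⥤ DerivedCategory (ModuleCat.{u} A) :=
  forget₂ (FGModuleCat.{u} A) (ModuleCat.{u} A) ⋙ stalk

/-- A two-term silting complex whose torsion pair splits and such that the torsion-free modules
satisfy the relevant injectivity condition, over a suitably finite ring. -/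
structure IsSeparatingSilting (P : DerivedCategory (ModuleCat.{u} A)) : Prop
    extends IsTwoTermSilting P where
  noetherian : IsNoetherianRing (End P)ᵐᵒᵖ
  finite_hom : ∀ (U : FGModuleCat.{u} A) (i : ℤ),
    Module.Finite (End P)ᵐᵒᵖ ((preadditiveCoyonedaObj P).obj ((fgStalk.obj U)⟦i⟧))
  finite_homology : ∀ j : ℤ, Module.Finite A ((homologyFunctor (ModuleCat.{u} A) j).obj P)
  split : SplitTorsion (fun U : FGModuleCat.{u} A => HomZero P (fgStalk.obj U) 1)
    (fun V : FGModuleCat.{u} A => HomZero P (fgStalk.obj V) 0)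
  ext_two : ∀ U V : FGModuleCat.{u} A, HomZero P (fgStalk.obj V) 0 →
    HomZero (fgStalk.obj U) (fgStalk.obj V) 2

variable (P : DerivedCategory (ModuleCat.{u} A))

/-- The direct sums of a torsion module in degree `0` and a torsion-free module in degree `-1`. -/
def heart : ObjectProperty (DerivedCategory (ModuleCat.{u} A)) := fun X =>
  ∃ U V : FGModuleCat.{u} A, HomZero P (fgStalk.obj U) 1 ∧ HomZero P (fgStalk.obj V) 0 ∧
    Nonempty (X ≅ fgStalk.obj U ⊞ (fgStalk.obj V)⟦(1 : ℤ)⟧)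

variable {P}

lemma HomZero.biprod {D : Type*} [Category* D] [Preadditive D] [HasZeroObject D] [HasShift D ℤ]
    [∀ n : ℤ, (shiftFunctor D n).Additive] [Pretriangulated D] [HasBinaryBiproducts D]
    {P Y Z : D} {i : ℤ} (hY : HomZero P Y i)
    (hZ : HomZero P Z i) : HomZero P (Y ⊞ Z) i := by
  intro f
  have h : f ≫ (𝟙 (Y ⊞ Z))⟦i⟧' = f := by simp
  rw [← CategoryTheory.Limits.biprod.total, Functor.map_add, Functor.map_comp, Functor.map_comp,
    Preadditive.comp_add, ← Category.assoc, ← Category.assoc, hY (f ≫ _),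
    hZ (f ≫ _), zero_comp, zero_comp, add_zero] at h
  exact h.symm

lemma heart_torsion {U : FGModuleCat.{u} A} (hU : HomZero P (fgStalk.obj U) 1) :
    heart P (fgStalk.obj U) := by
  obtain ⟨V, hV, hV'⟩ : ∃ V : FGModuleCat.{u} A, IsZero V ∧ HomZero P (fgStalk.obj V) 0 :=
    ⟨0, isZero_zero _, fun _ => ((shiftFunctor _ (0 : ℤ)).map_isZero
      (fgStalk.map_isZero (isZero_zero _))).eq_of_tgt _ _⟩
  exact ⟨U, V, hU, hV', ⟨isoBiprodZero
    ((shiftFunctor _ (1 : ℤ)).map_isZero (fgStalk.map_isZero hV))⟩⟩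

lemma heart_torsionFree {V : FGModuleCat.{u} A} (hV : HomZero P (fgStalk.obj V) 0) :
    heart P ((fgStalk.obj V)⟦(1 : ℤ)⟧) :=
  ⟨0, V, fun _ => ((shiftFunctor _ (1 : ℤ)).map_isZero
      (fgStalk.map_isZero (isZero_zero _))).eq_of_tgt _ _, hV,
    ⟨isoZeroBiprod (fgStalk.map_isZero (isZero_zero _))⟩⟩

namespace IsSeparatingSilting

variable (hP : IsSeparatingSilting P)
include hP

lemma homZero_torsion {U : FGModuleCat.{u} A} (hU : HomZero P (fgStalk.obj U) 1) {i : ℤ}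
    (hi : i ≠ 0) : HomZero P (fgStalk.obj U) i := by
  by_cases h : i = 1
  · exact h ▸ hU
  · exact hP.homZero_stalk hi h

lemma homZero_torsionFree {V : FGModuleCat.{u} A} (hV : HomZero P (fgStalk.obj V) 0) {i : ℤ}
    (hi : i ≠ 0) : HomZero P ((fgStalk.obj V)⟦(1 : ℤ)⟧) i := by
  rw [HomZero.shift_iff 1 i (1 + i) rfl]
  by_cases h : 1 + i = 0
  · exact h ▸ hV
  · exact hP.homZero_stalk h (by omega)

lemma homZero_heart {X : DerivedCategory (ModuleCat.{u} A)} (hX : heart P X) {i : ℤ}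
    (hi : i ≠ 0) : HomZero P X i := by
  obtain ⟨U, V, hU, hV, ⟨e⟩⟩ := hX
  exact (HomZero.biprod (hP.homZero_torsion hU hi) (hP.homZero_torsionFree hV hi)).of_iso e

lemma hom_heart_eq_zero {X : DerivedCategory (ModuleCat.{u} A)} (hX : heart P X)
    (Y : DerivedCategory (ModuleCat.{u} A)) (hY : ∀ i ≥ 0, HomZero P Y i) (f : Y ⟶ X) : f = 0 := by
  obtain ⟨U, V, hU, hV, ⟨e⟩⟩ := hX
  rw [← cancel_mono e.hom, zero_comp]
  refine biprod.hom_ext _ _ ?_ ?_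
  · rw [zero_comp]
    exact hP.hom_stalk_eq_zero hY _ _
  · rw [zero_comp]
    exact hP.hom_stalk_shift_eq_zero hY hV _

lemma finite_heart {X : DerivedCategory (ModuleCat.{u} A)} (hX : heart P X) :
    Module.Finite (End P)ᵐᵒᵖ ((preadditiveCoyonedaObj P).obj X) := by
  obtain ⟨U, V, hU, hV, ⟨e⟩⟩ := hX
  have h₁ := hP.finite_hom U 0
  have h₂ := hP.finite_hom V 1
  let a : fgStalk.obj U ⟶ X := biprod.inl ≫ e.inv
  let b : (fgStalk.obj V)⟦(1 : ℤ)⟧ ⟶ X := biprod.inr ≫ e.inv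
  refine Module.Finite.of_surjective
    (((preadditiveCoyonedaObj P).map ((shiftFunctorZero _ ℤ).hom.app (fgStalk.obj U) ≫ a)).hom.coprod
      ((preadditiveCoyonedaObj P).map b).hom) fun x => ?_
  obtain ⟨x, rfl⟩ := (homEquiv P X).surjective x
  refine ⟨(homEquiv P _ ((x ≫ e.hom ≫ biprod.fst) ≫ (shiftFunctorZero _ ℤ).inv.app _),
    homEquiv P _ (x ≫ e.hom ≫ biprod.snd)), ?_⟩
  rw [LinearMap.coprod_apply, map_homEquiv, map_homEquiv, ← map_add]
  congr 1
  have := congr(x ≫ e.hom ≫ $(biprod.total (X := fgStalk.obj U)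
    (Y := (fgStalk.obj V)⟦(1 : ℤ)⟧)) ≫ e.inv)
  simp only [Preadditive.add_comp, Preadditive.comp_add, Category.assoc, Category.id_comp,
    e.hom_inv_id, Category.comp_id] at this
  simpa [a, b, -biprod.total] using this

/-- Every finitely generated module is the module of morphisms to an object of the heart. -/
lemma exists_heart (N : Type u) [AddCommGroup N] [Module (End P)ᵐᵒᵖ N]
    [Module.Finite (End P)ᵐᵒᵖ N] :
    ∃ X, heart P X ∧ Nonempty ((preadditiveCoyonedaObj P).obj X ≃ₗ[(End P)ᵐᵒᵖ] N) := by
  have := hP.noetherian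
  obtain ⟨m, n, X, φ, ρ, δ, h, hX, ⟨e⟩⟩ :=
    exists_cone_presentation (P := P) (fun i hi => hP.homZero_self hi) N
  have hfin (j : ℤ) : Module.Finite A ((homologyFunctor (ModuleCat.{u} A) j).obj X) := by
    have h₁ := hP.finite_homology j
    have h₂ := hP.finite_homology (1 + j)
    have h₃ := finite_map_power (homologyFunctor (ModuleCat.{u} A) j) P n
    have h₄ := finite_map_power (homologyFunctor (ModuleCat.{u} A) (1 + j)) P m
    obtain ⟨w, hw⟩ := homology_exact (rot_of_distTriang _ h) j
    have h₅ : Module.Finite A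
        (((homologyFunctor (ModuleCat.{u} A) 0).shift (1 + j)).obj (power P m)) := h₄
    exact finite_of_exact hw h₃ (Module.Finite.equiv
      (((homologyFunctor (ModuleCat.{u} A) 0).shiftIso 1 j (1 + j) rfl).app
        (power P m)).symm.toLinearEquiv)
  obtain ⟨X', Z, U, W, i, q, δ, i', q', δ', h, h', hX', hZ, hU, ⟨p, hp⟩, K, k, p', hk, hp'⟩ :=
    hP.exists_truncation hX
  have hUf : Module.Finite A U :=
    have := hfin 0
    Module.Finite.of_surjective p.hom ((ModuleCat.epi_iff_surjective p).1 hp)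
  have hWf : Module.Finite A W := by
    have := hfin (-1)
    have := Module.Finite.of_injective k.hom ((ModuleCat.mono_iff_injective k).1 hk)
    exact Module.Finite.of_surjective p'.hom ((ModuleCat.epi_iff_surjective p').1 hp')
  obtain ⟨T, F, a, b, c, d, hT, hF, hab, hcd, habcd⟩ := hP.split.exists_decomp (FGModuleCat.of A W)
  let ι := forget₂ (FGModuleCat.{u} A) (ModuleCat.{u} A)
  obtain ⟨g, hg⟩ := hP.exists_bijective h h' hX' hZ (ι.map a) (ι.map b) (ι.map c) (ι.map d) hT
    congr(ι.map $hcd) congr(ι.map $habcd) (hP.ext_two (FGModuleCat.of A U) F hF)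
  refine ⟨_, ⟨FGModuleCat.of A U, F, hU, hF,
    ⟨biprod.mapIso ((shiftFunctorZero _ ℤ).app _) (Iso.refl _)⟩⟩,
    ⟨(LinearEquiv.ofBijective ((preadditiveCoyonedaObj P).map g).hom hg).symm ≪≫ₗ e⟩⟩

end IsSeparatingSilting

end Heart

section HeartEquivalence

open DerivedCategory DerivedCategory.TStructure

lemma DistTriang.shift {D : Type*} [Category* D] [Preadditive D] [HasZeroObject D] [HasShift D ℤ]
    [∀ n : ℤ, (shiftFunctor D n).Additive] [Pretriangulated D] {X Y Z : D} {f : X ⟶ Y} {g : Y ⟶ Z}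
    {δ : Z ⟶ X⟦(1 : ℤ)⟧} (h : Triangle.mk f g δ ∈ distTriang D) (i : ℤ) :
    ∃ δ', Triangle.mk (f⟦i⟧') (g⟦i⟧') δ' ∈ distTriang D := by
  have hi : (i.negOnePow : ℤ) * i.negOnePow = 1 := by
    simp
  have h₁ : (i.negOnePow : ℤ) • (i.negOnePow : ℤ) • 𝟙 (Y⟦i⟧) = 𝟙 (Y⟦i⟧) := by
    rw [smul_smul, hi, one_smul]
  let e : Y⟦i⟧ ≅ Y⟦i⟧ :=
    ⟨(i.negOnePow : ℤ) • 𝟙 _, (i.negOnePow : ℤ) • 𝟙 _, by simp [smul_smul, hi],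
      by simp [smul_smul, hi]⟩
  refine ⟨((Triangle.shiftFunctor D i).obj (Triangle.mk f g δ)).mor₃,
    isomorphic_distinguished _ (Triangle.shift_distinguished _ h i) _
    (Triangle.isoMk _ _ (Iso.refl _) e (Iso.refl _) ?_ ?_ ?_)⟩
  · change f⟦i⟧' ≫ ((i.negOnePow : ℤ) • 𝟙 _) = 𝟙 _ ≫ ((i.negOnePow : ℤ) • f⟦i⟧')
    simp
  · change g⟦i⟧' ≫ 𝟙 _ = ((i.negOnePow : ℤ) • 𝟙 _) ≫ ((i.negOnePow : ℤ) • g⟦i⟧')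
    simp [smul_smul, hi]
  · exact (congr((_ : _ ⟶ _) ≫ $((shiftFunctor D (1 : ℤ)).map_id (X⟦i⟧)))).trans
      ((Category.comp_id _).trans (Category.id_comp _).symm)

variable {A : Type u} [Ring A] [IsNoetherianRing A] [HasDerivedCategory.{u} (ModuleCat.{u} A)]
variable {P : DerivedCategory (ModuleCat.{u} A)}

omit [IsNoetherianRing A] in
lemma heart_of_iso {X Y : DerivedCategory (ModuleCat.{u} A)} (e : X ≅ Y) (hX : heart P X) :
    heart P Y := by
  obtain ⟨U, V, hU, hV, ⟨e'⟩⟩ := hX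
  exact ⟨U, V, hU, hV, ⟨e.symm ≪≫ e'⟩⟩

/-- The two classes of the torsion pair, indexed by the shift which brings them to the heart. -/
def part (P : DerivedCategory (ModuleCat.{u} A)) (i : ℤ) (U : FGModuleCat.{u} A) : Prop :=
  HomZero P (fgStalk.obj U) (1 - i)

lemma heart_part {i : ℤ} (hi : i = 0 ∨ i = 1) {U : FGModuleCat.{u} A} (hU : part P i U) :
    heart P ((fgStalk.obj U)⟦i⟧) := by
  obtain rfl | rfl := hi
  · exact heart_of_iso ((shiftFunctorZero _ ℤ).symm.app _) (heart_torsion (by simpa [part] using hU))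
  · exact heart_torsionFree (by simpa [part] using hU)

/-- A short exact sequence of finitely generated modules gives a distinguished triangle. -/
lemma exists_distTriang_fgStalk {S : ShortComplex (FGModuleCat.{u} A)} (hS : S.ShortExact)
    (i : ℤ) : ∃ δ, Triangle.mk ((fgStalk.map S.f)⟦i⟧') ((fgStalk.map S.g)⟦i⟧') δ ∈
      distTriang (DerivedCategory (ModuleCat.{u} A)) :=
  DistTriang.shift (hS.map_of_exact
    (forget₂ (FGModuleCat.{u} A) (ModuleCat.{u} A))).singleTriangle_distinguished i

namespace IsSeparatingSilting

variable (hP : IsSeparatingSilting P)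
include hP

/-- The functor `Hom(P, -[i])` on finitely generated modules. -/
noncomputable def homFunctor (i : ℤ) : FGModuleCat.{u} A ⥤ FGModuleCat.{u} (End P)ᵐᵒᵖ :=
  ObjectProperty.lift _ (fgStalk ⋙ shiftFunctor _ i ⋙ preadditiveCoyonedaObj P)
    fun U => hP.finite_hom U i

instance (i : ℤ) : (hP.homFunctor i).Additive where
  map_add {_ _ f g} := (forget₂ (FGModuleCat.{u} (End P)ᵐᵒᵖ) (ModuleCat.{u} (End P)ᵐᵒᵖ)).map_injective
    ((fgStalk ⋙ shiftFunctor _ i ⋙ preadditiveCoyonedaObj P).map_add (f := f) (g := g))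

lemma homFunctor_shortExact {i : ℤ} (hi : i = 0 ∨ i = 1) (S : ShortComplex (FGModuleCat.{u} A))
    (hS : S.ShortExact) (h₁ : part P i S.X₁) (h₃ : part P i S.X₃) :
    (S.map (hP.homFunctor i)).ShortExact := by
  have := hP.noetherian
  obtain ⟨δ, h⟩ := exists_distTriang_fgStalk hS i
  rw [fg_shortExact_iff]
  have k₁ := hP.homZero_heart (heart_part hi h₁) (i := 1) (by simp)
  have k₃ := hP.homZero_heart (heart_part hi h₃) (i := -1) (by simp)
  refine ⟨(injective_iff_map_eq_zero _).2 fun x hx => HomZero.injective_mor₁ h k₃ x hx,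
    fun x => DistTriang.lift₃ h x (k₁ _), ?_⟩
  ext x
  constructor
  · rintro ⟨y, rfl⟩
    exact (Category.assoc _ _ _).trans
      (congr((y : P ⟶ _) ≫ $(DistTriang.comp_zero₁ h)).trans comp_zero)
  · exact fun hx => DistTriang.lift₂ h x hx

/-- The functor `Hom(P, -)` from the heart to finitely generated modules. -/
noncomputable def heartFunctor : (heart P).FullSubcategory ⥤ FGModuleCat.{u} (End P)ᵐᵒᵖ :=
  ObjectProperty.lift _ ((heart P).ι ⋙ preadditiveCoyonedaObj P) fun X => hP.finite_heart X.2

instance : hP.heartFunctor.Additive where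
  map_add {_ _ f g} := (forget₂ (FGModuleCat.{u} (End P)ᵐᵒᵖ) (ModuleCat.{u} (End P)ᵐᵒᵖ)).map_injective
    (((heart P).ι ⋙ preadditiveCoyonedaObj P).map_add (f := f) (g := g))

instance : hP.heartFunctor.Faithful where
  map_injective {X Y f g} hfg := by
    have := hP.finite_heart X.2
    rw [← sub_eq_zero]
    refine (heart P).ι.map_injective ?_
    refine hom_ext_of_orth (P := P) (fun i hi => hP.homZero_self hi)
      (fun i hi => hP.homZero_heart X.2 (by omega)) (hP.hom_heart_eq_zero Y.2) _ fun h => ?_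
    have := congr(lin $hfg (homEquiv P X.1 h))
    have h' : h ≫ f.hom = h ≫ g.hom := this
    change h ≫ (f.hom - g.hom) = 0
    rw [Preadditive.comp_sub, h', sub_self]

instance : hP.heartFunctor.Full where
  map_surjective {X Y} φ := by
    have := hP.finite_heart X.2
    have := hP.noetherian
    obtain ⟨f, hf⟩ := exists_hom_of_orth (P := P) (fun i hi => hP.homZero_self hi)
      (fun i hi => hP.homZero_heart X.2 (i := i) (by omega))
      (hP.homZero_heart X.2 (by simp)) (hP.hom_heart_eq_zero Y.2) (lin φ)
    exact ⟨ObjectProperty.homMk f, fg_hom_ext (LinearMap.ext fun x => hf x)⟩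

instance : hP.heartFunctor.EssSurj where
  mem_essImage N := by
    obtain ⟨X, hX, ⟨e⟩⟩ := hP.exists_heart N.obj
    exact ⟨⟨X, hX⟩, ⟨ObjectProperty.isoMk _ e.toModuleIso⟩⟩

end IsSeparatingSilting

end HeartEquivalence

section HeartTransfer

open DerivedCategory DerivedCategory.TStructure

lemma nonempty_retract_biprod {C : Type*} [Category* C] [Preadditive C] [HasBinaryBiproducts C]
    {X U V U' V' : C} (p : X ⟶ U) (i : U ⟶ X) (q : X ⟶ V) (j : V ⟶ X) (h : p ≫ i + q ≫ j = 𝟙 X)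
    (e : U ≅ U') (e' : V ≅ V') : Nonempty (Retract X (U' ⊞ V')) :=
  ⟨⟨biprod.lift (p ≫ e.hom) (q ≫ e'.hom), biprod.desc (e.inv ≫ i) (e'.inv ≫ j), by simpa⟩⟩

variable {A : Type u} [Ring A] [IsNoetherianRing A] [HasDerivedCategory.{u} (ModuleCat.{u} A)]
variable {P : DerivedCategory (ModuleCat.{u} A)}

/-- A torsion or torsion-free module, as an object of the heart. -/
noncomputable abbrev partHeart {i : ℤ} (hi : i = 0 ∨ i = 1) {U : FGModuleCat.{u} A}
    (hU : part P i U) : (heart P).FullSubcategory :=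
  ⟨(fgStalk.obj U)⟦i⟧, heart_part hi hU⟩

lemma exists_heart_decomp (X : (heart P).FullSubcategory) :
    ∃ (U V : FGModuleCat.{u} A) (hU : part P 0 U) (hV : part P 1 V)
      (p : X ⟶ partHeart (.inl rfl) hU) (i : partHeart (.inl rfl) hU ⟶ X)
      (q : X ⟶ partHeart (.inr rfl) hV) (j : partHeart (.inr rfl) hV ⟶ X),
      i ≫ p = 𝟙 _ ∧ j ≫ q = 𝟙 _ ∧ p ≫ i + q ≫ j = 𝟙 X := by
  obtain ⟨U, V, hU, hV, ⟨e⟩⟩ := X.2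
  let z := (shiftFunctorZero _ ℤ).app (fgStalk.obj U)
  refine ⟨U, V, by simpa [part] using hU, by simpa [part] using hV,
    ObjectProperty.homMk (e.hom ≫ biprod.fst ≫ z.inv),
    ObjectProperty.homMk (z.hom ≫ biprod.inl ≫ e.inv),
    ObjectProperty.homMk (e.hom ≫ biprod.snd), ObjectProperty.homMk (biprod.inr ≫ e.inv),
    ?_, ?_, ?_⟩
  · refine ObjectProperty.hom_ext _ ?_
    change (z.hom ≫ biprod.inl ≫ e.inv) ≫ e.hom ≫ biprod.fst ≫ z.inv = 𝟙 _
    simp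
  · refine ObjectProperty.hom_ext _ ?_
    change (biprod.inr ≫ e.inv) ≫ e.hom ≫ biprod.snd = 𝟙 _
    simp
  · refine ObjectProperty.hom_ext _ ?_
    change (e.hom ≫ biprod.fst ≫ z.inv) ≫ (z.hom ≫ biprod.inl ≫ e.inv) +
      (e.hom ≫ biprod.snd) ≫ (biprod.inr ≫ e.inv) = 𝟙 _
    have := congr(e.hom ≫ $(biprod.total (X := fgStalk.obj U)
      (Y := (fgStalk.obj V)⟦(1 : ℤ)⟧)) ≫ e.inv)
    simpa [-biprod.total] using this

namespace IsSeparatingSilting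

variable (hP : IsSeparatingSilting P)
include hP

lemma extLE_end [IsNoetherianRing (End P)ᵐᵒᵖ] {J : FGModuleCat.{u} A} (hJ : IsInjCogen J)
    {J' : FGModuleCat.{u} (End P)ᵐᵒᵖ} (hJ' : IsInjCogen J') {n : ℕ}
    (hn : ExtLE (FGModuleCat.{u} A) n) : ExtLE (FGModuleCat.{u} (End P)ᵐᵒᵖ) n := by
  have h0 (U : FGModuleCat.{u} A) : HomZero P (fgStalk.obj U) 1 ↔ part P 0 U := by simp [part]
  have h1 (U : FGModuleCat.{u} A) : HomZero P (fgStalk.obj U) 0 ↔ part P 1 U := by simp [part]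
  refine ExtLE.of_splitTorsion hJ isProjGen_regular hP.split isProjGen_regular hJ'
    (hP.homFunctor 0) (hP.homFunctor 1)
    (fun S hS h₁ _ h₃ => hP.homFunctor_shortExact (.inl rfl) S hS ((h0 _).1 h₁) ((h0 _).1 h₃))
    (fun S hS h₁ _ h₃ => hP.homFunctor_shortExact (.inr rfl) S hS ((h1 _).1 h₁) ((h1 _).1 h₃))
    (fun Y => ?_) hn
  obtain ⟨U, V, hU, hV, p, i, q, j, -, -, h⟩ := exists_heart_decomp (hP.heartFunctor.objPreimage Y)
  refine ⟨U, V, (h0 _).2 hU, (h1 _).2 hV, ?_⟩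
  let e := hP.heartFunctor.objObjPreimageIso Y
  refine nonempty_retract_biprod (e.inv ≫ hP.heartFunctor.map p) (hP.heartFunctor.map i ≫ e.hom)
    (e.inv ≫ hP.heartFunctor.map q) (hP.heartFunctor.map j ≫ e.hom) ?_ (Iso.refl _) (Iso.refl _)
  have := congr(e.inv ≫ hP.heartFunctor.map $h ≫ e.hom)
  simpa [Functor.map_add, -ObjectProperty.FullSubcategory.comp_hom] using this

end IsSeparatingSilting

end HeartTransfer

section HeartTransferInverse

open DerivedCategory DerivedCategory.TStructure

variable {A : Type u} [Ring A] [IsNoetherianRing A] [HasDerivedCategory.{u} (ModuleCat.{u} A)]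
variable {P : DerivedCategory (ModuleCat.{u} A)}

omit [IsNoetherianRing A] in
lemma isZero_homology_stalk_shift (X : ModuleCat.{u} A) {i j : ℤ} (h : i + j ≠ 0) :
    IsZero ((homologyFunctor (ModuleCat.{u} A) j).obj ((stalk.obj X)⟦i⟧)) := by
  have h₁ := isLE_stalk_shift X i
  have h₂ := isGE_stalk_shift X i
  rw [isLE_iff] at h₁
  rw [isGE_iff] at h₂
  rcases lt_or_gt_of_ne h with h | h
  · exact h₂ j (by omega)
  · exact h₁ j (by omega)

omit [IsNoetherianRing A] in
lemma finite_homology_stalk_shift (X : FGModuleCat.{u} A) (i j : ℤ) :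
    Module.Finite A ((homologyFunctor (ModuleCat.{u} A) j).obj ((fgStalk.obj X)⟦i⟧)) := by
  by_cases h : i + j = 0
  · obtain rfl : j = -i := by omega
    have : Module.Finite A ((𝟭 (ModuleCat.{u} A)).obj X.obj) := X.2
    exact Module.Finite.equiv ((homologyStalkShift i).app X.obj).symm.toLinearEquiv
  · have : Subsingleton ((homologyFunctor (ModuleCat.{u} A) j).obj ((fgStalk.obj X)⟦i⟧)) :=
      ModuleCat.subsingleton_of_isZero (isZero_homology_stalk_shift X.obj h)
    infer_instance

lemma finite_homology_heart (X : (heart P).FullSubcategory) (j : ℤ) :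
    Module.Finite A ((homologyFunctor (ModuleCat.{u} A) j).obj X.obj) := by
  obtain ⟨U, V, hU, hV, p, i, q, k, -, -, h⟩ := exists_heart_decomp X
  have h₁ := finite_homology_stalk_shift U 0 j
  have h₂ := finite_homology_stalk_shift V 1 j
  let H := (heart P).ι ⋙ homologyFunctor (ModuleCat.{u} A) j
  have : Module.Finite A (H.obj (partHeart (.inl rfl) hU)) := h₁
  have : Module.Finite A (H.obj (partHeart (.inr rfl) hV)) := h₂
  refine Module.Finite.of_surjective ((H.map i).hom.coprod (H.map k).hom) fun x =>
    ⟨((H.map p).hom x, (H.map q).hom x), ?_⟩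
  have := congr((H.map $h).hom x)
  rw [Functor.map_add, Functor.map_comp, Functor.map_comp, CategoryTheory.Functor.map_id] at this
  exact this

namespace IsSeparatingSilting

variable (hP : IsSeparatingSilting P)
include hP

instance : hP.heartFunctor.IsEquivalence where

/-- The quasi-inverse of `Hom(P, -[i])`, on the relevant part of the torsion pair. -/
noncomputable def homologyOfModule (i : ℤ) :
    FGModuleCat.{u} (End P)ᵐᵒᵖ ⥤ FGModuleCat.{u} A :=
  ObjectProperty.lift _ (hP.heartFunctor.inv ⋙ (heart P).ι ⋙ homologyFunctor (ModuleCat.{u} A) (-i))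
    fun N => finite_homology_heart (hP.heartFunctor.inv.obj N) (-i)

instance : hP.heartFunctor.inv.Additive :=
  have : hP.heartFunctor.asEquivalence.functor.Additive :=
    inferInstanceAs hP.heartFunctor.Additive
  hP.heartFunctor.asEquivalence.inverse_additive

instance (i : ℤ) : (hP.homologyOfModule i).Additive where
  map_add {_ _ f g} := (forget₂ (FGModuleCat.{u} A) (ModuleCat.{u} A)).map_injective
    ((hP.heartFunctor.inv ⋙ (heart P).ι ⋙ homologyFunctor (ModuleCat.{u} A) (-i)).map_add
      (f := f) (g := g))

omit hP in
/-- The image of `part P i`. -/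
def modulePart (hP : IsSeparatingSilting P) (i : ℤ) (N : FGModuleCat.{u} (End P)ᵐᵒᵖ) : Prop :=
  ∃ U : FGModuleCat.{u} A, part P i U ∧ Nonempty (N ≅ (hP.homFunctor i).obj U)

lemma exists_iso_of_modulePart {i : ℤ} (hi : i = 0 ∨ i = 1) {N : FGModuleCat.{u} (End P)ᵐᵒᵖ}
    (hN : hP.modulePart i N) : ∃ (U : FGModuleCat.{u} A) (hU : part P i U),
      Nonempty (hP.heartFunctor.inv.obj N ≅ partHeart hi hU) := by
  obtain ⟨U, hU, ⟨e⟩⟩ := hN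
  exact ⟨U, hU, ⟨hP.heartFunctor.inv.mapIso e ≪≫
    (hP.heartFunctor.asEquivalence.unitIso.app (partHeart hi hU)).symm⟩⟩

lemma isZero_homology_of_modulePart {i j : ℤ} (hi : i = 0 ∨ i = 1) (hij : i + j ≠ 0)
    {N : FGModuleCat.{u} (End P)ᵐᵒᵖ} (hN : hP.modulePart i N) :
    IsZero ((homologyFunctor (ModuleCat.{u} A) j).obj (hP.heartFunctor.inv.obj N).obj) := by
  obtain ⟨U, hU, ⟨e⟩⟩ := hP.exists_iso_of_modulePart hi hN
  exact (isZero_homology_stalk_shift U.obj hij).of_iso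
    (((heart P).ι ⋙ homologyFunctor (ModuleCat.{u} A) j).mapIso e)

lemma exists_distTriang_inv [IsNoetherianRing (End P)ᵐᵒᵖ]
    (S : ShortComplex (FGModuleCat.{u} (End P)ᵐᵒᵖ)) (hS : S.ShortExact) :
    ∃ δ, Triangle.mk (hP.heartFunctor.inv.map S.f).hom (hP.heartFunctor.inv.map S.g).hom δ ∈
      distTriang (DerivedCategory (ModuleCat.{u} A)) := by
  have h : ((S.map hP.heartFunctor.inv).map hP.heartFunctor).ShortExact :=
    ShortComplex.shortExact_of_iso (S.mapNatIso hP.heartFunctor.asEquivalence.counitIso.symm) hS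
  rw [fg_shortExact_iff] at h
  obtain ⟨h₁, h₂, h₃⟩ := h
  have w := (S.map hP.heartFunctor.inv).zero
  refine exists_distTriang_of_exact hP.isZero
    (fun i hi => hP.homZero_heart (hP.heartFunctor.inv.obj S.X₁).2 hi)
    (fun i hi => hP.homZero_heart (hP.heartFunctor.inv.obj S.X₂).2 hi)
    (fun i hi => hP.homZero_heart (hP.heartFunctor.inv.obj S.X₃).2 hi) _ _
    congr((heart P).ι.map $w) (fun x hx => ?_) (fun x hx => ?_) fun x => h₂ x
  · exact (injective_iff_map_eq_zero _).1 h₁ x hx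
  · exact (SetLike.ext_iff.1 h₃ x).2 hx

lemma homologyOfModule_shortExact [IsNoetherianRing (End P)ᵐᵒᵖ] {i : ℤ} (hi : i = 0 ∨ i = 1)
    (S : ShortComplex (FGModuleCat.{u} (End P)ᵐᵒᵖ)) (hS : S.ShortExact)
    (h₁ : hP.modulePart i S.X₁) (h₃ : hP.modulePart i S.X₃) :
    (S.map (hP.homologyOfModule i)).ShortExact := by
  obtain ⟨δ, h⟩ := hP.exists_distTriang_inv S hS
  obtain ⟨w, hw⟩ := homology_exact h (-i)
  have hm := homology_mono h (-i) (hP.isZero_homology_of_modulePart hi (by omega) h₃)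
  have he := homology_epi h (-i) (hP.isZero_homology_of_modulePart hi (by omega) h₁)
  rw [fg_shortExact_iff]
  exact ⟨(ModuleCat.mono_iff_injective _).1 hm, (ModuleCat.epi_iff_surjective _).1 he,
    hw.moduleCat_range_eq_ker⟩

lemma splitTorsion_modulePart [IsNoetherianRing (End P)ᵐᵒᵖ] : SplitTorsion (hP.modulePart 1) (hP.modulePart 0) where
  hom_eq_zero {N N'} hN hN' f := by
    obtain ⟨V, hV, ⟨e⟩⟩ := hP.exists_iso_of_modulePart (.inr rfl) hN
    obtain ⟨U, hU, ⟨e'⟩⟩ := hP.exists_iso_of_modulePart (.inl rfl) hN'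
    refine hP.heartFunctor.inv.map_injective ?_
    rw [Functor.map_zero, ← cancel_epi e.inv, ← cancel_mono e'.hom, comp_zero, zero_comp]
    refine (heart P).ι.map_injective ?_
    have : t.IsLE ((heart P).ι.obj (partHeart (.inr rfl) hV)) (-1) := isLE_stalk_shift V.obj 1
    have : t.IsGE ((heart P).ι.obj (partHeart (.inl rfl) hU)) (-0) := isGE_stalk_shift U.obj 0
    exact t.zero _ (-1) (-0) (by simp)
  of_iso_left := by
    rintro X Y e ⟨U, hU, ⟨e'⟩⟩
    exact ⟨U, hU, ⟨e.symm ≪≫ e'⟩⟩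
  of_iso_right := by
    rintro X Y e ⟨U, hU, ⟨e'⟩⟩
    exact ⟨U, hU, ⟨e.symm ≪≫ e'⟩⟩
  exists_decomp N := by
    obtain ⟨U, V, hU, hV, p, i, q, j, h₁, h₂, h⟩ :=
      exists_heart_decomp (hP.heartFunctor.objPreimage N)
    let e := hP.heartFunctor.objObjPreimageIso N
    refine ⟨hP.heartFunctor.obj (partHeart (.inr rfl) hV),
      hP.heartFunctor.obj (partHeart (.inl rfl) hU), e.inv ≫ hP.heartFunctor.map q,
      hP.heartFunctor.map j ≫ e.hom, e.inv ≫ hP.heartFunctor.map p,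
      hP.heartFunctor.map i ≫ e.hom, ⟨V, hV, ⟨Iso.refl _⟩⟩, ⟨U, hU, ⟨Iso.refl _⟩⟩, ?_, ?_, ?_⟩
    · have := congr(hP.heartFunctor.map $h₂)
      rw [Functor.map_comp, CategoryTheory.Functor.map_id] at this
      simpa using this
    · have := congr(hP.heartFunctor.map $h₁)
      rw [Functor.map_comp, CategoryTheory.Functor.map_id] at this
      simpa using this
    · have := congr(e.inv ≫ hP.heartFunctor.map $h ≫ e.hom)
      rw [Functor.map_add, Functor.map_comp, Functor.map_comp,
        CategoryTheory.Functor.map_id, add_comm] at this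
      simpa using this

lemma nonempty_iso_homologyOfModule {i : ℤ} (hi : i = 0 ∨ i = 1) {U : FGModuleCat.{u} A}
    (hU : part P i U) :
    Nonempty (U ≅ (hP.homologyOfModule i).obj ((hP.homFunctor i).obj U)) :=
  ⟨ObjectProperty.isoMk _ (((homologyStalkShift i).app U.obj).symm ≪≫
    ((heart P).ι ⋙ homologyFunctor (ModuleCat.{u} A) (-i)).mapIso
      (hP.heartFunctor.asEquivalence.unitIso.app (partHeart hi hU)))⟩

lemma extLE_of_end [IsNoetherianRing (End P)ᵐᵒᵖ] {J : FGModuleCat.{u} A} (hJ : IsInjCogen J)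
    {J' : FGModuleCat.{u} (End P)ᵐᵒᵖ} (hJ' : IsInjCogen J') {n : ℕ}
    (hn : ExtLE (FGModuleCat.{u} (End P)ᵐᵒᵖ) n) : ExtLE (FGModuleCat.{u} A) n := by
  refine ExtLE.of_splitTorsion hJ' isProjGen_regular hP.splitTorsion_modulePart isProjGen_regular hJ
    (hP.homologyOfModule 1) (hP.homologyOfModule 0)
    (fun S hS h₁ _ h₃ => hP.homologyOfModule_shortExact (.inr rfl) S hS h₁ h₃)
    (fun S hS h₁ _ h₃ => hP.homologyOfModule_shortExact (.inl rfl) S hS h₁ h₃)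
    (fun Y => ?_) hn
  obtain ⟨U, V, p, i, q, j, hU, hV, -, -, h⟩ := hP.split.exists_decomp Y
  have hU' : part P 0 U := by simpa [part] using hU
  have hV' : part P 1 V := by simpa [part] using hV
  obtain ⟨e⟩ := hP.nonempty_iso_homologyOfModule (.inl rfl) hU'
  obtain ⟨e'⟩ := hP.nonempty_iso_homologyOfModule (.inr rfl) hV'
  exact ⟨_, _, ⟨V, hV', ⟨Iso.refl _⟩⟩, ⟨U, hU', ⟨Iso.refl _⟩⟩,
    nonempty_retract_biprod q j p i (by rwa [add_comm]) e' e⟩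

/-- Extension dimension bounds transfer along a separating silting complex. -/
lemma extLE_iff [IsNoetherianRing (End P)ᵐᵒᵖ] {J : FGModuleCat.{u} A} (hJ : IsInjCogen J)
    {J' : FGModuleCat.{u} (End P)ᵐᵒᵖ} (hJ' : IsInjCogen J') (n : ℕ) :
    ExtLE (FGModuleCat.{u} A) n ↔ ExtLE (FGModuleCat.{u} (End P)ᵐᵒᵖ) n :=
  ⟨hP.extLE_end hJ hJ', hP.extLE_of_end hJ hJ'⟩

end IsSeparatingSilting

end HeartTransferInverse

section KProjective

universe w' v w

open DerivedCategory DerivedCategory.TStructure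

variable {C : Type w} [Category.{v} C] [Abelian C] [HasDerivedCategory.{w'} C]

lemma Q_map_surjective (K L : CochainComplex C ℤ) [K.IsKProjective] :
    Function.Surjective (Q.map : (K ⟶ L) → (Q.obj K ⟶ Q.obj L)) := by
  intro f
  obtain ⟨g, hg⟩ := (CochainComplex.IsKProjective.Qh_map_bijective K _).2
    ((quotientCompQhIso C).hom.app K ≫ f ≫ (quotientCompQhIso C).inv.app L)
  obtain ⟨g, rfl⟩ := (HomotopyCategory.quotient _ _).map_surjective g
  refine ⟨g, ?_⟩
  rw [← cancel_epi ((quotientCompQhIso C).hom.app K), ← quotientCompQhIso_hom_naturality, hg]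
  simp

lemma quotient_map_eq_zero {K L : CochainComplex C ℤ} [K.IsKProjective] {f : K ⟶ L}
    (hf : Q.map f = 0) : (HomotopyCategory.quotient C (ComplexShape.up ℤ)).map f = 0 := by
  apply (CochainComplex.IsKProjective.Qh_map_bijective K _).1
  rw [Functor.map_zero, ← cancel_mono ((quotientCompQhIso C).hom.app L), zero_comp,
    quotientCompQhIso_hom_naturality, hf, comp_zero]

lemma Q_map_eq_zero {K L : CochainComplex C ℤ} {f : K ⟶ L}
    (hf : (HomotopyCategory.quotient C (ComplexShape.up ℤ)).map f = 0) : Q.map f = 0 := by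
  rw [← cancel_epi ((quotientCompQhIso C).hom.app K), ← quotientCompQhIso_hom_naturality, hf]
  simp

lemma isZero_of_homology (W : DerivedCategory C)
    (h : ∀ i, IsZero ((homologyFunctor C i).obj W)) : IsZero W := by
  have : W.IsLE (-1) := (isLE_iff W _).2 fun i _ => h i
  have : W.IsGE 0 := (isGE_iff W _).2 fun i _ => h i
  exact t.isZero W (-1) 0 (by simp)

/-- The objects of the homotopy category without morphisms to the shifts of `W`. -/
def leftOrth (W : DerivedCategory C) : Set (HomotopyCategory C (ComplexShape.up ℤ)) :=
  {Z | ∀ i, HomZero (Qh.obj Z) W i}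

lemma leftOrth_shift {W : DerivedCategory C} {Z : HomotopyCategory C (ComplexShape.up ℤ)}
    (hZ : Z ∈ leftOrth W) (n : ℤ) : Z⟦n⟧ ∈ leftOrth W := by
  intro i f
  rw [← cancel_epi ((Qh.commShiftIso n).inv.app Z), comp_zero]
  exact HomZero.shift_source (hZ (i - n)) (by omega) _

lemma leftOrth_obj₃ {W : DerivedCategory C}
    {T : Triangle (HomotopyCategory C (ComplexShape.up ℤ))} (hT : T ∈ distTriang _)
    (h₁ : T.obj₁ ∈ leftOrth W) (h₂ : T.obj₂ ∈ leftOrth W) : T.obj₃ ∈ leftOrth W := by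
  intro i f
  obtain ⟨g, hg⟩ := Triangle.yoneda_exact₃ _ (Qh.map_distinguished T hT) f (h₂ i _)
  rw [hg]
  have : g = 0 := HomZero.shift_source (h₁ (i - 1)) (by omega) _
  rw [this]
  exact comp_zero

lemma leftOrth_retract {W : DerivedCategory C} {X Y : HomotopyCategory C (ComplexShape.up ℤ)}
    (hX : X ∈ leftOrth W) (s : Y ⟶ X) (r : X ⟶ Y) (h : s ≫ r = 𝟙 Y) : Y ∈ leftOrth W := by
  intro i f
  have := congr(Qh.map $h ≫ f)
  rw [Functor.map_comp, Category.assoc, hX i (Qh.map r ≫ f), comp_zero] at this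
  simpa using this.symm

end KProjective

section Generation

open DerivedCategory DerivedCategory.TStructure

variable {A : Type u} [Ring A] [HasDerivedCategory.{u} (ModuleCat.{u} A)]

lemma triThick_subset_leftOrth {P : CochainComplex (ModuleCat.{u} A) ℤ}
    {W : DerivedCategory (ModuleCat.{u} A)} (h : ∀ i, HomZero (Q.obj P) W i) :
    triThick A {(HomotopyCategory.quotient (ModuleCat.{u} A) (ComplexShape.up ℤ)).obj P} ⊆
      leftOrth W := by
  refine Set.sInter_subset_of_mem ⟨?_, fun n X hX => leftOrth_shift hX n,
    fun T hT h₁ h₂ => leftOrth_obj₃ hT h₁ h₂, fun X Y hX ⟨s, r, h⟩ => leftOrth_retract hX s r h⟩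
  rintro _ rfl i f
  rw [← cancel_epi ((quotientCompQhIso _).inv.app P), comp_zero]
  exact h i _

lemma exactAt_of_homZero (K : CochainComplex (ModuleCat.{u} A) ℤ) (i : ℤ)
    (h : ∀ f : Q.obj ((HomologicalComplex.single (ModuleCat.{u} A) (ComplexShape.up ℤ) i).obj
      (ModuleCat.of A A)) ⟶ Q.obj K, f = 0) : K.ExactAt i := by
  have : Projective (ModuleCat.of A A) := inferInstance
  have hp (n : ℤ) : Projective (((HomologicalComplex.single (ModuleCat.{u} A)
      (ComplexShape.up ℤ) i).obj (ModuleCat.of A A)).X n) := inferInstance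
  have hs : CochainComplex.IsStrictlyLE ((HomologicalComplex.single (ModuleCat.{u} A)
      (ComplexShape.up ℤ) i).obj (ModuleCat.of A A)) i :=
    inferInstanceAs (((CochainComplex.singleFunctor (ModuleCat.{u} A) i).obj
      (ModuleCat.of A A)).IsStrictlyLE i)
  have := CochainComplex.isKProjective_of_projective
    ((HomologicalComplex.single (ModuleCat.{u} A) (ComplexShape.up ℤ) i).obj (ModuleCat.of A A)) i
  rw [K.exactAt_iff' (i - 1) i (i + 1) (by simp) (by simp), ShortComplex.moduleCat_exact_iff]
  intro x hx
  let g := HomologicalComplex.mkHomFromSingle (K := K) (j := i) (A := ModuleCat.of A A)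
    (ModuleCat.ofHom (LinearMap.toSpanSingleton A _ x)) (by
      rintro j rfl
      ext
      exact (congrArg (K.d i (i + 1)).hom (one_smul A x)).trans hx)
  have H := HomotopyCategory.homotopyOfEq g 0
    ((quotient_map_eq_zero (h _)).trans (Functor.map_zero _ _ _).symm)
  have h₁ := H.comm i
  rw [dNext_eq _ (show (ComplexShape.up ℤ).Rel i (i + 1) from rfl),
    prevD_eq _ (show (ComplexShape.up ℤ).Rel (i - 1) i by simp),
    HomologicalComplex.single_obj_d, zero_comp, zero_add, HomologicalComplex.zero_f, add_zero,
    HomologicalComplex.mkHomFromSingle_f] at h₁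
  refine ⟨(H.hom i (i - 1)).hom
    ((HomologicalComplex.singleObjXSelf (ComplexShape.up ℤ) i (ModuleCat.of A A)).inv.hom 1), ?_⟩
  have h₂ := congr(((HomologicalComplex.singleObjXSelf (ComplexShape.up ℤ) i
    (ModuleCat.of A A)).inv ≫ $h₁).hom (1 : A))
  rw [Iso.inv_hom_id_assoc] at h₂
  exact h₂.symm.trans (one_smul A x)

lemma isZero_of_triThick {P : CochainComplex (ModuleCat.{u} A) ℤ}
    (hP : ∀ i, (HomotopyCategory.quotient (ModuleCat.{u} A) (ComplexShape.up ℤ)).obj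
      ((HomologicalComplex.single (ModuleCat.{u} A) (ComplexShape.up ℤ) i).obj
        (ModuleCat.of A A)) ∈
      triThick A {(HomotopyCategory.quotient (ModuleCat.{u} A) (ComplexShape.up ℤ)).obj P})
    (W : DerivedCategory (ModuleCat.{u} A)) (h : ∀ i, HomZero (Q.obj P) W i) : IsZero W := by
  obtain ⟨K, ⟨e⟩⟩ : ∃ K, Nonempty (W ≅ Q.obj K) := ⟨_, ⟨(Q.objObjPreimageIso W).symm⟩⟩
  refine isZero_of_homology W fun i => ?_
  refine ((K.exactAt_iff_isZero_homology i).1 (exactAt_of_homZero K i fun f => ?_)).of_iso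
    ((homologyFunctor _ i).mapIso e ≪≫ (homologyFunctorFactors _ i).app K)
  have := triThick_subset_leftOrth h (hP i) 0
    ((quotientCompQhIso _).hom.app _ ≫ f ≫ e.inv ≫ (shiftFunctorZero _ ℤ).inv.app _)
  rw [← cancel_mono (e.inv ≫ (shiftFunctorZero _ ℤ).inv.app _), zero_comp,
    ← cancel_epi ((quotientCompQhIso _).hom.app _), comp_zero]
  exact this

end Generation

section Finiteness

open DerivedCategory
open scoped ModuleCat.Algebra

variable {k : Type u} [CommRing k] [IsNoetherianRing k] {A : Type u} [Ring A] [Algebra k A]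

variable (k) in
lemma finite_moduleCat_hom [Module.Finite k A] (M N : ModuleCat.{u} A) [Module.Finite A M]
    [Module.Finite A N] : Module.Finite k (M ⟶ N) := by
  have : Module.Finite k N := Module.Finite.trans A N
  obtain ⟨n, s, hs⟩ := Module.Finite.exists_fin (R := A) (M := M)
  refine Module.Finite.of_injective
    (LinearMap.pi fun i : Fin n =>
      { toFun := fun f : M ⟶ N => f.hom (s i)
        map_add' := fun _ _ => rfl
        map_smul' := fun _ _ => rfl } : (M ⟶ N) →ₗ[k] Fin n → N) fun f g h => ?_
  ext1
  refine LinearMap.ext_on hs ?_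
  rintro _ ⟨i, rfl⟩
  exact congrFun h i

variable (k) in
lemma finite_complex_hom [Module.Finite k A] (P K : CochainComplex (ModuleCat.{u} A) ℤ)
    [∀ i, Module.Finite A (P.X i)] [∀ i, Module.Finite A (K.X i)]
    (hP : ∀ i : ℤ, i ≠ -1 → i ≠ 0 → Subsingleton (P.X i)) : Module.Finite k (P ⟶ K) := by
  have (i : ℤ) := finite_moduleCat_hom k (P.X i) (K.X i)
  refine Module.Finite.of_injective
    ({ toFun := fun f : P ⟶ K => (f.f (-1), f.f 0)
       map_add' := fun _ _ => rfl
       map_smul' := fun _ _ => rfl } :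
      (P ⟶ K) →ₗ[k] (P.X (-1) ⟶ K.X (-1)) × (P.X 0 ⟶ K.X 0)) fun f g h => ?_
  ext1 i
  obtain ⟨h₁, h₂⟩ := Prod.ext_iff.1 h
  by_cases hi : i = -1
  · exact hi ▸ h₁
  · by_cases hi' : i = 0
    · exact hi' ▸ h₂
    · have := hP i hi hi'
      exact (ModuleCat.isZero_of_subsingleton _).eq_of_src _ _

variable [HasDerivedCategory.{u} (ModuleCat.{u} A)]

variable (k) in
lemma finite_Q_hom [Module.Finite k A] (P K : CochainComplex (ModuleCat.{u} A) ℤ)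
    [P.IsKProjective]
    [∀ i, Module.Finite A (P.X i)] [∀ i, Module.Finite A (K.X i)]
    (hP : ∀ i : ℤ, i ≠ -1 → i ≠ 0 → Subsingleton (P.X i)) :
    Module.Finite k (Q.obj P ⟶ Q.obj K) := by
  have := finite_complex_hom k P K hP
  exact Module.Finite.of_surjective (Functor.mapLinearMap k Q (X := P) (Y := K))
    (Q_map_surjective P K)

omit [IsNoetherianRing k] in
lemma finite_coyoneda {D : Type*} [Category.{u} D] [Preadditive D] [Linear k D] (X Y : D)
    [h : Module.Finite k (X ⟶ Y)] :
    Module.Finite (End X)ᵐᵒᵖ ((preadditiveCoyonedaObj X).obj Y) := by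
  obtain ⟨n, s, hs⟩ := Module.Finite.exists_fin (R := k) (M := X ⟶ Y)
  refine Module.Finite.of_surjective
    (Fintype.linearCombination (End X)ᵐᵒᵖ fun i : Fin n => homEquiv X Y (s i)) fun x => ?_
  obtain ⟨x, rfl⟩ := (homEquiv X Y).surjective x
  obtain ⟨c, rfl⟩ := (Submodule.mem_span_range_iff_exists_fun k).1
    (hs ▸ Submodule.mem_top : x ∈ Submodule.span k (Set.range s))
  refine ⟨fun i => (MulOpposite.op (c i • 𝟙 X : End X) : (End X)ᵐᵒᵖ), ?_⟩
  rw [Fintype.linearCombination_apply, map_sum]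
  refine Finset.sum_congr rfl fun i _ => ?_
  have h : c i • s i = (c i • 𝟙 X : End X) ≫ s i := by rw [Linear.smul_comp, Category.id_comp]
  rw [h]
  rfl

omit [HasDerivedCategory.{u} (ModuleCat.{u} A)] in
lemma finite_single (U : ModuleCat.{u} A) [Module.Finite A U] (i j : ℤ) :
    Module.Finite A (((HomologicalComplex.single _ (ComplexShape.up ℤ) i).obj U).X j) := by
  by_cases h : j = i
  · subst h
    exact Module.Finite.equiv
      (HomologicalComplex.singleObjXSelf (ComplexShape.up ℤ) j U).symm.toLinearEquiv
  · have := ModuleCat.subsingleton_of_isZero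
      (HomologicalComplex.isZero_single_obj_X (ComplexShape.up ℤ) i U j h)
    infer_instance

omit [HasDerivedCategory.{u} (ModuleCat.{u} A)] in
lemma projective_single (U : ModuleCat.{u} A) [Module.Projective A U]
    (i j : ℤ) :
    Module.Projective A (((HomologicalComplex.single _ (ComplexShape.up ℤ) i).obj U).X j) := by
  by_cases h : j = i
  · subst h
    exact Module.Projective.of_equiv
      (HomologicalComplex.singleObjXSelf (ComplexShape.up ℤ) j U).symm.toLinearEquiv
  · have := ModuleCat.subsingleton_of_isZero
      (HomologicalComplex.isZero_single_obj_X (ComplexShape.up ℤ) i U j h)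
    infer_instance

lemma finite_homologyFunctor [IsNoetherianRing A] (P : CochainComplex (ModuleCat.{u} A) ℤ)
    [∀ i, Module.Finite A (P.X i)] (j : ℤ) :
    Module.Finite A ((homologyFunctor (ModuleCat.{u} A) j).obj (Q.obj P)) := by
  have h₁ : Module.Finite A (P.cycles j) := Module.Finite.of_injective (P.iCycles j).hom
    ((ModuleCat.mono_iff_injective _).1 inferInstance)
  have h₂ : Module.Finite A (P.homology j) := Module.Finite.of_surjective (P.homologyπ j).hom
    ((ModuleCat.epi_iff_surjective _).1 inferInstance)
  change Module.Finite A
    ((HomologicalComplex.homologyFunctor (ModuleCat.{u} A) (ComplexShape.up ℤ) j).obj P) at h₂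
  exact Module.Finite.equiv
    ((homologyFunctorFactors (ModuleCat.{u} A) j).app P).symm.toLinearEquiv

end Finiteness

section Decomposition

variable {A : Type u} [Ring A]

lemma exists_prod_decomp {T F : ModuleCat.{u} A → Prop}
    (hT₀ : ∀ X : ModuleCat.{u} A, Subsingleton X → T X) (hF₀ : ∀ X : ModuleCat.{u} A, Subsingleton X → F X)
    (hT : ∀ X Y, T X → T Y → T (ModuleCat.of A (X × Y)))
    (hF : ∀ X Y, F X → F Y → F (ModuleCat.of A (X × Y)))
    (h : ∀ X : ModuleCat.{u} A, Module.Finite A X → Indec A X → T X ∨ F X)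
    (X : ModuleCat.{u} A) [Module.Finite A X] (hX : Module.length A X ≠ ⊤) :
    ∃ U V : ModuleCat.{u} A, T U ∧ F V ∧ Nonempty (X ≃ₗ[A] (U × V)) := by
  obtain ⟨n, hn⟩ := ENat.ne_top_iff_exists.1 hX
  induction n using Nat.strong_induction_on generalizing X with
  | _ n ih =>
  have hz : Subsingleton (ModuleCat.of A PUnit.{u + 1}) := inferInstanceAs (Subsingleton PUnit)
  by_cases hX' : Indec A X
  · obtain h | h := h X inferInstance hX'
    · exact ⟨X, ModuleCat.of A PUnit, h, hF₀ _ hz, ⟨LinearEquiv.prodUnique.symm⟩⟩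
    · exact ⟨ModuleCat.of A PUnit, X, hT₀ _ hz, h, ⟨LinearEquiv.uniqueProd.symm⟩⟩
  · obtain hs | hs := subsingleton_or_nontrivial X
    · exact ⟨X, ModuleCat.of A PUnit, hT₀ _ hs, hF₀ _ hz, ⟨LinearEquiv.prodUnique.symm⟩⟩
    · obtain ⟨Y, Z, ⟨e⟩, h'⟩ : ∃ Y Z : ModuleCat.{u} A, Nonempty (X ≃ₗ[A] (Y × Z)) ∧
          ¬ (Subsingleton Y ∨ Subsingleton Z) := by
        by_contra! hc
        exact hX' ⟨hs, fun Y Z h => by_contra fun h' => h' (hc Y Z h)⟩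
      rw [not_or, not_subsingleton_iff_nontrivial, not_subsingleton_iff_nontrivial] at h'
      obtain ⟨hY, hZ⟩ := h'
      have hl : Module.length A Y + Module.length A Z = n := by
        rw [← Module.length_prod, ← e.length_eq, hn]
      have hYf : Module.Finite A Y := Module.Finite.of_surjective
        (LinearMap.fst A Y Z ∘ₗ e.toLinearMap) (Prod.fst_surjective.comp e.surjective)
      have hZf : Module.Finite A Z := Module.Finite.of_surjective
        (LinearMap.snd A Y Z ∘ₗ e.toLinearMap) (Prod.snd_surjective.comp e.surjective)
      have hYp : 0 < Module.length A Y := Module.length_pos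
      have hZp : 0 < Module.length A Z := Module.length_pos
      have hYt : Module.length A Y ≠ ⊤ := fun h => by simp [h] at hl
      have hZt : Module.length A Z ≠ ⊤ := fun h => by simp [h] at hl
      obtain ⟨a, ha⟩ := ENat.ne_top_iff_exists.1 hYt
      obtain ⟨b, hb⟩ := ENat.ne_top_iff_exists.1 hZt
      rw [← ha, ← hb] at hl
      rw [← ha] at hYp
      rw [← hb] at hZp
      norm_cast at hl hYp hZp
      obtain ⟨U, V, hU, hV, ⟨e₁⟩⟩ := ih a (by omega) Y hYt ha
      obtain ⟨U', V', hU', hV', ⟨e₂⟩⟩ := ih b (by omega) Z hZt hb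
      exact ⟨_, _, hT _ _ hU hU', hF _ _ hV hV',
        ⟨e ≪≫ₗ (e₁.prodCongr e₂) ≪≫ₗ LinearEquiv.prodProdProdComm A U V U' V'⟩⟩

open DerivedCategory

lemma homZero_stalk_prod [HasDerivedCategory.{u} (ModuleCat.{u} A)]
    {P : DerivedCategory (ModuleCat.{u} A)} {X Y : ModuleCat.{u} A} {i : ℤ}
    (hX : HomZero P (stalk.obj X) i) (hY : HomZero P (stalk.obj Y) i) :
    HomZero P (stalk.obj (ModuleCat.of A (X × Y))) i :=
  (HomZero.biprod hX hY).of_iso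
    (stalk.mapIso (ModuleCat.biprodIsoProd X Y).symm ≪≫
      haveI := preservesBinaryBiproduct_of_preservesBiproduct (stalk (C := ModuleCat.{u} A)) X Y
      stalk.mapBiprod X Y)

lemma homZero_stalk_of_subsingleton [HasDerivedCategory.{u} (ModuleCat.{u} A)]
    {P : DerivedCategory (ModuleCat.{u} A)} {X : ModuleCat.{u} A} (i : ℤ)
    (hX : Subsingleton X) : HomZero P (stalk.obj X) i := fun _ =>
  ((shiftFunctor _ i).map_isZero
    (stalk.map_isZero (ModuleCat.isZero_of_subsingleton X))).eq_of_tgt _ _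

lemma splitTorsion_of_indec [IsNoetherianRing A] [IsArtinianRing A]
    [HasDerivedCategory.{u} (ModuleCat.{u} A)]
    {P : DerivedCategory (ModuleCat.{u} A)} (hP : IsTwoTermSilting P)
    (h : ∀ X : ModuleCat.{u} A, Module.Finite A X → Indec A X →
      HomZero P (stalk.obj X) 1 ∨ HomZero P (stalk.obj X) 0) :
    SplitTorsion (fun U : FGModuleCat.{u} A => HomZero P (fgStalk.obj U) 1)
      (fun V => HomZero P (fgStalk.obj V) 0) where
  hom_eq_zero hT hF f :=
    (forget₂ (FGModuleCat.{u} A) (ModuleCat.{u} A)).map_injective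
      ((hP.hom_eq_zero_of_torsion hT hF _).trans (Functor.map_zero _ _ _).symm)
  of_iso_left e h := h.of_iso (fgStalk.mapIso e.symm)
  of_iso_right e h := h.of_iso (fgStalk.mapIso e.symm)
  exists_decomp X := by
    have : Module.Finite A X.obj := X.property
    obtain ⟨U, V, hU, hV, ⟨e⟩⟩ := exists_prod_decomp
      (fun X => homZero_stalk_of_subsingleton (P := P) 1)
      (fun X => homZero_stalk_of_subsingleton (P := P) 0)
      (fun X Y => homZero_stalk_prod) (fun X Y => homZero_stalk_prod) h X.obj Module.length_ne_top
    have hUf : Module.Finite A U := Module.Finite.of_surjective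
      (LinearMap.fst A U V ∘ₗ e.toLinearMap) (Prod.fst_surjective.comp e.surjective)
    have hVf : Module.Finite A V := Module.Finite.of_surjective
      (LinearMap.snd A U V ∘ₗ e.toLinearMap) (Prod.snd_surjective.comp e.surjective)
    refine ⟨FGModuleCat.of A U, FGModuleCat.of A V,
      fgHom (LinearMap.fst A U V ∘ₗ e.toLinearMap), fgHom (e.symm.toLinearMap ∘ₗ LinearMap.inl A U V),
      fgHom (LinearMap.snd A U V ∘ₗ e.toLinearMap), fgHom (e.symm.toLinearMap ∘ₗ LinearMap.inr A U V),
      hU, hV, ?_, ?_, ?_⟩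
    · refine fg_hom_ext (LinearMap.ext fun x => ?_)
      exact congr(($(e.apply_symm_apply (x, 0))).1)
    · refine fg_hom_ext (LinearMap.ext fun x => ?_)
      exact congr(($(e.apply_symm_apply (0, x))).2)
    · refine fg_hom_ext (LinearMap.ext fun x => ?_)
      change e.symm ((e x).1, 0) + e.symm (0, (e x).2) = x
      rw [← map_add]
      simp

end Decomposition

section Injective

universe w' v w

open DerivedCategory

variable {C : Type w} [Category.{v} C] [Abelian C] [HasDerivedCategory.{w'} C]

lemma homZero_stalk_injective (X I : C) [Injective I] {i : ℤ} (hi : 0 < i) :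
    HomZero (stalk.obj X) (stalk.obj I) i := by
  intro f
  let K := (CochainComplex.singleFunctor C 0).obj X
  simp only [← cancel_mono (((singleFunctors C).shiftIso i (-i) 0 (by lia)).hom.app _),
    Limits.zero_comp]
  exact to_singleFunctor_obj_eq_zero_of_injective (K := K) (n := 0) _ (by lia)

end Injective

section Concrete

open DerivedCategory

variable {A : Type u} [Ring A] [HasDerivedCategory.{u} (ModuleCat.{u} A)]

lemma homZero_two_of_idLEOne {X Y : ModuleCat.{u} A} (hY : IdLEOne A Y) :
    HomZero (stalk.obj X) (stalk.obj Y) 2 := by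
  obtain ⟨I₀, I₁, f, g, h₀, h₁, hf, hg, hfg⟩ := hY
  have := Module.injective_object_of_injective_module (inj := h₀)
  have := Module.injective_object_of_injective_module (inj := h₁)
  let S : ShortComplex (ModuleCat.{u} A) := ShortComplex.mk (ModuleCat.ofHom f) (ModuleCat.ofHom g)
    (ModuleCat.hom_ext (LinearMap.range_le_ker_iff.1 hfg.le))
  have hS : S.ShortExact :=
    { exact := (ShortComplex.moduleCat_exact_iff_range_eq_ker S).2 hfg
      mono_f := (ModuleCat.mono_iff_injective _).2 hf
      epi_g := (ModuleCat.epi_iff_surjective _).2 hg }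
  have h := hS.singleTriangle_distinguished
  exact HomZero.obj₁ (P := stalk.obj X) h (i := 2) (n := 1) rfl
    (homZero_stalk_injective X I₀ two_pos) (homZero_stalk_injective X I₁ one_pos)

variable {P : CochainComplex (ModuleCat.{u} A) ℤ}

lemma isTwoTermSilting_Q
    (hP2 : ∀ i : ℤ, i ≠ -1 → i ≠ 0 → Subsingleton (P.X i))
    (hsilt₁ : Subsingleton
      (((HomotopyCategory.quotient (ModuleCat.{u} A) (ComplexShape.up ℤ)).obj P) ⟶
       (((HomotopyCategory.quotient (ModuleCat.{u} A) (ComplexShape.up ℤ)).obj P)⟦(1:ℤ)⟧)))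
    (hgen : ∀ i, (HomotopyCategory.quotient (ModuleCat.{u} A) (ComplexShape.up ℤ)).obj
      ((HomologicalComplex.single (ModuleCat.{u} A) (ComplexShape.up ℤ) i).obj
        (ModuleCat.of A A)) ∈
      triThick A {(HomotopyCategory.quotient (ModuleCat.{u} A) (ComplexShape.up ℤ)).obj P})
    [P.IsStrictlyLE 0] [P.IsKProjective] :
    IsTwoTermSilting (Q.obj P) where
  isLE := inferInstance
  hom_eq_zero Y hY f := by
    obtain ⟨K, hK, ⟨e⟩⟩ := exists_iso_Q_obj_of_isLE Y (-2)
    obtain ⟨g, hg⟩ := Q_map_surjective P K (f ≫ e.hom)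
    have hg₀ : g = 0 := by
      ext1 i
      by_cases hi : -2 < i
      · exact (K.isZero_of_isStrictlyLE (-2) i hi).eq_of_tgt _ _
      · have := hP2 i (by lia) (by lia)
        exact (ModuleCat.isZero_of_subsingleton (P.X i)).eq_of_src _ _
    rw [← cancel_mono e.hom, ← hg, hg₀, Functor.map_zero, zero_comp]
  homZero_one f := by
    obtain ⟨g, hg⟩ := Q_map_surjective P (P⟦(1 : ℤ)⟧) (f ≫ (Q.commShiftIso (1 : ℤ)).inv.app P)
    have hg₀ : (HomotopyCategory.quotient (ModuleCat.{u} A) (ComplexShape.up ℤ)).map g = 0 := by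
      rw [← cancel_mono (((HomotopyCategory.quotient (ModuleCat.{u} A)
        (ComplexShape.up ℤ)).commShiftIso (1 : ℤ)).hom.app P)]
      exact hsilt₁.elim _ _
    rw [← cancel_mono ((Q.commShiftIso (1 : ℤ)).inv.app P), ← hg, Q_map_eq_zero hg₀, zero_comp]
  isZero := isZero_of_triThick hgen

lemma isSeparatingSilting_Q (k : Type u) [CommRing k] [IsArtinianRing k] [Algebra k A]
    [Module.Finite k A] [IsNoetherianRing A]
    (hPproj : ∀ i, Module.Projective A (P.X i))
    (hPfin : ∀ i, Module.Finite A (P.X i))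
    (hP2 : ∀ i : ℤ, i ≠ -1 → i ≠ 0 → Subsingleton (P.X i))
    (hsilt₁ : Subsingleton
      (((HomotopyCategory.quotient (ModuleCat.{u} A) (ComplexShape.up ℤ)).obj P) ⟶
       (((HomotopyCategory.quotient (ModuleCat.{u} A) (ComplexShape.up ℤ)).obj P)⟦(1:ℤ)⟧)))
    (hgen : ∀ i, (HomotopyCategory.quotient (ModuleCat.{u} A) (ComplexShape.up ℤ)).obj
      ((HomologicalComplex.single (ModuleCat.{u} A) (ComplexShape.up ℤ) i).obj
        (ModuleCat.of A A)) ∈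
      triThick A {(HomotopyCategory.quotient (ModuleCat.{u} A) (ComplexShape.up ℤ)).obj P})
    (hsep : ∀ X : ModuleCat.{u} A, Module.Finite A X → Indec A X →
      HomZero (Q.obj P) (stalk.obj X) 1 ∨ HomZero (Q.obj P) (stalk.obj X) 0)
    (hid : ∀ X : ModuleCat.{u} A, Module.Finite A X → HomZero (Q.obj P) (stalk.obj X) 0 →
      IdLEOne A X) :
    IsSeparatingSilting (Q.obj P) ∧ ∃ _ : Algebra k (End (Q.obj P)),
      Module.Finite k (End (Q.obj P)) := by
  have hle : P.IsStrictlyLE 0 := (CochainComplex.isStrictlyLE_iff _ _).2 fun i hi =>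
    have := hP2 i (by lia) (by lia)
    ModuleCat.isZero_of_subsingleton (P.X i)
  have (i : ℤ) : Projective (P.X i) :=
    have := hPproj i
    inferInstance
  have := P.isKProjective_of_projective 0
  have := IsArtinianRing.of_finite k A
  open scoped ModuleCat.Algebra in
  have hfin : Module.Finite k (End (Q.obj P)) := finite_Q_hom k P P hP2
  have hs := isTwoTermSilting_Q hP2 hsilt₁ hgen
  refine ⟨{ toIsTwoTermSilting := hs
            noetherian := isNoetherianRing_of_finite k _
            finite_hom := fun U i => ?_
            finite_homology := finite_homologyFunctor P
            split := splitTorsion_of_indec hs hsep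
            ext_two := fun U V hV => homZero_two_of_idLEOne (hid V.obj V.property hV) }, _, hfin⟩
  have : Module.Finite A U.obj := U.property
  let K := (CochainComplex.singleFunctor (ModuleCat.{u} A) 0).obj U.obj
  have hK (j : ℤ) : Module.Finite A ((K⟦i⟧).X j) := finite_single U.obj 0 (j + i)
  have := finite_Q_hom k P (K⟦i⟧) hP2
  have : Module.Finite (End (Q.obj P))ᵐᵒᵖ ((preadditiveCoyonedaObj (Q.obj P)).obj
      ((shiftFunctor (CochainComplex (ModuleCat.{u} A) ℤ) i ⋙ Q).obj K)) :=
    finite_coyoneda (k := k) (Q.obj P) (Q.obj (K⟦i⟧))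
  exact Module.Finite.equiv ((preadditiveCoyonedaObj (Q.obj P)).mapIso
    ((Q.commShiftIso i).app K)).toLinearEquiv

end Concrete

end Paper

end

open Paper CategoryTheory in
/-- Let `P` be a 2-term separating silting complex of finitely
generated projective `A`-modules (degrees `-1, 0`), and `B = End_{D^b(A)}(P)`.
If every module in the torsion-free class `ℱ(P)` has injective dimension at
most `1`, then `ed(A) = ed(B)`. -/
theorem stmt8 (k : Type u) [CommRing k] [IsArtinianRing k]
    (A : Type u) [Ring A] [Algebra k A] [Module.Finite k A]
    [HasDerivedCategory.{u} (ModuleCat.{u} A)]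
    (P : CochainComplex (ModuleCat.{u} A) ℤ)
    (hPproj : ∀ i, Module.Projective A (P.X i))
    (hPfin : ∀ i, Module.Finite A (P.X i))
    (hP2 : ∀ i : ℤ, i ≠ -1 → i ≠ 0 → Subsingleton (P.X i))
    -- `P` is silting:
    (hsilt₁ : Subsingleton
      (((HomotopyCategory.quotient (ModuleCat.{u} A) (ComplexShape.up ℤ)).obj P) ⟶
       (((HomotopyCategory.quotient (ModuleCat.{u} A) (ComplexShape.up ℤ)).obj P)⟦(1:ℤ)⟧)))
    (hsilt₂ : triThick A
        {((HomotopyCategory.quotient (ModuleCat.{u} A) (ComplexShape.up ℤ)).obj P)} =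
      {X | ∃ Q : CochainComplex (ModuleCat.{u} A) ℤ,
        (∀ i, Module.Projective A (Q.X i)) ∧ (∀ i, Module.Finite A (Q.X i)) ∧
        (∃ a b : ℤ, ∀ i, (i < a ∨ b < i) → Subsingleton (Q.X i)) ∧
        Nonempty (X ≅ (HomotopyCategory.quotient (ModuleCat.{u} A)
          (ComplexShape.up ℤ)).obj Q)})
    -- the torsion pair induced by `P`:
    (𝒯 ℱ : Set (ModuleCat.{u} A))
    (h𝒯 : 𝒯 = {U : ModuleCat.{u} A | Module.Finite A U ∧ Subsingleton
      ((DerivedCategory.Q.obj P) ⟶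
        (((DerivedCategory.singleFunctor (ModuleCat.{u} A) 0).obj U)⟦(1:ℤ)⟧))})
    (hℱ : ℱ = {V : ModuleCat.{u} A | Module.Finite A V ∧ Subsingleton
      ((DerivedCategory.Q.obj P) ⟶
        ((DerivedCategory.singleFunctor (ModuleCat.{u} A) 0).obj V))})
    -- `P` is separating:
    (hsep : ∀ X : ModuleCat.{u} A, Module.Finite A X → Indec A X → X ∈ 𝒯 ∪ ℱ)
    -- every module in `ℱ(P)` has injective dimension at most 1:
    (hid : ∀ X ∈ ℱ, IdLEOne A X) :
    extDim A = extDim (CategoryTheory.End (DerivedCategory.Q.obj P)) := by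
  have hA := isNoetherianRing_of_finite k A
  have hgen (i : ℤ) : (HomotopyCategory.quotient (ModuleCat.{u} A) (ComplexShape.up ℤ)).obj
      ((HomologicalComplex.single (ModuleCat.{u} A) (ComplexShape.up ℤ) i).obj
        (ModuleCat.of A A)) ∈
      triThick A {(HomotopyCategory.quotient (ModuleCat.{u} A) (ComplexShape.up ℤ)).obj P} := by
    rw [hsilt₂]
    exact ⟨_, fun j => projective_single _ i j, fun j => finite_single _ i j,
      ⟨i, i, fun j hj => ModuleCat.subsingleton_of_isZero
        (HomologicalComplex.isZero_single_obj_X (ComplexShape.up ℤ) i _ j (by omega))⟩,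
      ⟨Iso.refl _⟩⟩
  obtain ⟨hS, _, hB⟩ := isSeparatingSilting_Q k hPproj hPfin hP2 hsilt₁ hgen
    (fun X hX hX' => by
      have := hsep X hX hX'
      rw [h𝒯, hℱ] at this
      refine this.imp (fun h f => h.2.elim _ _) fun h => ?_
      exact HomZero.zero_iff.2 fun f => h.2.elim _ _)
    fun X hX h => hid X <| by
      rw [hℱ]
      exact ⟨hX, ⟨fun f g => (HomZero.zero_iff.1 h f).trans (HomZero.zero_iff.1 h g).symm⟩⟩
  have := isNoetherianRing_of_finite k (End (DerivedCategory.Q.obj P))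
  have := hS.noetherian
  obtain ⟨J, hJ⟩ := exists_isInjCogen k A
  obtain ⟨J', hJ'⟩ := exists_isInjCogen k (End (DerivedCategory.Q.obj P))ᵐᵒᵖ
  exact extDim_eq_of_extLE_iff fun n =>
    (hS.extLE_iff hJ hJ' n).trans (extLE_mulOpposite_iff k _ n)
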